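/- Let n ≥ 1. For a graph G on vertex set {1,…,n}, let R(G) denote the number of sets C ⊆ {1,…,n} such that (G,C) is a unipolar arrangement, plus the number of sets C ⊆ {1,…,n} such that (Ḡ,C) is a unipolar arrangement (Ḡ the complement of G). Then the total variation distance between the uniform distribution on 𝒫_n and the generated distribution assigning probability R(G)/(2𝓛_n) to each graph G on {1,…,n}, namely (1/2)·Σ_G |𝟙[G ∈ 𝒫_n]/|𝒫_n| − R(G)/(2𝓛_n)| (sum over all graphs G on vertex set {1,…,n}), is e^{−Θ(n)}: there exist constants c > 0, C > 0 and n₀ such that for all n ≥ n₀ this quantity is at least e^{−Cn} and at most e^{−cn}. -/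

import Mathlib

open scoped Classical
open Filter

noncomputable section

/-- A finite simple graph is perfect if every induced subgraph has chromatic number
equal to clique number. -/
def IsPerfect {V : Type*} (G : SimpleGraph V) : Prop :=
  ∀ s : Set V, (G.induce s).chromaticNumber = ((G.induce s).cliqueNum : ℕ∞)

/-- `(G, C)` is a unipolar arrangement: `C` is a clique (the central clique) and every
connected component of the subgraph induced on the complement of `C` is a clique. -/
def IsUnipolarArrangement {V : Type*} (G : SimpleGraph V) (C : Set V) : Prop :=
  G.IsClique C ∧
    ∀ u v : (Cᶜ : Set V), (G.induce Cᶜ).Reachable u v → u ≠ v → (G.induce Cᶜ).Adj u v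

def IsUnipolar {V : Type*} (G : SimpleGraph V) : Prop :=
  ∃ C : Set V, IsUnipolarArrangement G C

def IsCoUnipolar {V : Type*} (G : SimpleGraph V) : Prop := IsUnipolar Gᶜ

def IsGenSplit {V : Type*} (G : SimpleGraph V) : Prop := IsUnipolar G ∨ IsCoUnipolar G

/-- the `m`-th Bell number: the number of partitions of an `m`-element set. -/
def bell (m : ℕ) : ℕ := Nat.card (Finpartition (Finset.univ : Finset (Fin m)))

/-- `ℓ_{n,k} = C(n,k) · 2^{k(n-k)} · B_{n-k}` -/
def ell (n k : ℕ) : ℕ := Nat.choose n k * 2 ^ (k * (n - k)) * bell (n - k)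

/-- `𝓛_n = Σ_{k=0}^n ℓ_{n,k}` -/
def scrL (n : ℕ) : ℕ := ∑ k ∈ Finset.range (n + 1), ell n k

/-- the number of perfect graphs on `{1,…,n}` -/
def perfectCount (n : ℕ) : ℕ := Nat.card {G : SimpleGraph (Fin n) // IsPerfect G}

/-- independence number -/
def indepNum {V : Type*} (G : SimpleGraph V) : ℕ := Gᶜ.cliqueNum

/-- `R(G)`: the number of sets `C` such that `(G, C)` is a unipolar arrangement, plus the
number of sets `C` such that `(Gᶜ, C)` is a unipolar arrangement. -/
def genR {n : ℕ} (G : SimpleGraph (Fin n)) : ℕ :=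
  Nat.card {C : Set (Fin n) // IsUnipolarArrangement G C} +
    Nat.card {C : Set (Fin n) // IsUnipolarArrangement Gᶜ C}

/-- `G` has no induced five-cycle. -/
def C5Free {V : Type*} (G : SimpleGraph V) : Prop :=
  ∀ a b c d e, G.Adj a b → G.Adj b c → G.Adj c d → G.Adj d e → G.Adj e a →
    ¬G.Adj a c → ¬G.Adj b d → ¬G.Adj c e → ¬G.Adj d a → ¬G.Adj e b → False

/-- adjacency is transitive on `S`: the subgraph induced on `S` is a disjoint union of cliques. -/
def P3Free {V : Type*} (G : SimpleGraph V) (S : Set V) : Prop :=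
  ∀ x ∈ S, ∀ y ∈ S, ∀ z ∈ S, G.Adj x y → G.Adj y z → x ≠ z → G.Adj x z

theorem C5Free.compl {V : Type*} {G : SimpleGraph V} (h : C5Free G) : C5Free Gᶜ := by
  intro a b c d e hab hbc hcd hde hea hac hbd hce hda heb
  simp only [SimpleGraph.compl_adj, not_and, not_not] at *
  have h1 : a ≠ c := by rintro rfl; exact hcd.2 (hda hcd.1.symm).symm
  have h2 : b ≠ d := by rintro rfl; exact hde.2 (heb hde.1.symm).symm
  have h3 : c ≠ e := by rintro rfl; exact hea.2 (hac hea.1.symm).symm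
  have h4 : d ≠ a := by rintro rfl; exact hab.2 (hbd hab.1.symm).symm
  have h5 : e ≠ b := by rintro rfl; exact hbc.2 (hce hbc.1.symm).symm
  exact h a c e b d (hac h1) (hce h3) (heb h5) (hbd h2) (hda h4) (fun h => hea.2 h.symm)
    (fun h => hbc.2 h.symm) (fun h => hde.2 h.symm) (fun h => hab.2 h.symm) (fun h => hcd.2 h.symm)

theorem isUnipolarArrangement_iff {V : Type*} (G : SimpleGraph V) (C : Set V) :
    IsUnipolarArrangement G C ↔ G.IsClique C ∧ P3Free G Cᶜ := by
  unfold IsUnipolarArrangement P3Free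
  refine and_congr_right fun _ => ⟨fun h x hx y hy z hz hxy hyz hne => ?_, fun h u v huv => ?_⟩
  · have h1 : (G.induce Cᶜ).Adj ⟨x, hx⟩ ⟨y, hy⟩ := hxy
    have h2 : (G.induce Cᶜ).Adj ⟨y, hy⟩ ⟨z, hz⟩ := hyz
    exact h ⟨x, hx⟩ ⟨z, hz⟩ (h1.reachable.trans h2.reachable) (by simpa using hne)
  · rw [SimpleGraph.reachable_iff_reflTransGen] at huv
    induction huv with
    | refl => simp
    | @tail b c _ hbc ih =>
      intro hne
      by_cases hub : u = b
      · subst hub; exact hbc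
      · exact h u u.2 b b.2 c c.2 (ih hub) hbc (by simpa [Subtype.ext_iff] using hne)

theorem IsPerfect.c5Free {V : Type*} {G : SimpleGraph V} (h : IsPerfect G) : C5Free G := by
  intro a b c d e hab hbc hcd hde hea hac hbd hce hda heb
  have := h {a, b, c, d, e}
  set H := G.induce ({a, b, c, d, e} : Set V) with hH
  have hfin : Finite ({a, b, c, d, e} : Set V) := Set.toFinite _
  have hcl : H.cliqueNum ≤ 2 := by
    have := Fintype.ofFinite ({a, b, c, d, e} : Set V)
    obtain ⟨t, ht⟩ := H.exists_isNClique_cliqueNum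
    by_contra! hlt
    rw [← ht.card_eq, Finset.two_lt_card] at hlt
    obtain ⟨x, hx, y, hy, z, hz, hxy, hxz, hyz⟩ := hlt
    have h1 : G.Adj x y := ht.isClique hx hy hxy
    have h2 : G.Adj x z := ht.isClique hx hz hxz
    have h3 : G.Adj y z := ht.isClique hy hz hyz
    obtain ⟨x, hx'⟩ := x
    obtain ⟨y, hy'⟩ := y
    obtain ⟨z, hz'⟩ := z
    simp only [Set.mem_insert_iff, Set.mem_singleton_iff] at hx' hy' hz'
    simp only at h1 h2 h3
    clear hx hy hz hxy hxz hyz ht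
    clear this
    clear hfin
    clear h hH
    rcases hx' with rfl | rfl | rfl | rfl | rfl <;> rcases hy' with rfl | rfl | rfl | rfl | rfl <;>
      first
      | exact h1.ne rfl
      | exact absurd h1 ‹_›
      | exact absurd h1.symm ‹_›
      | (rcases hz' with rfl | rfl | rfl | rfl | rfl <;>
          first
          | exact h2.ne rfl
          | exact h3.ne rfl
          | exact absurd h2 ‹_›
          | exact absurd h2.symm ‹_›
          | exact absurd h3 ‹_›
          | exact absurd h3.symm ‹_›)
  have hcol : H.Colorable 2 := by
    rw [← SimpleGraph.chromaticNumber_le_iff_colorable, this]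
    exact_mod_cast hcl
  obtain ⟨col⟩ := hcol
  have key : ∀ x y (hx : x ∈ ({a, b, c, d, e} : Set V)) (hy : y ∈ ({a, b, c, d, e} : Set V)),
      G.Adj x y → col ⟨x, hx⟩ ≠ col ⟨y, hy⟩ := fun x y hx hy hxy => col.valid hxy
  have k1 := key a b (by simp) (by simp) hab
  have k2 := key b c (by simp) (by simp) hbc
  have k3 := key c d (by simp) (by simp) hcd
  have k4 := key d e (by simp) (by simp) hde
  have k5 := key e a (by simp) (by simp) hea
  generalize col ⟨a, _⟩ = a' at *
  generalize col ⟨b, _⟩ = b' at *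
  generalize col ⟨c, _⟩ = c' at *
  generalize col ⟨d, _⟩ = d' at *
  generalize col ⟨e, _⟩ = e' at *
  clear key this hcl
  revert a' b' c' d' e'
  decide

theorem isPerfect_of_colorable {V : Type*} [Finite V] {G : SimpleGraph V}
    (h : ∀ s : Set V, (G.induce s).Colorable (G.induce s).cliqueNum) : IsPerfect G := by
  intro s
  have := Fintype.ofFinite V
  apply le_antisymm
  · rw [SimpleGraph.chromaticNumber_le_iff_colorable]; exact h s
  · exact SimpleGraph.cliqueNum_le_chromaticNumber

theorem exists_list_coloring {W : Type*} [Fintype W] {H : SimpleGraph W} {C : Finset W}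
    (hC : H.IsClique C) (κ : C → Fin H.cliqueNum) (hκ : Function.Injective κ)
    (S : Finset W) (hS : H.IsClique S) (hSC : Disjoint S C) :
    ∃ f : W → Fin H.cliqueNum, Set.InjOn f S ∧ ∀ u ∈ S, ∀ c : C, H.Adj u c → f u ≠ κ c := by
  rcases S.eq_empty_or_nonempty with rfl | ⟨s0, hs0⟩
  · by_cases hw : Nonempty W
    · obtain ⟨w⟩ := hw
      have : 0 < H.cliqueNum := by
        have : H.IsClique (({w} : Finset W) : Set W) := by simp
        have := this.card_le_cliqueNum
        simp at this; omega
      exact ⟨fun _ => ⟨0, this⟩, by simp, by simp⟩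
    · exact ⟨fun w => absurd ⟨w⟩ hw, by simp, by simp⟩
  let t : S → Finset (Fin H.cliqueNum) := fun u =>
    Finset.univ.filter fun i => ∀ c : C, H.Adj u c → i ≠ κ c
  have hall : ∀ X : Finset S, X.card ≤ (X.biUnion t).card := by
    intro X
    rcases X.eq_empty_or_nonempty with rfl | ⟨x0, hx0⟩
    · simp
    let D : Finset C := Finset.univ.filter fun c => ∀ u ∈ X, H.Adj u c
    have h1 : (X.biUnion t)ᶜ ⊆ D.image κ := by
      intro i hi
      simp only [Finset.mem_compl, Finset.mem_biUnion, not_exists, not_and, t, Finset.mem_filter,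
        Finset.mem_univ, true_and, not_forall, not_not] at hi
      obtain ⟨c, hc, hic⟩ := hi x0 hx0
      simp only [Finset.mem_image, D, Finset.mem_filter, Finset.mem_univ, true_and]
      refine ⟨c, fun u hu => ?_, hic.symm⟩
      obtain ⟨c', hc', hic'⟩ := hi u hu
      have : c = c' := hκ (hic.symm.trans hic')
      subst this; exact hc'
    have h2 : ((X.biUnion t)ᶜ).card ≤ D.card :=
      (Finset.card_le_card h1).trans Finset.card_image_le
    have hdisj : Disjoint (X.map (Function.Embedding.subtype _)) (D.map (Function.Embedding.subtype _)) := by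
      rw [Finset.disjoint_left]
      intro a ha hb
      simp only [Finset.mem_map, Function.Embedding.subtype_apply] at ha hb
      obtain ⟨a, _, rfl⟩ := ha
      obtain ⟨b, _, hb⟩ := hb
      exact Finset.disjoint_left.1 hSC a.2 (hb ▸ b.2)
    have hcl : H.IsClique (((X.map (Function.Embedding.subtype _)) ∪
        (D.map (Function.Embedding.subtype _)) : Finset W) : Set W) := by
      intro a ha b hb hab
      simp only [Finset.coe_union, Finset.coe_map, Function.Embedding.subtype_apply, Set.mem_union,
        Set.mem_image, Finset.mem_coe] at ha hb
      rcases ha with ⟨a, ha, rfl⟩ | ⟨a, ha, rfl⟩ <;> rcases hb with ⟨b, hb, rfl⟩ | ⟨b, hb, rfl⟩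
      · exact hS a.2 b.2 hab
      · exact (Finset.mem_filter.1 hb).2 a ha
      · exact ((Finset.mem_filter.1 ha).2 b hb).symm
      · exact hC a.2 b.2 hab
    have h3 := hcl.card_le_cliqueNum
    rw [Finset.card_union_of_disjoint hdisj, Finset.card_map, Finset.card_map] at h3
    have h4 := Finset.card_compl_add_card (X.biUnion t)
    rw [Fintype.card_fin] at h4
    omega
  obtain ⟨f, hf, hft⟩ := (Finset.all_card_le_biUnion_card_iff_exists_injective t).1 hall
  refine ⟨fun w => if h : w ∈ S then f ⟨w, h⟩ else f ⟨s0, hs0⟩, ?_, ?_⟩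
  · intro a ha b hb hab
    simp only [Finset.mem_coe] at ha hb
    simp only [ha, hb, dif_pos] at hab
    simpa using hf hab
  · intro u hu c huc
    simp only [hu, dif_pos]
    exact (Finset.mem_filter.1 (hft ⟨u, hu⟩)).2 c huc

theorem colorable_of_arrangement {W : Type*} [Finite W] {H : SimpleGraph W} {C : Set W}
    (hC : H.IsClique C) (hP : P3Free H Cᶜ) : H.Colorable H.cliqueNum := by
  have := Fintype.ofFinite W
  have hC' : H.IsClique (C.toFinset : Set W) := by simpa using hC
  obtain ⟨κ⟩ : Nonempty (C.toFinset ↪ Fin H.cliqueNum) := by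
    apply Function.Embedding.nonempty_of_card_le
    simpa using hC'.card_le_cliqueNum
  let bl : W → Finset W := fun v => Finset.univ.filter fun u => u ∉ C ∧ v ∉ C ∧ (u = v ∨ H.Adj v u)
  have hbl : ∀ v, H.IsClique (bl v : Set W) := by
    intro v a ha b hb hab
    simp only [bl, Finset.coe_filter, Finset.mem_univ, true_and, Set.mem_ofPred_eq] at ha hb
    obtain ⟨ha, hv, ha'⟩ := ha
    obtain ⟨hb, -, hb'⟩ := hb
    rcases ha' with rfl | ha' <;> rcases hb' with rfl | hb'
    · exact absurd rfl hab
    · exact hb'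
    · exact ha'.symm
    · exact hP a ha v hv b hb ha'.symm hb' hab
  have hdis : ∀ v, Disjoint (bl v) C.toFinset := by
    intro v; rw [Finset.disjoint_left]; intro a ha
    simp only [bl, Finset.mem_filter] at ha
    simpa using ha.2.1
  have hex : ∀ S : Finset W, ∃ f : W → Fin H.cliqueNum, H.IsClique S → Disjoint S C.toFinset →
      Set.InjOn f S ∧ ∀ u ∈ S, ∀ c : C.toFinset, H.Adj u c → f u ≠ κ c := by
    intro S
    by_cases h : H.IsClique S ∧ Disjoint S C.toFinset
    · obtain ⟨f, hf⟩ := exists_list_coloring hC' κ κ.injective S h.1 h.2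
      exact ⟨f, fun _ _ => hf⟩
    · by_cases hw : Nonempty (Fin H.cliqueNum)
      · exact ⟨fun _ => hw.some, fun h1 h2 => absurd ⟨h1, h2⟩ h⟩
      · obtain ⟨f, -⟩ := exists_list_coloring hC' κ κ.injective ∅ (by simp) (by simp)
        exact ⟨f, fun h1 h2 => absurd ⟨h1, h2⟩ h⟩
  choose F hF using hex
  have hf1 := fun v => (hF (bl v) (hbl v) (hdis v)).1
  have hf2 := fun v => (hF (bl v) (hbl v) (hdis v)).2
  have hself : ∀ v, v ∉ C → v ∈ bl v := fun v hv => by simp [bl, hv]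
  have heq : ∀ u v, u ∉ C → v ∉ C → H.Adj u v → bl u = bl v := by
    intro u v hu hv huv
    ext w
    simp only [bl, Finset.mem_filter, Finset.mem_univ, true_and, hu, hv, not_false_eq_true]
    refine and_congr_right fun hw => ⟨?_, ?_⟩
    · rintro (rfl | h)
      · exact Or.inr huv.symm
      · by_cases hwv : w = v
        · exact Or.inl hwv
        · exact Or.inr (hP v hv u hu w hw huv.symm h (Ne.symm hwv))
    · rintro (rfl | h)
      · exact Or.inr huv
      · by_cases hwv : w = u
        · exact Or.inl hwv
        · exact Or.inr (hP u hu v hv w hw huv h (Ne.symm hwv))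
  refine ⟨SimpleGraph.Coloring.mk
    (fun v => if h : v ∈ C then κ ⟨v, by simpa using h⟩ else F (bl v) v) ?_⟩
  intro u v huv
  by_cases hu : u ∈ C <;> by_cases hv : v ∈ C
  · simp only [hu, hv, dif_pos]
    intro h; exact huv.ne (by simpa using κ.injective h)
  · simp only [hu, hv, dif_pos, dif_neg, not_false_eq_true]
    exact (hf2 v v (hself v hv) ⟨u, by simpa using hu⟩ huv.symm).symm
  · simp only [hu, hv, dif_pos, dif_neg, not_false_eq_true]
    exact hf2 u u (hself u hu) ⟨v, by simpa using hv⟩ huv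
  · simp only [hu, hv, dif_neg, not_false_eq_true]
    have he := heq u v hu hv huv
    rw [he]
    intro h
    exact huv.ne (hf1 v (he ▸ hself u hu) (hself v hv) h)

theorem IsUnipolar.isPerfect {V : Type*} [Finite V] {G : SimpleGraph V} (h : IsUnipolar G) :
    IsPerfect G := by
  obtain ⟨C, hC⟩ := h
  rw [isUnipolarArrangement_iff] at hC
  refine isPerfect_of_colorable fun s => colorable_of_arrangement (C := {x | (x : V) ∈ C}) ?_ ?_
  · intro a ha b hb hab
    exact hC.1 ha hb (by simpa [Subtype.ext_iff] using hab)
  · intro x hx y hy z hz hxy hyz hne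
    exact hC.2 x hx y hy z hz hxy hyz (by simpa [Subtype.ext_iff] using hne)

theorem colorable_of_co_arrangement {W : Type*} [Finite W] {H : SimpleGraph W} {C : Set W}
    (hC : Hᶜ.IsClique C) (hP : P3Free Hᶜ Cᶜ) : H.Colorable H.cliqueNum := by
  have := Fintype.ofFinite W
  let r : Setoid (Cᶜ : Set W) :=
    { r := fun x y => ¬H.Adj x y
      iseqv := ⟨fun x => by simp, fun {x y} h => fun h' => h h'.symm, fun {x y z} h1 h2 => by
        by_cases hxy : x = y
        · subst hxy; exact h2
        by_cases hyz : y = z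
        · subst hyz; exact h1
        by_cases hxz : x = z
        · subst hxz; simp
        have := hP x x.2 y y.2 z z.2
          ⟨fun h => hxy (Subtype.ext h), h1⟩
          ⟨fun h => hyz (Subtype.ext h), h2⟩
          (by simpa [Subtype.ext_iff] using hxz)
        exact this.2⟩ }
  have hr : ∀ x y : (Cᶜ : Set W), (Quotient.mk r x = Quotient.mk r y) ↔ ¬H.Adj x y :=
    fun x y => Quotient.eq (r := r)
  by_cases hc : ∃ c ∈ C, ∀ q : Quotient r, ∃ x : (Cᶜ : Set W), Quotient.mk r x = q ∧ H.Adj c x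
  · obtain ⟨c, hcC, hc⟩ := hc
    choose x hx1 hx2 using hc
    let f : Option (Quotient r) → W := fun o => o.elim c fun q => x q
    have hadj : ∀ p q, p ≠ q → H.Adj (f p) (f q) := by
      rintro (_ | p) (_ | q) hpq
      · exact absurd rfl hpq
      · exact hx2 q
      · exact (hx2 p).symm
      · by_contra h
        apply hpq
        rw [← hx1 p, ← hx1 q]
        exact congrArg some ((hr _ _).2 h)
    have hinj : Function.Injective f := fun p q h => by
      by_contra hne; exact (hadj p q hne).ne h
    have hcl : H.IsClique ((Finset.univ.map ⟨f, hinj⟩ : Finset W) : Set W) := by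
      intro a ha b hb hab
      simp only [Finset.coe_map, Function.Embedding.coeFn_mk, Finset.coe_univ, Set.image_univ,
        Set.mem_range] at ha hb
      obtain ⟨p, rfl⟩ := ha
      obtain ⟨q, rfl⟩ := hb
      exact hadj p q fun h => hab (by rw [h])
    have hle := hcl.card_le_cliqueNum
    rw [Finset.card_map, Finset.card_univ] at hle
    refine SimpleGraph.Colorable.mono hle (SimpleGraph.Coloring.colorable
      (SimpleGraph.Coloring.mk (fun v => if h : v ∈ C then none else some (Quotient.mk r ⟨v, h⟩)) ?_))
    intro u v huv
    by_cases hu : u ∈ C <;> by_cases hv : v ∈ C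
    · exact absurd huv (hC hu hv huv.ne).2
    · simp [hu, hv]
    · simp [hu, hv]
    · simp only [hu, hv, dif_neg, not_false_eq_true]
      intro h
      exact (hr _ _).1 (Option.some.inj h) huv
  · have hc' : ∀ c : C, ∃ q : Quotient r, ∀ x : (Cᶜ : Set W), H.Adj c x → Quotient.mk r x ≠ q := by
      intro c
      by_contra! h
      exact hc ⟨c, c.2, fun q => by obtain ⟨x, h1, h2⟩ := h q; exact ⟨x, h2, h1⟩⟩
    choose Q hQ using hc'
    let f : Quotient r → W := fun q => q.out
    have hadj : ∀ p q, p ≠ q → H.Adj (f p) (f q) := by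
      intro p q hpq
      by_contra h
      apply hpq
      rw [← Quotient.out_eq p, ← Quotient.out_eq q]
      exact (hr _ _).2 h
    have hinj : Function.Injective f := fun p q h => by
      by_contra hne; exact (hadj p q hne).ne h
    have hcl : H.IsClique ((Finset.univ.map ⟨f, hinj⟩ : Finset W) : Set W) := by
      intro a ha b hb hab
      simp only [Finset.coe_map, Function.Embedding.coeFn_mk, Finset.coe_univ, Set.image_univ,
        Set.mem_range] at ha hb
      obtain ⟨p, rfl⟩ := ha
      obtain ⟨q, rfl⟩ := hb
      exact hadj p q fun h => hab (by rw [h])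
    have hle := hcl.card_le_cliqueNum
    rw [Finset.card_map, Finset.card_univ] at hle
    refine SimpleGraph.Colorable.mono hle (SimpleGraph.Coloring.colorable
      (SimpleGraph.Coloring.mk (fun v => if h : v ∈ C then Q ⟨v, h⟩ else (Quotient.mk r ⟨v, h⟩)) ?_))
    intro u v huv
    by_cases hu : u ∈ C <;> by_cases hv : v ∈ C
    · exact absurd huv (hC hu hv huv.ne).2
    · simp only [hu, hv, dif_neg, dif_pos, not_false_eq_true]
      exact (hQ ⟨u, hu⟩ ⟨v, hv⟩ huv).symm
    · simp only [hu, hv, dif_neg, dif_pos, not_false_eq_true]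
      exact hQ ⟨v, hv⟩ ⟨u, hu⟩ huv.symm
    · simp only [hu, hv, dif_neg, not_false_eq_true]
      intro h
      exact (hr _ _).1 h huv

theorem IsCoUnipolar.isPerfect {V : Type*} [Finite V] {G : SimpleGraph V} (h : IsCoUnipolar G) :
    IsPerfect G := by
  obtain ⟨C, hC⟩ := h
  rw [isUnipolarArrangement_iff] at hC
  refine isPerfect_of_colorable fun s => colorable_of_co_arrangement (C := {x | (x : V) ∈ C}) ?_ ?_
  · intro a ha b hb hab
    have := hC.1 ha hb (by simpa [Subtype.ext_iff] using hab)
    exact ⟨hab, this.2⟩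
  · intro x hx y hy z hz hxy hyz hne
    have := hC.2 x hx y hy z hz ⟨by simpa [Subtype.ext_iff] using hxy.1, hxy.2⟩
      ⟨by simpa [Subtype.ext_iff] using hyz.1, hyz.2⟩ (by simpa [Subtype.ext_iff] using hne)
    exact ⟨hne, this.2⟩

theorem IsGenSplit.isPerfect {V : Type*} [Finite V] {G : SimpleGraph V} (h : IsGenSplit G) :
    IsPerfect G := h.elim IsUnipolar.isPerfect IsCoUnipolar.isPerfect

theorem ncard_exists_le {ι α : Type*} [Fintype ι] [Finite α] (P : ι → α → Prop) (m : ℝ)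
    (h : ∀ i, ({x | P i x}.ncard : ℝ) ≤ m) :
    ({x | ∃ i, P i x}.ncard : ℝ) ≤ Fintype.card ι * m := by
  have := Fintype.ofFinite α
  have h1 : {x | ∃ i, P i x} =
      ((Finset.univ.biUnion fun i => Finset.univ.filter (P i) : Finset α) : Set α) := by
    ext x; simp
  rw [h1, Set.ncard_coe_finset]
  have h2 : ∀ i, (((Finset.univ.filter (P i)).card : ℕ) : ℝ) ≤ m := by
    intro i
    have := h i
    rwa [show {x | P i x} = ((Finset.univ.filter (P i) : Finset α) : Set α) by ext x; simp,
      Set.ncard_coe_finset] at this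
  calc (((Finset.univ.biUnion fun i => Finset.univ.filter (P i)).card : ℕ) : ℝ)
      ≤ ((∑ i, (Finset.univ.filter (P i)).card : ℕ) : ℝ) := by
        exact_mod_cast Finset.card_biUnion_le
    _ ≤ ∑ i : ι, m := by push_cast; exact Finset.sum_le_sum fun i _ => h2 i
    _ = Fintype.card ι * m := by simp

theorem ncard_le_mul_of_fiber {α β : Type*} [Finite α] [Finite β] (S : Set α) (T : Set β)
    (f : α → β) (hf : ∀ x ∈ S, f x ∈ T) (m : ℝ)
    (h : ∀ y ∈ T, ({x | x ∈ S ∧ f x = y}.ncard : ℝ) ≤ m) :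
    (S.ncard : ℝ) ≤ T.ncard * m := by
  have := Fintype.ofFinite α
  have := Fintype.ofFinite β
  have h1 : S.ncard = S.toFinset.card := Set.ncard_eq_toFinset_card' S
  have h2 : T.ncard = T.toFinset.card := Set.ncard_eq_toFinset_card' T
  rw [h1, h2, Finset.card_eq_sum_card_fiberwise (t := T.toFinset) (f := f)
    (fun x hx => by simpa using hf x (by simpa using hx))]
  push_cast
  calc _ ≤ ∑ y ∈ T.toFinset, m := by
        refine Finset.sum_le_sum fun y hy => ?_
        have := h y (by simpa using hy)
        rwa [show {x | x ∈ S ∧ f x = y} =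
          ((S.toFinset.filter (fun x => f x = y) : Finset α) : Set α) by ext x; simp,
          Set.ncard_coe_finset] at this
    _ = _ := by simp

/-- Few subsets are small. -/
theorem exists_few_small_subsets (ε : ℝ) (hε : 0 < ε) : ∃ η : ℝ, 0 < η ∧ η < 1 ∧
    ∀ {β : Type} (R : Finset β),
      (((R.powerset.filter fun Y => (Y.card : ℝ) ≤ η * R.card).card : ℕ) : ℝ) ≤
        (2 : ℝ) ^ (ε * R.card) := by
  set x : ℝ := min (1 / 2) ((2 : ℝ) ^ (ε / 2) - 1) with hx
  have hx1 : x ≤ 1 / 2 := min_le_left _ _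
  have hx2 : 1 + x ≤ (2 : ℝ) ^ (ε / 2) := by linarith [min_le_right (1 / 2) ((2 : ℝ) ^ (ε / 2) - 1)]
  have hx0 : 0 < x := by
    refine lt_min (by norm_num) ?_
    have := Real.one_lt_rpow (x := 2) (by norm_num) (half_pos hε)
    linarith
  have hl : 0 < -Real.logb 2 x := by
    have := Real.logb_neg (b := 2) (by norm_num) hx0 (by linarith)
    linarith
  refine ⟨min (1 / 2) (ε / 2 / (-Real.logb 2 x)), by positivity,
    (min_le_left _ _).trans_lt (by norm_num), fun {β} R => ?_⟩
  set η := min (1 / 2) (ε / 2 / (-Real.logb 2 x))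
  have hη : η * (-Real.logb 2 x) ≤ ε / 2 := by
    rw [← le_div_iff₀ hl]; exact min_le_right _ _
  set n : ℝ := (R.card : ℝ) with hn
  have hn0 : 0 ≤ n := Nat.cast_nonneg _
  have hsum : ∑ Y ∈ R.powerset, x ^ Y.card = (1 + x) ^ R.card := by
    have := Finset.sum_pow_mul_eq_add_pow x 1 R
    simpa [add_comm] using this
  have hlow : (((R.powerset.filter fun Y => (Y.card : ℝ) ≤ η * n).card : ℕ) : ℝ) * x ^ (η * n) ≤
      (1 + x) ^ R.card := by
    rw [← hsum, ← nsmul_eq_mul, ← Finset.sum_const]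
    refine (Finset.sum_le_sum (fun Y hY => ?_)).trans
      (Finset.sum_le_sum_of_subset_of_nonneg (Finset.filter_subset _ _)
        (fun Y _ _ => by positivity))
    rw [← Real.rpow_natCast x]
    exact Real.rpow_le_rpow_of_exponent_ge hx0 (by linarith) (Finset.mem_filter.1 hY).2
  have hxp : 0 < x ^ (η * n) := Real.rpow_pos_of_pos hx0 _
  rw [← le_div_iff₀ hxp] at hlow
  refine hlow.trans ?_
  rw [div_le_iff₀ hxp]
  have e1 : (2 : ℝ) ^ (ε * n) = 2 ^ (ε / 2 * n) * 2 ^ (ε / 2 * n) := by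
    rw [← Real.rpow_add (by norm_num)]; ring_nf
  have e2 : (1 + x) ^ R.card ≤ (2 : ℝ) ^ (ε / 2 * n) := by
    rw [Real.rpow_mul (by norm_num), hn, Real.rpow_natCast]
    exact pow_le_pow_left₀ (by linarith) hx2 _
  have e3 : 1 ≤ (2 : ℝ) ^ (ε / 2 * n) * x ^ (η * n) := by
    have : x ^ (η * n) = 2 ^ (Real.logb 2 x * (η * n)) := by
      conv_rhs => rw [Real.rpow_mul (by norm_num), Real.rpow_logb (by norm_num) (by norm_num) hx0]
    rw [this, ← Real.rpow_add (by norm_num)]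
    apply Real.one_le_rpow (by norm_num)
    nlinarith
  rw [e1, mul_assoc]
  calc (1 + x) ^ R.card ≤ 2 ^ (ε / 2 * n) * 1 := by rw [mul_one]; exact e2
    _ ≤ _ := mul_le_mul_of_nonneg_left e3 (by positivity)

theorem card_powerset_few_inter_le {β : Type} [DecidableEq β] {ε η : ℝ} {R F : Finset β} (hRF : R ⊆ F)
    (hη : (((R.powerset.filter fun Y => (Y.card : ℝ) ≤ η * R.card).card : ℕ) : ℝ) ≤
        (2 : ℝ) ^ (ε * R.card)) :
    (((F.powerset.filter fun X => ((X ∩ R).card : ℝ) ≤ η * R.card).card : ℕ) : ℝ) ≤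
      2 ^ ((F.card : ℝ) - (1 - ε) * R.card) := by
  have h1 : (F.powerset.filter fun X => ((X ∩ R).card : ℝ) ≤ η * R.card).card ≤
      ((F \ R).powerset ×ˢ (R.powerset.filter fun Y => (Y.card : ℝ) ≤ η * R.card)).card := by
    refine Finset.card_le_card_of_injOn (fun X => (X \ R, X ∩ R)) ?_ ?_
    · intro X hX
      simp only [Finset.coe_filter, Set.mem_ofPred_eq, Finset.mem_powerset] at hX
      simp only [Finset.coe_product, Set.mem_prod, Finset.mem_coe, Finset.mem_powerset,
        Finset.mem_filter]
      exact ⟨Finset.sdiff_subset_sdiff hX.1 le_rfl, Finset.inter_subset_right, hX.2⟩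
    · intro X _ Y _ h
      simp only [Prod.mk.injEq] at h
      rw [← Finset.sdiff_union_inter X R, ← Finset.sdiff_union_inter Y R, h.1, h.2]
  rw [Finset.card_product, Finset.card_powerset, Finset.card_sdiff_of_subset hRF] at h1
  have hle := Finset.card_le_card hRF
  calc _ ≤ ((2 ^ (F.card - R.card) : ℕ) : ℝ) *
        ((R.powerset.filter fun Y => (Y.card : ℝ) ≤ η * R.card).card : ℝ) := by exact_mod_cast h1
    _ ≤ ((2 ^ (F.card - R.card) : ℕ) : ℝ) * (2 : ℝ) ^ (ε * R.card) := by gcongr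
    _ = _ := by
      push_cast
      rw [← Real.rpow_natCast, ← Real.rpow_add (by norm_num), Nat.cast_sub hle]
      ring_nf

/-- Between large subsets of `A` and `B` there are many edges and many non-edges. -/
def PR {V : Type*} (G : SimpleGraph V) (A B : Finset V) (g d : ℝ) : Prop :=
  ∀ A' ⊆ A, ∀ B' ⊆ B, g ≤ (A'.card : ℝ) → g ≤ (B'.card : ℝ) → ∀ b : Bool,
    d * A'.card * B'.card ≤ (((A' ×ˢ B').filter fun p => (G.Adj p.1 p.2 ↔ b = true)).card : ℝ)

theorem PR.mono {V : Type*} {G : SimpleGraph V} {A B A₁ B₁ : Finset V} {g d g₁ d₁ : ℝ}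
    (h : PR G A B g d) (hA : A₁ ⊆ A) (hB : B₁ ⊆ B) (hg : g ≤ g₁) (hd : d₁ ≤ d) :
    PR G A₁ B₁ g₁ d₁ := by
  intro A' hA' B' hB' h1 h2 b
  refine le_trans ?_ (h A' (hA'.trans hA) B' (hB'.trans hB) (hg.trans h1) (hg.trans h2) b)
  gcongr

theorem PR.symm {V : Type*} {G : SimpleGraph V} {A B : Finset V} {g d : ℝ}
    (h : PR G A B g d) : PR G B A g d := by
  intro B' hB' A' hA' h1 h2 b
  have := h A' hA' B' hB' h2 h1 b
  rw [mul_assoc, mul_comm (B'.card : ℝ), ← mul_assoc]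
  refine this.trans ?_
  norm_cast
  refine Finset.card_le_card_of_injOn Prod.swap ?_ Prod.swap_injective.injOn
  rintro ⟨x, y⟩ hp
  simp only [Finset.coe_filter, Set.mem_ofPred_eq, Finset.mem_product] at hp ⊢
  exact ⟨⟨hp.1.2, hp.1.1⟩, by rw [← hp.2]; exact G.adj_comm _ _⟩

theorem PR.compl {V : Type*} {G : SimpleGraph V} {A B : Finset V} {g d : ℝ}
    (h : PR G A B g d) (hAB : Disjoint A B) : PR Gᶜ A B g d := by
  intro A' hA' B' hB' h1 h2 b
  refine (h A' hA' B' hB' h1 h2 (!b)).trans ?_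
  norm_cast
  refine Finset.card_le_card fun p hp => ?_
  simp only [Finset.mem_filter, Finset.mem_product] at hp ⊢
  refine ⟨hp.1, ?_⟩
  have : p.1 ≠ p.2 := fun he =>
    Finset.disjoint_left.1 hAB (hA' hp.1.1) (he ▸ hB' hp.1.2)
  rw [SimpleGraph.compl_adj]
  cases b <;> simp_all

/-- The edge set between `A` and `B`. -/
def crossEdges {V : Type*} (G : SimpleGraph V) (F : Finset (V × V)) : Finset (V × V) :=
  F.filter fun p => G.Adj p.1 p.2

theorem exists_few_not_PR : ∃ d : ℝ, 0 < d ∧ d < 1 ∧ ∀ {V : Type} [Fintype V] [DecidableEq V]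
    (A B : Finset V) (g : ℝ), 0 ≤ g →
      ({X : Finset (V × V) | ∃ G : SimpleGraph V, ¬PR G A B g d ∧ crossEdges G (A ×ˢ B) = X}.ncard : ℝ)
        ≤ 2 ^ (2 * (Fintype.card V : ℝ) + 1 + (A.card * B.card : ℝ) - g ^ 2 / 2) := by
  obtain ⟨d, hd0, hd1, hd⟩ := exists_few_small_subsets (1 / 2) (by norm_num)
  refine ⟨d, hd0, hd1, fun {V} _ _ A B g hg => ?_⟩
  let P : (Finset V × Finset V × Bool) → Finset (V × V) → Prop := fun i X =>
    X ⊆ A ×ˢ B ∧ i.1 ⊆ A ∧ i.2.1 ⊆ B ∧ g ≤ (i.1.card : ℝ) ∧ g ≤ (i.2.1.card : ℝ) ∧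
      ((((if i.2.2 then X else (A ×ˢ B) \ X) ∩ (i.1 ×ˢ i.2.1)).card : ℝ) ≤ d * (i.1 ×ˢ i.2.1).card)
  have hsub : {X : Finset (V × V) | ∃ G : SimpleGraph V, ¬PR G A B g d ∧ crossEdges G (A ×ˢ B) = X}
      ⊆ {X | ∃ i, P i X} := by
    rintro X ⟨G, hG, rfl⟩
    simp only [PR, not_forall, not_le] at hG
    obtain ⟨A', hA', B', hB', h1, h2, b, hb⟩ := hG
    refine ⟨(A', B', b), Finset.filter_subset _ _, hA', hB', h1, h2, ?_⟩
    simp only [Finset.card_product]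
    push_cast
    rw [← mul_assoc]
    refine le_trans ?_ hb.le
    norm_cast
    refine Finset.card_le_card fun p hp => ?_
    simp only [Finset.mem_inter, Finset.mem_product, crossEdges] at hp
    simp only [Finset.mem_filter, Finset.mem_product]
    refine ⟨hp.2, ?_⟩
    cases b <;> simp_all
  have hP : ∀ i, ({X | P i X}.ncard : ℝ) ≤ 2 ^ ((A.card * B.card : ℝ) - g ^ 2 / 2) := by
    rintro ⟨A', B', b⟩
    by_cases hi : A' ⊆ A ∧ B' ⊆ B ∧ g ≤ (A'.card : ℝ) ∧ g ≤ (B'.card : ℝ)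
    swap
    · have : {X | P (A', B', b) X} = ∅ := by
        ext X; simp only [Set.mem_ofPred_eq, Set.mem_empty_iff_false, iff_false]
        rintro ⟨_, h⟩
        exact hi ⟨h.1, h.2.1, h.2.2.1, h.2.2.2.1⟩
      rw [this]; simp; positivity
    obtain ⟨hA', hB', h1, h2⟩ := hi
    have hsub : A' ×ˢ B' ⊆ A ×ˢ B := Finset.product_subset_product hA' hB'
    have hc := card_powerset_few_inter_le hsub (hd (A' ×ˢ B'))
    have h3 : {X | P (A', B', b) X}.ncard ≤ ((A ×ˢ B).powerset.filter fun X =>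
        ((X ∩ (A' ×ˢ B')).card : ℝ) ≤ d * (A' ×ˢ B').card).card := by
      rw [← Set.ncard_coe_finset]
      refine Set.ncard_le_ncard_of_injOn (fun X => if b then X else (A ×ˢ B) \ X) ?_ ?_
      · rintro X ⟨hX, _, _, _, _, h⟩
        simp only [Finset.coe_filter, Set.mem_ofPred_eq, Finset.mem_powerset]
        refine ⟨?_, h⟩
        split_ifs
        · exact hX
        · exact Finset.sdiff_subset
      · rintro X ⟨hX, _⟩ Y ⟨hY, _⟩ h
        cases b
        · simp only [Bool.false_eq_true, if_false] at h
          rw [← Finset.sdiff_sdiff_eq_self hX, h, Finset.sdiff_sdiff_eq_self hY]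
        · simpa using h
    refine (Nat.cast_le.2 h3).trans (hc.trans ?_)
    apply Real.rpow_le_rpow_of_exponent_le (by norm_num)
    simp only [Finset.card_product]
    push_cast
    nlinarith
  calc _ ≤ ({X | ∃ i, P i X}.ncard : ℝ) := by exact_mod_cast Set.ncard_le_ncard hsub
    _ ≤ _ := ncard_exists_le P _ hP
    _ = _ := by
      simp only [Fintype.card_prod, Fintype.card_finset, Fintype.card_bool]
      push_cast
      rw [show (2 : ℝ) * (Fintype.card V : ℝ) + 1 + (A.card * B.card : ℝ) - g ^ 2 / 2 =
        (Fintype.card V : ℝ) + ((Fintype.card V : ℝ) + (1 + ((A.card * B.card : ℝ) - g ^ 2 / 2))) by ring,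
        Real.rpow_add (by norm_num), Real.rpow_add (by norm_num), Real.rpow_add (by norm_num)]
      simp only [Real.rpow_natCast, Real.rpow_one]
      ring

/-- Encoding graphs by the pairs in `F` and the deviations from a reference relation elsewhere. -/
theorem ncard_graphs_le_of_code {V : Type} [Fintype V] [DecidableEq V] (S : Set (SimpleGraph V))
    (F : Finset (V × V)) (R : V → V → Prop) (T : Set (Finset (V × V))) (m : ℝ)
    (hT : ∀ G ∈ S, crossEdges G F ∈ T)
    (hm : ∀ G ∈ S, ((Finset.univ.filter fun p : V × V =>
      p ∉ F ∧ p.swap ∉ F ∧ ¬(G.Adj p.1 p.2 ↔ R p.1 p.2)).card : ℝ) ≤ m) :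
    (S.ncard : ℝ) ≤ T.ncard * (((Finset.univ : Finset (V × V)).powerset.filter
      fun Y => (Y.card : ℝ) ≤ m).card : ℝ) := by
  have : S.ncard ≤ (T ×ˢ (((Finset.univ : Finset (V × V)).powerset.filter
      fun Y => (Y.card : ℝ) ≤ m : Finset _) : Set (Finset (V × V)))).ncard := by
    refine Set.ncard_le_ncard_of_injOn (fun G => (crossEdges G F,
      Finset.univ.filter fun p : V × V =>
        p ∉ F ∧ p.swap ∉ F ∧ ¬(G.Adj p.1 p.2 ↔ R p.1 p.2))) ?_ ?_
    · intro G hG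
      refine ⟨hT G hG, ?_⟩
      simp only [Finset.coe_filter, Finset.mem_powerset, Finset.subset_univ, true_and,
        Set.mem_ofPred_eq]
      exact hm G hG
    · intro G hG H hH h
      simp only [Prod.mk.injEq] at h
      obtain ⟨h1, h2⟩ := h
      have key : ∀ x y, (x, y) ∈ F → (G.Adj x y ↔ H.Adj x y) := by
        intro x y hxy
        have := Finset.ext_iff.1 h1 (x, y)
        simpa [crossEdges, hxy] using this
      ext x y
      by_cases hxy : (x, y) ∈ F
      · exact key x y hxy
      by_cases hyx : (y, x) ∈ F
      · rw [G.adj_comm, H.adj_comm]; exact key y x hyx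
      have := Finset.ext_iff.1 h2 (x, y)
      simp only [Finset.mem_filter, Finset.mem_univ, true_and, hxy, Prod.swap_prod_mk, hyx,
        not_false_eq_true] at this
      tauto
  rw [Set.ncard_prod, Set.ncard_coe_finset] at this
  exact_mod_cast this

/-- Neighbours (`b = true`) or non-neighbours (`b = false`) of `v` in `D`. -/
def nb {V : Type*} (G : SimpleGraph V) (D : Finset V) (v : V) (b : Bool) : Finset V :=
  D.filter fun w => w ≠ v ∧ (G.Adj v w ↔ b = true)

theorem nb_subset {V : Type*} (G : SimpleGraph V) (D : Finset V) (v : V) (b : Bool) :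
    nb G D v b ⊆ D := Finset.filter_subset _ _

theorem mem_nb {V : Type*} {G : SimpleGraph V} {D : Finset V} {v w : V} {b : Bool} :
    w ∈ nb G D v b ↔ w ∈ D ∧ w ≠ v ∧ (G.Adj v w ↔ b = true) := Finset.mem_filter

theorem nb_compl {V : Type*} (G : SimpleGraph V) (D : Finset V) (v : V) (b : Bool) :
    nb Gᶜ D v b = nb G D v (!b) := by
  ext w
  simp only [mem_nb, SimpleGraph.compl_adj]
  cases b <;> simp <;> tauto

theorem PR.exists_pair {V : Type*} {G : SimpleGraph V} {A B A' B' : Finset V} {g d : ℝ}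
    (h : PR G A B g d) (hd : 0 < d) (hg : 0 < g) (hA : A' ⊆ A) (hB : B' ⊆ B) (h1 : g ≤ A'.card)
    (h2 : g ≤ B'.card) (b : Bool) : ∃ x ∈ A', ∃ y ∈ B', (G.Adj x y ↔ b = true) := by
  have := h A' hA B' hB h1 h2 b
  have h3 : 0 < d * A'.card * B'.card := by
    have := hg.trans_le h1
    have := hg.trans_le h2
    positivity
  have h4 := Finset.card_pos.1 (Nat.cast_pos.1 (h3.trans_le this))
  obtain ⟨⟨x, y⟩, hp⟩ := h4
  simp only [Finset.mem_filter, Finset.mem_product] at hp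
  exact ⟨x, hp.1.1, y, hp.1.2, hp.2⟩

theorem PR.card_bad_lt {V : Type*} {G : SimpleGraph V} {A B B' : Finset V} {g d : ℝ}
    (h : PR G A B g d) (hAB : Disjoint A B) (hg : 0 < g) (hB : B' ⊆ B) (h2 : g ≤ B'.card)
    (b : Bool) : ((A.filter fun v => ((nb G B' v b).card : ℝ) < d * B'.card).card : ℝ) < g := by
  by_contra! hlt
  set A' := A.filter fun v => ((nb G B' v b).card : ℝ) < d * B'.card with hA'
  have h3 := h A' (Finset.filter_subset _ _) B' hB hlt h2 b
  have h4 : ((A' ×ˢ B').filter fun p => (G.Adj p.1 p.2 ↔ b = true)).card =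
      ∑ v ∈ A', (nb G B' v b).card := by
    rw [Finset.card_filter, Finset.sum_product]
    refine Finset.sum_congr rfl fun v hv => ?_
    rw [nb, Finset.card_filter]
    refine Finset.sum_congr rfl fun w hw => ?_
    have : w ≠ v := fun he => Finset.disjoint_left.1 hAB (Finset.mem_filter.1 hv).1
      (he ▸ hB hw)
    simp [this]
  rw [h4] at h3
  push_cast at h3
  have hne : A'.Nonempty := Finset.card_pos.1 (Nat.cast_pos.1 (hg.trans_le hlt))
  have h5 : ∑ v ∈ A', ((nb G B' v b).card : ℝ) < ∑ v ∈ A', d * B'.card :=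
    Finset.sum_lt_sum_of_nonempty hne fun v hv => (Finset.mem_filter.1 hv).2
  rw [Finset.sum_const, nsmul_eq_mul] at h5
  nlinarith

theorem exists_not_bad {V ι : Type*} [Fintype ι] (P X : Finset V) (Bad : ι → V → Prop) (g : ℝ)
    (h : ∀ i, ((P.filter (Bad i)).card : ℝ) ≤ g)
    (hP : (Fintype.card ι : ℝ) * g + X.card < P.card) : ∃ v ∈ P, v ∉ X ∧ ∀ i, ¬Bad i v := by
  by_contra! hcon
  have hsub : P ⊆ X ∪ Finset.univ.biUnion fun i => P.filter (Bad i) := by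
    intro v hv
    by_cases hvX : v ∈ X
    · exact Finset.mem_union_left _ hvX
    · obtain ⟨i, hi⟩ := hcon v hv hvX
      exact Finset.mem_union_right _ (Finset.mem_biUnion.2 ⟨i, Finset.mem_univ _,
        Finset.mem_filter.2 ⟨hv, hi⟩⟩)
  have h1 : (P.card : ℝ) ≤ X.card + ∑ i, ((P.filter (Bad i)).card : ℝ) := by
    have := (Finset.card_le_card hsub).trans ((Finset.card_union_le _ _).trans
      (Nat.add_le_add_left Finset.card_biUnion_le _))
    exact_mod_cast this
  have h2 : ∑ i, ((P.filter (Bad i)).card : ℝ) ≤ ∑ i : ι, g := Finset.sum_le_sum fun i _ => h i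
  simp only [Finset.sum_const, Finset.card_univ, nsmul_eq_mul] at h2
  linarith

theorem not_c5Free_of_centre {V : Type*} {G : SimpleGraph V} {V₁ V₃ : Finset V} {g d K : ℝ}
    {a b c : V} (hfree : C5Free G)
    (hPR : PR G V₁ V₃ g d) (hdis : Disjoint V₁ V₃) (hd : 0 < d) (hd1 : d ≤ 1) (hg : 0 < g)
    (hK : 3 * g ≤ d * K) (hab : G.Adj a b) (hbc : G.Adj b c)
    (h1 : ∀ p q r, K ≤ ((nb G (nb G (nb G V₁ a p) b q) c r).card : ℝ))
    (h3 : ∀ p q r, K ≤ ((nb G (nb G (nb G V₃ a p) b q) c r).card : ℝ)) : False := by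
  have hgK : 3 * g ≤ K := by nlinarith
  set U := nb G (nb G (nb G V₁ a true) b false) c false with hU
  set U' := nb G (nb G (nb G V₁ a false) b true) c false with hU'
  set W := nb G (nb G (nb G V₃ a false) b false) c true with hW
  have hUV : U ⊆ V₁ := (nb_subset _ _ _ _).trans ((nb_subset _ _ _ _).trans (nb_subset _ _ _ _))
  have hUV' : U' ⊆ V₁ := (nb_subset _ _ _ _).trans ((nb_subset _ _ _ _).trans (nb_subset _ _ _ _))
  have hWV : W ⊆ V₃ := (nb_subset _ _ _ _).trans ((nb_subset _ _ _ _).trans (nb_subset _ _ _ _))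
  have hUm : ∀ u ∈ U, G.Adj a u ∧ ¬G.Adj b u ∧ ¬G.Adj c u := by
    intro u hu; simp only [hU, mem_nb] at hu; simp_all
  have hUm' : ∀ u ∈ U', ¬G.Adj a u ∧ G.Adj b u ∧ ¬G.Adj c u := by
    intro u hu; simp only [hU', mem_nb] at hu; simp_all
  have hWm : ∀ u ∈ W, ¬G.Adj a u ∧ ¬G.Adj b u ∧ G.Adj c u := by
    intro u hu; simp only [hW, mem_nb] at hu; simp_all
  have cU : K ≤ U.card := h1 true false false
  have cU' : K ≤ U'.card := h1 false true false
  have cW : K ≤ W.card := h3 false false true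
  by_cases hac : G.Adj a c
  · obtain ⟨u, hu, -, hu2⟩ := exists_not_bad U ∅
      (fun (_ : Unit) v => ((nb G W v true).card : ℝ) < d * W.card) g
      (fun _ => ((hPR.mono hUV hWV le_rfl le_rfl).card_bad_lt
        (Finset.disjoint_of_subset_left hUV (Finset.disjoint_of_subset_right hWV hdis)) hg
        le_rfl (by linarith) true).le) (by simp; linarith)
    have hu2 := not_lt.1 (hu2 ())
    set W1 := nb G W u true with hW1
    have cW1 : 2 * g ≤ W1.card := by nlinarith
    have hW1W : W1 ⊆ W := nb_subset _ _ _ _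
    have hW1V : W1 ⊆ V₃ := hW1W.trans hWV
    obtain ⟨u', hu', -, hu2'⟩ := exists_not_bad U' ∅
      (fun (b : Bool) v => ((nb G W1 v b).card : ℝ) < d * W1.card) g
      (fun b => ((hPR.mono hUV' hW1V le_rfl le_rfl).card_bad_lt
        (Finset.disjoint_of_subset_left hUV' (Finset.disjoint_of_subset_right hW1V hdis)) hg
        le_rfl (by linarith) b).le) (by simp; linarith)
    have hpos : ∀ b, ∃ w, w ∈ nb G W1 u' b := by
      intro b
      have := not_lt.1 (hu2' b)
      have : 0 < ((nb G W1 u' b).card : ℝ) := lt_of_lt_of_le (by nlinarith) this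
      exact Finset.card_pos.1 (Nat.cast_pos.1 this)
    by_cases huu : G.Adj u u'
    · obtain ⟨w, hw⟩ := hpos false
      rw [mem_nb] at hw
      have hwW := hWm w (hW1W hw.1)
      have huw : G.Adj u w := by have := hw.1; rw [hW1, mem_nb] at this; simpa using this.2.2
      have hm := hUm u hu
      have hm' := hUm' u' hu'
      exact hfree c b u' u w hbc.symm hm'.2.1 huu.symm huw hwW.2.2.symm hm'.2.2 hm.2.1
        (by simpa using hw.2.2) (fun h => hm.2.2 h.symm) (fun h => hwW.2.1 h.symm)
    · obtain ⟨w, hw⟩ := hpos true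
      rw [mem_nb] at hw
      have hwW := hWm w (hW1W hw.1)
      have huw : G.Adj u w := by have := hw.1; rw [hW1, mem_nb] at this; simpa using this.2.2
      have hm := hUm u hu
      have hm' := hUm' u' hu'
      exact hfree a u w u' b hm.1 huw (by simpa using (by simpa using hw.2.2 : G.Adj u' w).symm)
        hm'.2.1.symm hab.symm hwW.1 huu (fun h => hwW.2.1 h.symm) (fun h => hm'.1 h.symm) hm.2.1
  · obtain ⟨u, hu, w, hw, huw⟩ := hPR.exists_pair hd hg hUV hWV (by linarith) (by linarith) true
    have huw : G.Adj u w := by simpa using huw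
    have hm := hUm u hu
    have hm' := hWm w hw
    exact hfree u a b c w hm.1.symm hab hbc hm'.2.2 huw.symm (fun h => hm.2.1 h.symm) hac hm'.2.1
      hm.2.2 (fun h => hm'.1 h.symm)

theorem not_c5Free_of_generic {V : Type*} {G : SimpleGraph V} {V₁ V₃ : Finset V} {g d K : ℝ}
    {a b c : V} (hfree : C5Free G)
    (hPR : PR G V₁ V₃ g d) (hdis : Disjoint V₁ V₃) (hd : 0 < d) (hd1 : d ≤ 1) (hg : 0 < g)
    (hK : 3 * g ≤ d * K) (hab : a ≠ b) (hac : a ≠ c) (hbc : b ≠ c)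
    (h1 : ∀ p q r, K ≤ ((nb G (nb G (nb G V₁ a p) b q) c r).card : ℝ))
    (h3 : ∀ p q r, K ≤ ((nb G (nb G (nb G V₃ a p) b q) c r).card : ℝ)) : False := by
  have hcomm : ∀ (H : SimpleGraph V) (D : Finset V) x p y q, nb H (nb H D x p) y q = nb H (nb H D y q) x p := by
    intro H D x p y q; ext w; simp only [mem_nb]; tauto
  have aux : ∀ H : SimpleGraph V, C5Free H → PR H V₁ V₃ g d →
      (∀ p q r, K ≤ ((nb H (nb H (nb H V₁ a p) b q) c r).card : ℝ)) →
      (∀ p q r, K ≤ ((nb H (nb H (nb H V₃ a p) b q) c r).card : ℝ)) →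
      (H.Adj a b ∧ H.Adj b c) ∨ (H.Adj a b ∧ H.Adj a c) ∨ (H.Adj a c ∧ H.Adj b c) → False := by
    rintro H hH hPRH g1 g3 (⟨e1, e2⟩ | ⟨e1, e2⟩ | ⟨e1, e2⟩)
    · exact not_c5Free_of_centre hH hPRH hdis hd hd1 hg hK e1 e2 g1 g3
    · exact not_c5Free_of_centre hH hPRH hdis hd hd1 hg hK e1.symm e2
        (fun p q r => by rw [hcomm H V₁]; exact g1 q p r)
        (fun p q r => by rw [hcomm H V₃]; exact g3 q p r)
    · exact not_c5Free_of_centre hH hPRH hdis hd hd1 hg hK e1 e2.symm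
        (fun p q r => by rw [hcomm H]; exact g1 p r q)
        (fun p q r => by rw [hcomm H]; exact g3 p r q)
  by_cases h : (G.Adj a b ∧ G.Adj b c) ∨ (G.Adj a b ∧ G.Adj a c) ∨ (G.Adj a c ∧ G.Adj b c)
  · exact aux G hfree hPR h1 h3 h
  · refine aux Gᶜ hfree.compl (hPR.compl hdis) (fun p q r => ?_) (fun p q r => ?_) ?_
    · simp only [nb_compl]; exact h1 _ _ _
    · simp only [nb_compl]; exact h3 _ _ _
    · simp only [SimpleGraph.compl_adj]
      tauto

/-- A five-cycle-free graph has no three pairwise mixed classes. -/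
theorem not_c5Free_of_triangle {V : Type*} {G : SimpleGraph V} {V₁ V₂ V₃ : Finset V} {g d m : ℝ}
    (hfree : C5Free G) (h12 : PR G V₁ V₂ g d) (h23 : PR G V₂ V₃ g d) (h13 : PR G V₁ V₃ g d)
    (d12 : Disjoint V₁ V₂) (d23 : Disjoint V₂ V₃) (d13 : Disjoint V₁ V₃)
    (hd : 0 < d) (hd1 : d ≤ 1) (hg : 0 < g) (hm : 3 * g ≤ d ^ 4 * m)
    (c1 : m ≤ V₁.card) (c3 : m ≤ V₃.card) (c2 : 16 * g + 2 < V₂.card) : False := by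
  have hm0 : 0 < m := by
    by_contra! h
    nlinarith [pow_pos hd 4]
  let D : Bool → Finset V := fun s => if s then V₁ else V₃
  have hD : ∀ s, PR G V₂ (D s) g d := by rintro (_ | _); exacts [h23, h12.symm]
  have dD : ∀ s, Disjoint V₂ (D s) := by rintro (_ | _); exacts [d23, d12.symm]
  have cD : ∀ s, m ≤ (D s).card := by rintro (_ | _); exacts [c3, c1]
  have hd2 : d ^ 2 ≤ 1 := pow_le_one₀ hd.le hd1
  have e2 : 3 * g ≤ d ^ 2 * m := hm.trans (by nlinarith [pow_pos hd 2])
  have e1 : 3 * g ≤ d * m := e2.trans (by nlinarith)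
  have e0 : 3 * g ≤ m := e1.trans (by nlinarith)
  obtain ⟨a, ha, -, ha2⟩ := exists_not_bad V₂ ∅
    (fun (i : Bool × Bool) v => ((nb G (D i.1) v i.2).card : ℝ) < d * (D i.1).card) g
    (fun i => ((hD i.1).card_bad_lt (dD _) hg le_rfl (by linarith [cD i.1]) i.2).le)
    (by simp; linarith)
  have ha3 : ∀ s p, d * m ≤ ((nb G (D s) a p).card : ℝ) := fun s p =>
    le_trans (by have := cD s; gcongr) (not_lt.1 (ha2 (s, p)))
  obtain ⟨b, hb, hbX, hb2⟩ := exists_not_bad V₂ {a}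
    (fun (i : Bool × Bool × Bool) v =>
      ((nb G (nb G (D i.1) a i.2.1) v i.2.2).card : ℝ) < d * (nb G (D i.1) a i.2.1).card) g
    (fun i => ((hD i.1).card_bad_lt (dD _) hg (nb_subset _ _ _ _) (by linarith [ha3 i.1 i.2.1]) _).le)
    (by simp; linarith)
  have hb3 : ∀ s p q, d ^ 2 * m ≤ ((nb G (nb G (D s) a p) b q).card : ℝ) := fun s p q =>
    le_trans (by rw [pow_two, mul_assoc]; have := ha3 s p; gcongr) (not_lt.1 (hb2 (s, p, q)))
  obtain ⟨c, hc, hcX, hc2⟩ := exists_not_bad V₂ {a, b}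
    (fun (i : Bool × Bool × Bool × Bool) v =>
      ((nb G (nb G (nb G (D i.1) a i.2.1) b i.2.2.1) v i.2.2.2).card : ℝ) <
        d * (nb G (nb G (D i.1) a i.2.1) b i.2.2.1).card) g
    (fun i => ((hD i.1).card_bad_lt (dD _) hg ((nb_subset _ _ _ _).trans (nb_subset _ _ _ _))
      (by linarith [hb3 i.1 i.2.1 i.2.2.1]) _).le)
    (by
      have : (({a, b} : Finset V).card : ℝ) ≤ 2 := by exact_mod_cast Finset.card_le_two
      simp only [Fintype.card_prod, Fintype.card_bool]; push_cast; linarith)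
  have hc3 : ∀ s p q r, d ^ 3 * m ≤ ((nb G (nb G (nb G (D s) a p) b q) c r).card : ℝ) :=
    fun s p q r => le_trans (by rw [pow_succ', mul_assoc]; have := hb3 s p q; gcongr)
      (not_lt.1 (hc2 (s, p, q, r)))
  simp only [Finset.mem_singleton, Finset.mem_insert, not_or] at hbX hcX
  exact not_c5Free_of_generic hfree h13 d13 hd hd1 hg (K := d ^ 3 * m) (by nlinarith)
    (Ne.symm hbX) (Ne.symm hcX.1) (Ne.symm hcX.2) (hc3 true) (hc3 false)

theorem PR_of_isUniform {V : Type} [DecidableEq V] {G : SimpleGraph V} {s t : Finset V}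
    {ε d g : ℝ} (h : G.IsUniform ε s t) (h1 : 2 * d ≤ (G.edgeDensity s t : ℝ))
    (h2 : (G.edgeDensity s t : ℝ) ≤ 1 - 2 * d) (hε : ε ≤ d) (hs : s.card * ε ≤ g)
    (ht : t.card * ε ≤ g) : PR G s t g d := by
  intro A hA B hB hgA hgB b
  have h3 := h hA hB (hs.trans hgA) (ht.trans hgB)
  rw [abs_lt] at h3
  by_cases h0 : A.card * B.card = 0
  · have : d * A.card * B.card = 0 := by
      rw [mul_assoc]; norm_cast; rw [h0]; simp
    rw [this]; positivity
  have hpos : (0 : ℝ) < A.card * B.card := by exact_mod_cast Nat.pos_of_ne_zero h0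
  have h4 : (G.edgeDensity A B : ℝ) * (A.card * B.card) = ((G.interedges A B).card : ℝ) := by
    rw [SimpleGraph.edgeDensity_def]; push_cast
    rw [div_mul_cancel₀ _ hpos.ne']
  have h5 : (G.interedges A B).card +
      ((A ×ˢ B).filter fun p => ¬G.Adj p.1 p.2).card = A.card * B.card := by
    rw [SimpleGraph.interedges_def, Finset.card_filter_add_card_filter_not, Finset.card_product]
  cases b
  · have h6 : (((A ×ˢ B).filter fun p => (G.Adj p.1 p.2 ↔ false = true)).card : ℝ) =
        A.card * B.card - ((G.interedges A B).card : ℝ) := by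
      rw [eq_sub_iff_add_eq']
      rw [← Nat.cast_mul, ← h5]
      simp
    rw [h6, ← h4]; nlinarith
  · have h6 : (((A ×ˢ B).filter fun p => (G.Adj p.1 p.2 ↔ true = true)).card : ℝ) =
        ((G.interedges A B).card : ℝ) := by
      rw [SimpleGraph.interedges_def]; simp
    rw [h6, ← h4]; nlinarith

theorem card_le_of_fibers {V : Type} [Fintype V] [DecidableEq V] {k : ℕ} (φ : V → Fin k)
    (E : Finset (V × V)) (d : ℝ)
    (h : ∀ i j, ((E.filter fun p => φ p.1 = i ∧ φ p.2 = j).card : ℝ) ≤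
      d * ((Finset.univ.filter fun v => φ v = i).card * (Finset.univ.filter fun v => φ v = j).card)) :
    (E.card : ℝ) ≤ d * (Fintype.card V : ℝ) ^ 2 := by
  have e1 : E ⊆ (Finset.univ : Finset (Fin k × Fin k)).biUnion fun ij =>
      E.filter fun p => φ p.1 = ij.1 ∧ φ p.2 = ij.2 := by
    intro p hp
    simp only [Finset.mem_biUnion, Finset.mem_univ, true_and, Finset.mem_filter]
    exact ⟨(φ p.1, φ p.2), hp, rfl, rfl⟩
  have e3 : (E.card : ℝ) ≤ ∑ ij : Fin k × Fin k, d * ((Finset.univ.filter fun v => φ v = ij.1).card *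
      (Finset.univ.filter fun v => φ v = ij.2).card) := by
    refine (Nat.cast_le.2 ((Finset.card_le_card e1).trans Finset.card_biUnion_le)).trans ?_
    push_cast
    exact Finset.sum_le_sum fun ij _ => h ij.1 ij.2
  have e4 : ∑ i : Fin k, ((Finset.univ.filter fun v => φ v = i).card : ℝ) = Fintype.card V := by
    have : ∑ i : Fin k, (Finset.univ.filter fun v => φ v = i).card = Fintype.card V := by
      rw [← Finset.card_univ, Finset.card_eq_sum_card_fiberwise (t := Finset.univ) (f := φ)
        (fun _ _ => Finset.mem_coe.2 (Finset.mem_univ _))]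
    exact_mod_cast this
  rw [← Finset.mul_sum, ← Finset.univ_product_univ, Finset.sum_product] at e3
  simp only [← Finset.mul_sum, ← Finset.sum_mul, e4] at e3
  rwa [pow_two]

theorem card_mismatch_le {V : Type} [DecidableEq V] (G : SimpleGraph V) (s t : Finset V)
    {d : ℝ} (hd : d < 1 / 2)
    (h : (G.edgeDensity s t : ℝ) ≤ d ∨ 1 - d ≤ (G.edgeDensity s t : ℝ)) :
    (((s ×ˢ t).filter fun p => ¬(G.Adj p.1 p.2 ↔ (1 / 2 : ℝ) ≤ (G.edgeDensity s t : ℝ))).card : ℝ) ≤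
      d * (s.card * t.card) := by
  by_cases h0 : s.card * t.card = 0
  · have : s ×ˢ t = ∅ := by rw [← Finset.card_eq_zero, Finset.card_product, h0]
    rw [this]
    have : (s.card * t.card : ℝ) = 0 := by exact_mod_cast h0
    simp [this]
  have hpos : (0 : ℝ) < s.card * t.card := by exact_mod_cast Nat.pos_of_ne_zero h0
  have h4 : (G.edgeDensity s t : ℝ) * (s.card * t.card) = ((G.interedges s t).card : ℝ) := by
    rw [SimpleGraph.edgeDensity_def]; push_cast
    rw [div_mul_cancel₀ _ hpos.ne']
  have h5 : (G.interedges s t).card +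
      ((s ×ˢ t).filter fun p => ¬G.Adj p.1 p.2).card = s.card * t.card := by
    rw [SimpleGraph.interedges_def, Finset.card_filter_add_card_filter_not, Finset.card_product]
  have h5' : ((G.interedges s t).card : ℝ) +
      (((s ×ˢ t).filter fun p => ¬G.Adj p.1 p.2).card : ℝ) = s.card * t.card := by
    exact_mod_cast h5
  rcases h with h | h
  · have hr : ¬(1 / 2 : ℝ) ≤ (G.edgeDensity s t : ℝ) := by linarith
    simp only [hr, iff_false, not_not]
    have h6 : (((s ×ˢ t).filter fun p => G.Adj p.1 p.2).card : ℝ) =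
        ((G.interedges s t).card : ℝ) := by
      rw [SimpleGraph.interedges_def]
    rw [h6, ← h4]
    exact mul_le_mul_of_nonneg_right h hpos.le
  · have hr : (1 / 2 : ℝ) ≤ (G.edgeDensity s t : ℝ) := by linarith
    simp only [hr, iff_true]
    nlinarith

set_option maxHeartbeats 1000000 in
theorem exists_regular_structure (ε₁ : ℝ) (hε₁ : 0 < ε₁) : ∃ M : ℕ,
    ∀ {V : Type} [Fintype V] [DecidableEq V] (G : SimpleGraph V), C5Free G →
      16 * M ≤ Fintype.card V → ∃ k : ℕ, 0 < k ∧ k ≤ M ∧ ∃ (φ : V → Fin k)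
        (Γ : SimpleGraph (Fin k)) (r : Fin k → Fin k → Prop),
        (∀ i j l, Γ.Adj i j → Γ.Adj j l → Γ.Adj i l → False) ∧
        (∀ i, ((Finset.univ.filter fun v => φ v = i).card : ℝ) ≤ (Fintype.card V : ℝ) / k + 1) ∧
        ((Finset.univ.filter fun p : V × V => ¬Γ.Adj (φ p.1) (φ p.2) ∧
          ¬(G.Adj p.1 p.2 ↔ r (φ p.1) (φ p.2))).card : ℝ) ≤ ε₁ * (Fintype.card V : ℝ) ^ 2 := by
  set d : ℝ := min (ε₁ / 8) (1 / 8) with hd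
  have hd0 : 0 < d := by positivity
  have hd1 : d ≤ 1 / 8 := min_le_right _ _
  have hdε : d ≤ ε₁ / 8 := min_le_left _ _
  set ε : ℝ := d ^ 4 / 64 with hε
  have hε0 : 0 < ε := by positivity
  have hd4 : d ^ 4 ≤ d := by nlinarith [pow_le_one₀ (n := 3) hd0.le (by linarith)]
  have hεd : ε ≤ d / 64 := by rw [hε]; linarith
  set l : ℕ := ⌈8 / ε₁⌉₊ + 1 with hl
  have hl8 : 8 / ε₁ ≤ l := (Nat.le_ceil _).trans (by rw [hl]; push_cast; linarith)
  refine ⟨max l (SzemerediRegularity.bound ε l), fun {V} _ _ G hG hn => ?_⟩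
  set n := Fintype.card V with hnV
  obtain ⟨P, hPe, hlP, hPM, hPu⟩ := szemeredi_regularity G hε0
    (l := l) (by have := le_max_left l (SzemerediRegularity.bound ε l); omega)
  set k := P.parts.card with hk
  have hk0 : 0 < k := by omega
  have hkM : k ≤ max l (SzemerediRegularity.bound ε l) := hPM.trans (le_max_right _ _)
  have hk0' : (0 : ℝ) < k := by exact_mod_cast hk0
  have hkn : 16 * (k : ℝ) ≤ n := by
    have : 16 * k ≤ n := by omega
    exact_mod_cast this
  have hnk : 16 ≤ (n : ℝ) / k := by rw [le_div_iff₀ hk0']; exact hkn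
  have hcardu : (Finset.univ : Finset V).card = n := rfl
  have hup : ∀ p ∈ P.parts, (p.card : ℝ) ≤ (n : ℝ) / k + 1 := by
    intro p hp
    have h := hPe.card_part_le_average_add_one hp
    rw [hcardu, ← hk] at h
    have h2 : ((n / k : ℕ) : ℝ) ≤ (n : ℝ) / k := Nat.cast_div_le
    have h3 : (p.card : ℝ) ≤ ((n / k : ℕ) : ℝ) + 1 := by exact_mod_cast h
    linarith
  have hlow : ∀ p ∈ P.parts, (n : ℝ) / (2 * k) ≤ (p.card : ℝ) := by
    intro p hp
    have h := hPe.average_le_card_part hp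
    rw [hcardu, ← hk] at h
    have h2 : (n : ℝ) / k < ((n / k : ℕ) : ℝ) + 1 := by
      rw [div_lt_iff₀ hk0']
      have := Nat.lt_div_mul_add (a := n) hk0
      have h5 : n < (n / k + 1) * k := by linarith
      exact_mod_cast h5
    have h3 : ((n / k : ℕ) : ℝ) ≤ (p.card : ℝ) := by exact_mod_cast h
    have h4 : (n : ℝ) / (2 * k) = (n : ℝ) / k / 2 := by field_simp
    rw [h4]; linarith
  let eqv : P.parts ≃ Fin k := P.parts.equivFin
  let φ : V → Fin k := fun v => eqv ⟨P.part v, P.part_mem.2 (Finset.mem_univ v)⟩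
  let W : Fin k → Finset V := fun i => (eqv.symm i : Finset V)
  have hWp : ∀ i, W i ∈ P.parts := fun i => (eqv.symm i).2
  have hWφ : ∀ v, W (φ v) = P.part v := fun v => by simp [W, φ]
  have hmem : ∀ v i, v ∈ W i ↔ φ v = i := by
    intro v i
    constructor
    · intro h
      have : P.part v = W i := P.part_eq_of_mem (hWp i) h
      simp only [φ]
      rw [← eqv.symm.injective.eq_iff, Equiv.symm_apply_apply]
      exact Subtype.ext this
    · rintro rfl
      rw [hWφ]; exact P.mem_part (Finset.mem_univ v)
  have hWinj : ∀ i j, i ≠ j → Disjoint (W i) (W j) := by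
    intro i j hij
    rw [Finset.disjoint_left]
    intro v hi hj
    exact hij (((hmem v i).1 hi).symm.trans ((hmem v j).1 hj))
  have hWne : ∀ i j, i ≠ j → W i ≠ W j := by
    intro i j hij h
    exact hij (eqv.symm.injective (Subtype.ext h))
  let Γ : SimpleGraph (Fin k) :=
    { Adj := fun i j => i ≠ j ∧ G.IsUniform ε (W i) (W j) ∧ 2 * d ≤ (G.edgeDensity (W i) (W j) : ℝ) ∧
        (G.edgeDensity (W i) (W j) : ℝ) ≤ 1 - 2 * d
      symm := ⟨fun i j h => ⟨h.1.symm, h.2.1.symm, by rw [G.edgeDensity_comm]; exact h.2.2.1,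
        by rw [G.edgeDensity_comm]; exact h.2.2.2⟩⟩
      loopless := ⟨fun i h => h.1 rfl⟩ }
  let r : Fin k → Fin k → Prop := fun i j => (1 / 2 : ℝ) ≤ (G.edgeDensity (W i) (W j) : ℝ)
  have hPR : ∀ i j, Γ.Adj i j → PR G (W i) (W j) (ε * (2 * (n / k))) d := by
    rintro i j ⟨hij, h1, h2, h3⟩
    refine PR_of_isUniform h1 h2 h3 (by linarith) ?_ ?_
    · have := hup _ (hWp i); nlinarith
    · have := hup _ (hWp j); nlinarith
  refine ⟨k, hk0, hkM, φ, Γ, r, ?_, ?_, ?_⟩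
  · intro i j m hij hjm him
    have h4 : (n : ℝ) / (2 * k) = (n : ℝ) / k / 2 := by field_simp
    refine not_c5Free_of_triangle hG (hPR i j hij) (hPR j m hjm) (hPR i m him)
      (hWinj i j hij.1) (hWinj j m hjm.1) (hWinj i m him.1) hd0 (by linarith)
      (by positivity) (m := (n : ℝ) / (2 * k)) ?_ (hlow _ (hWp i)) (hlow _ (hWp m)) ?_
    · rw [h4, hε]; nlinarith [pow_pos hd0 4]
    · refine lt_of_lt_of_le ?_ (hlow _ (hWp j))
      rw [h4]; nlinarith
  · intro i
    rw [show (Finset.univ.filter fun v => φ v = i) = W i by ext v; simp [hmem]]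
    exact hup _ (hWp i)
  · set E := Finset.univ.filter fun p : V × V => ¬Γ.Adj (φ p.1) (φ p.2) ∧
          ¬(G.Adj p.1 p.2 ↔ r (φ p.1) (φ p.2)) with hE
    set E1 := Finset.univ.filter fun p : V × V => φ p.1 = φ p.2 with hE1
    set E2 := (P.nonUniforms G ε).biUnion fun q => q.1 ×ˢ q.2 with hE2
    set E3 := Finset.univ.filter fun p : V × V => φ p.1 ≠ φ p.2 ∧
      G.IsUniform ε (W (φ p.1)) (W (φ p.2)) ∧ ¬Γ.Adj (φ p.1) (φ p.2) ∧
          ¬(G.Adj p.1 p.2 ↔ r (φ p.1) (φ p.2)) with hE3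
    have hsub : E ⊆ E1 ∪ (E2 ∪ E3) := by
      intro p hp
      simp only [hE, Finset.mem_filter, Finset.mem_univ, true_and] at hp
      by_cases h1 : φ p.1 = φ p.2
      · exact Finset.mem_union_left _ (by simp [hE1, h1])
      apply Finset.mem_union_right
      by_cases h2 : G.IsUniform ε (W (φ p.1)) (W (φ p.2))
      · exact Finset.mem_union_right _ (by simp only [hE3, Finset.mem_filter, Finset.mem_univ, true_and]; exact ⟨h1, h2, hp.1, hp.2⟩)
      · apply Finset.mem_union_left
        simp only [hE2, Finset.mem_biUnion]
        refine ⟨(W (φ p.1), W (φ p.2)), ?_, ?_⟩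
        · rw [Finpartition.mk_mem_nonUniforms]
          exact ⟨hWp _, hWp _, hWne _ _ h1, h2⟩
        · simp [hmem]
    have hc := (Finset.card_le_card hsub).trans ((Finset.card_union_le _ _).trans
      (Nat.add_le_add_left (Finset.card_union_le _ _) _))
    have hc' : (E.card : ℝ) ≤ E1.card + (E2.card + E3.card) := by exact_mod_cast hc
    have hlk : (l : ℝ) ≤ k := by exact_mod_cast hlP
    have hk8 : 8 / ε₁ ≤ k := hl8.trans hlk
    have c1 : (E1.card : ℝ) ≤ ε₁ / 4 * n ^ 2 := by
      have e1 : E1.card = ∑ u : V, (W (φ u)).card := by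
        rw [hE1, Finset.card_filter, ← Finset.univ_product_univ, Finset.sum_product]
        refine Finset.sum_congr rfl fun u _ => ?_
        rw [← Finset.card_filter]
        congr 1
        ext v; simp [hmem, eq_comm]
      have e2 : (E1.card : ℝ) ≤ ∑ u : V, ((n : ℝ) / k + 1) := by
        rw [e1]; push_cast
        exact Finset.sum_le_sum fun u _ => hup _ (hWp _)
      rw [Finset.sum_const, Finset.card_univ, nsmul_eq_mul, ← hnV] at e2
      have e3 : (n : ℝ) / k ≤ n * (ε₁ / 8) := by
        rw [div_le_iff₀ hk0', mul_assoc]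
        rw [div_le_iff₀ hε₁] at hk8
        nlinarith [Nat.cast_nonneg (α := ℝ) n]
      nlinarith [Nat.cast_nonneg (α := ℝ) n]
    have c2 : (E2.card : ℝ) ≤ ε₁ / 4 * n ^ 2 := by
      have e1 : (E2.card : ℝ) ≤ ∑ q ∈ P.nonUniforms G ε, (2 * (n / k : ℝ)) ^ 2 := by
        refine (Nat.cast_le.2 Finset.card_biUnion_le).trans ?_
        push_cast
        refine Finset.sum_le_sum fun q hq => ?_
        obtain ⟨q1, q2⟩ := q
        rw [Finpartition.mk_mem_nonUniforms] at hq
        rw [Finset.card_product]; push_cast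
        have a1 := hup _ hq.1
        have a2 := hup _ hq.2.1
        rw [pow_two]
        apply mul_le_mul <;> linarith
      rw [Finset.sum_const, nsmul_eq_mul] at e1
      have e2 : ((P.nonUniforms G ε).card : ℝ) ≤ k ^ 2 * ε := by
        refine hPu.trans ?_
        have : ((k * (k - 1) : ℕ) : ℝ) ≤ (k : ℝ) ^ 2 := by
          norm_cast; rw [pow_two]; exact Nat.mul_le_mul_left _ (by omega)
        exact mul_le_mul_of_nonneg_right this hε0.le
      calc (E2.card : ℝ) ≤ k ^ 2 * ε * (2 * (n / k : ℝ)) ^ 2 := e1.trans (by gcongr)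
        _ = 4 * ε * n ^ 2 := by field_simp; ring
        _ ≤ _ := by
          have : 4 * ε ≤ ε₁ / 4 := by linarith
          gcongr
    have c3 : (E3.card : ℝ) ≤ ε₁ / 4 * n ^ 2 := by
      have := card_le_of_fibers φ E3 (2 * d) fun i j => ?_
      · refine this.trans ?_
        have : 2 * d ≤ ε₁ / 4 := by linarith
        gcongr
      have hWi : ∀ i, (Finset.univ.filter fun v => φ v = i) = W i := by
        intro i; ext v; simp [hmem]
      rw [hWi, hWi]
      by_cases hij : i ≠ j ∧ G.IsUniform ε (W i) (W j) ∧ ¬Γ.Adj i j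
      · have hden : (G.edgeDensity (W i) (W j) : ℝ) ≤ 2 * d ∨
            1 - 2 * d ≤ (G.edgeDensity (W i) (W j) : ℝ) := by
          by_contra! hcon
          exact hij.2.2 ⟨hij.1, hij.2.1, hcon.1.le, hcon.2.le⟩
        refine (Nat.cast_le.2 (Finset.card_le_card ?_)).trans
          (card_mismatch_le G (W i) (W j) (by linarith) hden)
        intro q hq
        simp only [hE3, Finset.mem_filter, Finset.mem_univ, true_and] at hq
        obtain ⟨⟨-, -, -, hq⟩, hqi, hqj⟩ := hq
        rw [hqi, hqj] at hq
        rw [Finset.mem_filter, Finset.mem_product, hmem, hmem]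
        exact ⟨⟨hqi, hqj⟩, hq⟩
      · have : (E3.filter fun p => φ p.1 = i ∧ φ p.2 = j) = ∅ := by
          rw [Finset.filter_eq_empty_iff]
          rintro q hq ⟨hqi, hqj⟩
          simp only [hE3, Finset.mem_filter, Finset.mem_univ, true_and] at hq
          obtain ⟨h1, h2, h3, -⟩ := hq
          rw [hqi, hqj] at h1 h2 h3
          exact hij ⟨h1, h2, h3⟩
        rw [this, Finset.card_empty, Nat.cast_zero]
        exact mul_nonneg (by linarith) (mul_nonneg (Nat.cast_nonneg _) (Nat.cast_nonneg _))
    have c4 : (E.card : ℝ) ≤ ε₁ * n ^ 2 := by linarith [mul_nonneg hε₁.le (sq_nonneg (n : ℝ))]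
    convert c4

theorem mantel_stability {α : Type*} [Fintype α] [DecidableEq α] [Nonempty α] (Γ : SimpleGraph α)
    (h : ∀ i j l, Γ.Adj i j → Γ.Adj j l → Γ.Adj i l → False) : ∃ A : Finset α,
    (∀ i ∈ A, ∀ j ∈ A, ¬Γ.Adj i j) ∧
    2 * ((Finset.univ.filter fun p : α × α => Γ.Adj p.1 p.2).card +
      ((Aᶜ ×ˢ Aᶜ).filter fun p : α × α => Γ.Adj p.1 p.2).card) ≤ Fintype.card α ^ 2 := by
  obtain ⟨x, -, hx⟩ := Finset.exists_max_image (Finset.univ : Finset α)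
    (fun x => (Finset.univ.filter fun y => Γ.Adj x y).card) Finset.univ_nonempty
  set A := Finset.univ.filter fun y => Γ.Adj x y with hA
  have hAA : ∀ i ∈ A, ∀ j ∈ A, ¬Γ.Adj i j := by
    intro i hi j hj hij
    simp only [hA, Finset.mem_filter, Finset.mem_univ, true_and] at hi hj
    exact h x i j hi hij hj
  refine ⟨A, hAA, ?_⟩
  set f : Finset α → Finset α → ℕ := fun X Y => ((X ×ˢ Y).filter fun p : α × α => Γ.Adj p.1 p.2).card
    with hf
  have hsym : f A Aᶜ = f Aᶜ A := by
    simp only [hf]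
    refine Finset.card_bij (fun p _ => p.swap) ?_ ?_ ?_
    · rintro ⟨a, b⟩ hp
      simp only [Finset.mem_filter, Finset.mem_product, Prod.swap] at hp ⊢
      exact ⟨hp.1.symm, hp.2.symm⟩
    · intro a _ b _ hab; exact Prod.swap_injective hab
    · rintro ⟨a, b⟩ hp
      simp only [Finset.mem_filter, Finset.mem_product] at hp
      exact ⟨(b, a), by simp only [Finset.mem_filter, Finset.mem_product]; exact ⟨hp.1.symm, hp.2.symm⟩, rfl⟩
  have htot : (Finset.univ.filter fun p : α × α => Γ.Adj p.1 p.2).card ≤ 2 * f Aᶜ A + f Aᶜ Aᶜ := by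
    have : (Finset.univ.filter fun p : α × α => Γ.Adj p.1 p.2) ⊆
        ((A ×ˢ Aᶜ).filter fun p : α × α => Γ.Adj p.1 p.2) ∪
        (((Aᶜ ×ˢ A).filter fun p : α × α => Γ.Adj p.1 p.2) ∪
        ((Aᶜ ×ˢ Aᶜ).filter fun p : α × α => Γ.Adj p.1 p.2)) := by
      rintro ⟨a, b⟩ hp
      simp only [Finset.mem_filter, Finset.mem_univ, true_and, Finset.mem_union,
        Finset.mem_product, Finset.mem_compl] at hp ⊢
      by_cases ha : a ∈ A <;> by_cases hb : b ∈ A <;> simp [ha, hb, hp]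
      exact hAA a ha b hb hp
    have h1 := (Finset.card_le_card this).trans ((Finset.card_union_le _ _).trans
      (Nat.add_le_add_left (Finset.card_union_le _ _) _))
    simp only [hf] at hsym ⊢
    omega
  have hdeg : f Aᶜ A + f Aᶜ Aᶜ ≤ Aᶜ.card * A.card := by
    have e : f Aᶜ A + f Aᶜ Aᶜ = ∑ y ∈ Aᶜ, (Finset.univ.filter fun z => Γ.Adj y z).card := by
      have e1 : ∀ Y, f Aᶜ Y = ∑ y ∈ Aᶜ, (Y.filter fun z => Γ.Adj y z).card := by
        intro Y
        simp only [hf, Finset.card_filter, Finset.sum_product]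
      rw [e1, e1, ← Finset.sum_add_distrib]
      refine Finset.sum_congr rfl fun y _ => ?_
      rw [← Finset.card_union_of_disjoint, ← Finset.filter_union, Finset.union_compl]
      exact Finset.disjoint_filter_filter disjoint_compl_right
    rw [e, ← smul_eq_mul]
    exact Finset.sum_le_card_nsmul _ _ _ fun y _ => hx y (Finset.mem_univ y)
  have hc : A.card + Aᶜ.card = Fintype.card α := Finset.card_add_card_compl A
  have : ((Aᶜ ×ˢ Aᶜ).filter fun p : α × α => Γ.Adj p.1 p.2).card = f Aᶜ Aᶜ := rfl
  rw [this, ← hc]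
  zify at *
  nlinarith [sq_nonneg ((A.card : ℤ) - Aᶜ.card)]

theorem count_deviation {V ι : Type} [Fintype V] [DecidableEq V] [Fintype ι]
    (F : ι → Finset (V × V)) (R : ι → V → V → Prop) (T : ι → Set (Finset (V × V))) (m t : ℝ)
    (ht : ∀ i, ((T i).ncard : ℝ) ≤ t) :
    ({G : SimpleGraph V | ∃ i, crossEdges G (F i) ∈ T i ∧
      ((Finset.univ.filter fun p : V × V =>
        p ∉ F i ∧ p.swap ∉ F i ∧ ¬(G.Adj p.1 p.2 ↔ R i p.1 p.2)).card : ℝ) ≤ m}.ncard : ℝ) ≤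
    Fintype.card ι * (t * (((Finset.univ : Finset (V × V)).powerset.filter
      fun Y => (Y.card : ℝ) ≤ m).card : ℝ)) := by
  refine ncard_exists_le _ _ fun i => ?_
  refine (ncard_graphs_le_of_code _ (F i) (R i) (T i) m (fun G hG => hG.1)
    (fun G hG => hG.2)).trans ?_
  exact mul_le_mul_of_nonneg_right (ht i) (Nat.cast_nonneg _)

theorem ncard_subsets {β : Type*} (F : Finset β) : ({X | X ⊆ F} : Set (Finset β)).ncard = 2 ^ F.card := by
  have : ({X | X ⊆ F} : Set (Finset β)) = ↑F.powerset := by ext; simp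
  rw [this, Set.ncard_coe_finset, Finset.card_powerset]

theorem card_filter_comp_le {V κ : Type*} [Fintype V] [Fintype κ] [DecidableEq κ] (φ : V → κ) (s : ℝ)
    (hs : ∀ i, ((Finset.univ.filter fun v => φ v = i).card : ℝ) ≤ s) (Q : Finset (κ × κ)) :
    ((Finset.univ.filter fun p : V × V => (φ p.1, φ p.2) ∈ Q).card : ℝ) ≤ Q.card * s ^ 2 := by
  have e := Finset.card_eq_sum_card_fiberwise
    (s := Finset.univ.filter fun p : V × V => (φ p.1, φ p.2) ∈ Q) (t := Q)
    (f := fun p => (φ p.1, φ p.2)) (fun p hp => (Finset.mem_filter.1 hp).2)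
  rw [e]; push_cast
  rw [← nsmul_eq_mul]
  refine Finset.sum_le_card_nsmul _ _ _ fun q hq => ?_
  have : (Finset.univ.filter fun p : V × V => (φ p.1, φ p.2) ∈ Q).filter
      (fun p => (φ p.1, φ p.2) = q) ⊆ (Finset.univ.filter fun v => φ v = q.1) ×ˢ
        (Finset.univ.filter fun v => φ v = q.2) := by
    rintro ⟨a, b⟩ hp
    simp only [Finset.mem_filter, Finset.mem_univ, true_and, Finset.mem_product] at hp ⊢
    rw [← hp.2]; simp
  have h2 := Finset.card_le_card this
  rw [Finset.card_product] at h2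
  have h3 : ((((Finset.univ.filter fun p : V × V => (φ p.1, φ p.2) ∈ Q).filter
      (fun p => (φ p.1, φ p.2) = q)).card : ℕ) : ℝ) ≤ ((Finset.univ.filter fun v => φ v = q.1).card : ℝ) *
        ((Finset.univ.filter fun v => φ v = q.2).card : ℝ) := by exact_mod_cast h2
  refine h3.trans ?_
  rw [pow_two]
  exact mul_le_mul (hs _) (hs _) (Nat.cast_nonneg _) ((Nat.cast_nonneg _).trans (hs q.1))

set_option maxHeartbeats 800000 in
theorem exists_deviation_form {V : Type} [Fintype V] [DecidableEq V] {G : SimpleGraph V} {k : ℕ}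
    (hk : 0 < k) {φ : V → Fin k} {Γ : SimpleGraph (Fin k)} {r : Fin k → Fin k → Prop} {s ε₁ δ : ℝ}
    (hΓ : ∀ i j l, Γ.Adj i j → Γ.Adj j l → Γ.Adj i l → False)
    (hs : ∀ i, ((Finset.univ.filter fun v => φ v = i).card : ℝ) ≤ s)
    (he : ((Finset.univ.filter fun p : V × V => ¬Γ.Adj (φ p.1) (φ p.2) ∧
          ¬(G.Adj p.1 p.2 ↔ r (φ p.1) (φ p.2))).card : ℝ) ≤ ε₁) :
    (∃ i : (V → Fin k) × Finset (Fin k × Fin k) × Finset (Fin k × Fin k),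
      ((Finset.univ.filter fun p : V × V => (i.1 p.1, i.1 p.2) ∈ i.2.1).card : ℝ) ≤
        (1 / 4 - δ / 2) * (k * s) ^ 2 ∧
      ((Finset.univ.filter fun p : V × V =>
        p ∉ (Finset.univ.filter fun p : V × V => (i.1 p.1, i.1 p.2) ∈ i.2.1) ∧
        p.swap ∉ (Finset.univ.filter fun p : V × V => (i.1 p.1, i.1 p.2) ∈ i.2.1) ∧
        ¬(G.Adj p.1 p.2 ↔ (i.1 p.1, i.1 p.2) ∈ i.2.2)).card : ℝ) ≤ ε₁) ∨
    (∃ i : Finset V × (V → Fin k) × Finset (Fin k × Fin k),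
      ((Finset.univ.filter fun p : V × V =>
        p ∉ i.1 ×ˢ i.1ᶜ ∧ p.swap ∉ i.1 ×ˢ i.1ᶜ ∧
        ¬(G.Adj p.1 p.2 ↔ (i.2.1 p.1, i.2.1 p.2) ∈ i.2.2)).card : ℝ) ≤ ε₁ + δ * (k * s) ^ 2) := by
  have : Nonempty (Fin k) := ⟨⟨0, hk⟩⟩
  have hcf := card_filter_comp_le φ s hs
  obtain ⟨A, hA, hm⟩ := mantel_stability Γ hΓ
  rw [Fintype.card_fin] at hm
  set q := (Aᶜ ×ˢ Aᶜ).filter fun p : Fin k × Fin k => Γ.Adj p.1 p.2 with hq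
  set r' : Finset (Fin k × Fin k) := Finset.univ.filter fun p => r p.1 p.2 with hr'
  by_cases hqc : δ * (k : ℝ) ^ 2 ≤ q.card
  · left
    set Γ' : Finset (Fin k × Fin k) := Finset.univ.filter fun p => p.1 < p.2 ∧ Γ.Adj p.1 p.2 with hΓ'
    have h2 : 2 * Γ'.card ≤ (Finset.univ.filter fun p : Fin k × Fin k => Γ.Adj p.1 p.2).card := by
      have e : (Γ'.image Prod.swap).card = Γ'.card :=
        Finset.card_image_of_injective _ Prod.swap_injective
      rw [two_mul]
      nth_rewrite 2 [← e]
      rw [← Finset.card_union_of_disjoint]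
      · apply Finset.card_le_card
        intro p hp
        simp only [hΓ', Finset.mem_union, Finset.mem_filter, Finset.mem_univ, true_and,
          Finset.mem_image] at hp ⊢
        rcases hp with hp | ⟨a, ha, rfl⟩
        · exact hp.2
        · exact ha.2.symm
      · rw [Finset.disjoint_left]
        intro p hp hp'
        simp only [hΓ', Finset.mem_filter, Finset.mem_univ, true_and,
          Finset.mem_image] at hp hp'
        obtain ⟨a, ha, rfl⟩ := hp'
        exact lt_asymm hp.1 ha.1
    refine ⟨(φ, Γ', r'), ?_, ?_⟩
    · refine (hcf Γ').trans ?_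
      rw [mul_pow, ← mul_assoc]
      refine mul_le_mul_of_nonneg_right ?_ (sq_nonneg s)
      have h3 : 2 * (2 * Γ'.card + q.card) ≤ k ^ 2 := by omega
      have h4 : 2 * (2 * (Γ'.card : ℝ) + q.card) ≤ (k : ℝ) ^ 2 := by exact_mod_cast h3
      linarith
    · refine le_trans ?_ he
      refine Nat.cast_le.2 (Finset.card_le_card ?_)
      intro p hp
      simp only [hΓ', hr', Finset.mem_filter, Finset.mem_univ, true_and, Prod.fst_swap,
        Prod.snd_swap] at hp ⊢
      refine ⟨fun hadj => ?_, hp.2.2⟩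
      rcases lt_or_gt_of_ne hadj.ne with h | h
      · exact hp.1 ⟨h, hadj⟩
      · exact hp.2.1 ⟨h, hadj.symm⟩
  · right
    push Not at hqc
    refine ⟨(Finset.univ.filter fun v => φ v ∈ A, φ, r'), ?_⟩
    have hsub : (Finset.univ.filter fun p : V × V =>
        p ∉ (Finset.univ.filter fun v => φ v ∈ A) ×ˢ (Finset.univ.filter fun v => φ v ∈ A)ᶜ ∧
        p.swap ∉ (Finset.univ.filter fun v => φ v ∈ A) ×ˢ (Finset.univ.filter fun v => φ v ∈ A)ᶜ ∧
        ¬(G.Adj p.1 p.2 ↔ (φ p.1, φ p.2) ∈ r')) ⊆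
        (Finset.univ.filter fun p : V × V => ¬Γ.Adj (φ p.1) (φ p.2) ∧
          ¬(G.Adj p.1 p.2 ↔ r (φ p.1) (φ p.2))) ∪
        (Finset.univ.filter fun p : V × V => (φ p.1, φ p.2) ∈ q) := by
      intro p hp
      simp only [hr', hq, Finset.mem_filter, Finset.mem_univ, true_and, Prod.fst_swap,
        Prod.snd_swap, Finset.mem_product, Finset.mem_compl, Finset.mem_union, not_and,
        not_not] at hp ⊢
      obtain ⟨h1, h2, h3⟩ := hp
      by_cases hadj : Γ.Adj (φ p.1) (φ p.2)
      · right
        refine ⟨⟨fun h => hA _ h _ (h1 h) hadj, fun h => hA _ (h2 h) _ h hadj⟩, hadj⟩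
      · exact Or.inl ⟨hadj, h3⟩
    have h1 := (Finset.card_le_card hsub).trans (Finset.card_union_le _ _)
    have h2 := hcf q
    have h3 : (q.card : ℝ) * s ^ 2 ≤ δ * (k * s) ^ 2 := by
      rw [mul_pow, ← mul_assoc]
      exact mul_le_mul_of_nonneg_right hqc.le (sq_nonneg s)
    refine (Nat.cast_le.2 h1).trans ?_
    push_cast
    exact add_le_add he (h2.trans h3)

theorem count_sparse_structures {V : Type} [Fintype V] [DecidableEq V] (k : ℕ) (a m : ℝ) :
    ({G : SimpleGraph V | ∃ i : (V → Fin k) × Finset (Fin k × Fin k) × Finset (Fin k × Fin k),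
      ((Finset.univ.filter fun p : V × V => (i.1 p.1, i.1 p.2) ∈ i.2.1).card : ℝ) ≤ a ∧
      ((Finset.univ.filter fun p : V × V =>
        p ∉ (Finset.univ.filter fun p : V × V => (i.1 p.1, i.1 p.2) ∈ i.2.1) ∧
        p.swap ∉ (Finset.univ.filter fun p : V × V => (i.1 p.1, i.1 p.2) ∈ i.2.1) ∧
        ¬(G.Adj p.1 p.2 ↔ (i.1 p.1, i.1 p.2) ∈ i.2.2)).card : ℝ) ≤ m}.ncard : ℝ) ≤
    ((k : ℝ) ^ Fintype.card V * 2 ^ k ^ 2 * 2 ^ k ^ 2) * (2 ^ a *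
      (((Finset.univ : Finset (V × V)).powerset.filter fun Y => (Y.card : ℝ) ≤ m).card : ℝ)) := by
  have h := count_deviation (V := V)
    (ι := (V → Fin k) × Finset (Fin k × Fin k) × Finset (Fin k × Fin k))
    (fun i => Finset.univ.filter fun p : V × V => (i.1 p.1, i.1 p.2) ∈ i.2.1)
    (fun i u v => (i.1 u, i.1 v) ∈ i.2.2)
    (fun i => {X | X ⊆ (Finset.univ.filter fun p : V × V => (i.1 p.1, i.1 p.2) ∈ i.2.1) ∧
      ((Finset.univ.filter fun p : V × V => (i.1 p.1, i.1 p.2) ∈ i.2.1).card : ℝ) ≤ a}) m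
    (2 ^ a) (fun i => ?_)
  · have hc : (Fintype.card ((V → Fin k) × Finset (Fin k × Fin k) × Finset (Fin k × Fin k)) : ℝ) =
        (k : ℝ) ^ Fintype.card V * 2 ^ k ^ 2 * 2 ^ k ^ 2 := by
      simp only [Fintype.card_prod, Fintype.card_fun, Fintype.card_fin, Fintype.card_finset]
      push_cast
      rw [pow_two k, mul_assoc]
    rw [hc] at h
    refine le_trans (Nat.cast_le.2 (Set.ncard_le_ncard ?_ (Set.toFinite _))) h
    rintro G ⟨i, h1, h2⟩
    exact ⟨i, ⟨Finset.filter_subset _ _, by convert h1⟩, by convert h2⟩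
  · by_cases ha : ((Finset.univ.filter fun p : V × V => (i.1 p.1, i.1 p.2) ∈ i.2.1).card : ℝ) ≤ a
    · simp only [ha, and_true]
      rw [ncard_subsets]
      push_cast
      rw [← Real.rpow_natCast]
      exact Real.rpow_le_rpow_of_exponent_le (by norm_num) ha
    · simp only [ha, and_false]
      rw [Set.ofPred_false, Set.ncard_empty, Nat.cast_zero]
      positivity

theorem count_bipartite_structures {V : Type} [Fintype V] [DecidableEq V] (k : ℕ)
    (T : Finset V → Set (Finset (V × V))) (t m : ℝ) (ht : ∀ A, ((T A).ncard : ℝ) ≤ t) :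
    ({G : SimpleGraph V | ∃ i : Finset V × (V → Fin k) × Finset (Fin k × Fin k),
      crossEdges G (i.1 ×ˢ i.1ᶜ) ∈ T i.1 ∧
      ((Finset.univ.filter fun p : V × V =>
        p ∉ i.1 ×ˢ i.1ᶜ ∧ p.swap ∉ i.1 ×ˢ i.1ᶜ ∧
        ¬(G.Adj p.1 p.2 ↔ (i.2.1 p.1, i.2.1 p.2) ∈ i.2.2)).card : ℝ) ≤ m}.ncard : ℝ) ≤
    (2 ^ Fintype.card V * (k : ℝ) ^ Fintype.card V * 2 ^ k ^ 2) * (t *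
      (((Finset.univ : Finset (V × V)).powerset.filter fun Y => (Y.card : ℝ) ≤ m).card : ℝ)) := by
  have h := count_deviation (V := V)
    (ι := Finset V × (V → Fin k) × Finset (Fin k × Fin k))
    (fun i => i.1 ×ˢ i.1ᶜ)
    (fun i u v => (i.2.1 u, i.2.1 v) ∈ i.2.2) (fun i => T i.1) m t (fun i => ht _)
  have hc : (Fintype.card (Finset V × (V → Fin k) × Finset (Fin k × Fin k)) : ℝ) =
        2 ^ Fintype.card V * (k : ℝ) ^ Fintype.card V * 2 ^ k ^ 2 := by
    simp only [Fintype.card_prod, Fintype.card_fun, Fintype.card_fin, Fintype.card_finset]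
    push_cast
    rw [pow_two k, mul_assoc]
  rw [hc] at h
  convert h

theorem card_mul_card_compl_le {V : Type*} [Fintype V] [DecidableEq V] (A : Finset V) {γ : ℝ} (hγ : 0 ≤ γ)
    (h : ¬|(A.card : ℝ) - (Fintype.card V : ℝ) / 2| ≤ γ * Fintype.card V) :
    (A.card * Aᶜ.card : ℝ) ≤ (1 / 4 - γ ^ 2) * (Fintype.card V : ℝ) ^ 2 := by
  have hc : (A.card : ℝ) + Aᶜ.card = Fintype.card V := by exact_mod_cast Finset.card_add_card_compl A
  have h2 : (γ * Fintype.card V) ^ 2 ≤ |(A.card : ℝ) - (Fintype.card V : ℝ) / 2| ^ 2 := by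
    have : 0 ≤ γ * Fintype.card V := by positivity
    push Not at h
    gcongr
  rw [sq_abs] at h2
  have : (Aᶜ.card : ℝ) = Fintype.card V - A.card := by linarith
  rw [this]
  nlinarith

theorem card_mul_card_compl_le' {V : Type*} [Fintype V] [DecidableEq V] (A : Finset V) :
    (A.card * Aᶜ.card : ℝ) ≤ (1 / 4) * (Fintype.card V : ℝ) ^ 2 := by
  have hc : (A.card : ℝ) + Aᶜ.card = Fintype.card V := by exact_mod_cast Finset.card_add_card_compl A
  have : (Aᶜ.card : ℝ) = Fintype.card V - A.card := by linarith
  rw [this]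
  nlinarith [sq_nonneg ((A.card : ℝ) - Fintype.card V / 2)]

theorem sparse_exponent_le {M n c δ : ℝ} (hM0 : 0 ≤ M) (hc0 : 0 < c) (hc16 : c ≤ 1 / 16)
    (hc2 : 16 * c ≤ δ) (hδ : δ ≤ 1 / 8) (hn1 : 20 * (M + 1) ≤ c * n) :
    M * n + M ^ 2 + M ^ 2 + ((1 / 4 - δ / 2) * (n + M) ^ 2 + δ / 8 * n ^ 2) ≤
      (1 / 4 - 2 * c) * n ^ 2 := by
  have hnM : 320 * (M + 1) ≤ n := by
    by_contra! h
    nlinarith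
  have hn0 : 0 ≤ n := by linarith
  have hMn : 0 ≤ M * n := mul_nonneg hM0 hn0
  have e2 : M ^ 2 ≤ M * n := by rw [pow_two]; exact mul_le_mul_of_nonneg_left (by linarith) hM0
  have e1 : (1 / 4 - δ / 2) * (n + M) ^ 2 ≤ (1 / 4 - δ / 2) * n ^ 2 + M * n := by
    have h1 : (1 / 4 - δ / 2) * (2 * (M * n) + M ^ 2) ≤ 1 / 4 * (2 * (M * n) + M ^ 2) :=
      mul_le_mul_of_nonneg_right (by linarith) (by positivity)
    linarith
  have e3 : 20 * (M + 1) * n ≤ c * n * n := mul_le_mul_of_nonneg_right hn1 hn0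
  have e4 : 16 * c * n ^ 2 ≤ δ * n ^ 2 := mul_le_mul_of_nonneg_right hc2 (sq_nonneg n)
  linarith

theorem bipartite_exponent_le {M n c γ : ℝ} (hM0 : 0 ≤ M) (hc0 : 0 < c) (hc16 : c ≤ 1 / 16)
    (hc1 : 16 * c ≤ γ ^ 2) (hn1 : 20 * (M + 1) ≤ c * n) :
    n + M * n + M ^ 2 + ((2 * n + 2 + (1 / 4 - γ ^ 2 / 2) * n ^ 2) + γ ^ 2 / 8 * n ^ 2) ≤
      (1 / 4 - 2 * c) * n ^ 2 := by
  have hnM : 320 * (M + 1) ≤ n := by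
    by_contra! h
    nlinarith
  have hn0 : 0 ≤ n := by linarith
  have e2 : M ^ 2 ≤ M * n := by rw [pow_two]; exact mul_le_mul_of_nonneg_left (by linarith) hM0
  have e3 : 20 * (M + 1) * n ≤ c * n * n := mul_le_mul_of_nonneg_right hn1 hn0
  have e4 : 16 * c * n ^ 2 ≤ γ ^ 2 * n ^ 2 := mul_le_mul_of_nonneg_right hc1 (sq_nonneg n)
  linarith [mul_nonneg hM0 hn0]

def badCross {V : Type} [Fintype V] [DecidableEq V] (γ d : ℝ) (A : Finset V) : Set (Finset (V × V)) :=
  {X | X ⊆ A ×ˢ Aᶜ ∧ (A.card * Aᶜ.card : ℝ) ≤ (1 / 4 - γ ^ 2) * (Fintype.card V : ℝ) ^ 2} ∪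
  {X | ∃ G : SimpleGraph V, ¬PR G A Aᶜ (γ * Fintype.card V) d ∧ crossEdges G (A ×ˢ Aᶜ) = X}

theorem two_mul_two_rpow (x : ℝ) : 2 * (2 : ℝ) ^ x = 2 ^ (x + 1) := by
  rw [Real.rpow_add_one two_ne_zero, mul_comm]

theorem natCast_pow_le_two_rpow (a b : ℕ) : ((a : ℝ) ^ b) ≤ 2 ^ ((a : ℝ) * b) := by
  rw [Real.rpow_mul_natCast (by norm_num), Real.rpow_natCast]
  have : (a : ℝ) ≤ 2 ^ a := by exact_mod_cast Nat.lt_two_pow_self.le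
  gcongr

set_option maxHeartbeats 1000000 in
theorem exists_few_unbalanced : ∃ d : ℝ, 0 < d ∧ d < 1 ∧ ∀ γ : ℝ, 0 < γ → ∃ c : ℝ, 0 < c ∧ ∃ n₀ : ℕ,
    ∀ {V : Type} [Fintype V] [DecidableEq V], n₀ ≤ Fintype.card V →
    ({G : SimpleGraph V | C5Free G ∧ ¬∃ A : Finset V, PR G A Aᶜ (γ * Fintype.card V) d ∧
      |(A.card : ℝ) - (Fintype.card V : ℝ) / 2| ≤ γ * Fintype.card V}.ncard : ℝ) ≤
      2 ^ ((1 / 4 - c) * (Fintype.card V : ℝ) ^ 2) := by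
  obtain ⟨d, hd0, hd1, hPR⟩ := exists_few_not_PR
  refine ⟨d, hd0, hd1, fun γ hγ => ?_⟩
  obtain ⟨η, hη0, hη1, hη⟩ := exists_few_small_subsets (γ ^ 2 / 8) (by positivity)
  set δ := η / 8 with hδ
  obtain ⟨η', hη'0, hη'1, hη'⟩ := exists_few_small_subsets (δ / 8) (by positivity)
  obtain ⟨M, hM⟩ := exists_regular_structure (min (η / 2) η') (by positivity)
  set c := min (γ ^ 2) δ / 16 with hc
  have hc0 : 0 < c := by positivity
  have hc1 : 16 * c ≤ γ ^ 2 := by rw [hc]; linarith [min_le_left (γ ^ 2) δ]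
  have hc2 : 16 * c ≤ δ := by rw [hc]; linarith [min_le_right (γ ^ 2) δ]
  refine ⟨c, hc0, ⌈20 * ((M : ℝ) + 1) / c⌉₊, fun {V} _ _ hn => ?_⟩
  have hn1 : 20 * ((M : ℝ) + 1) ≤ c * Fintype.card V := by
    have := (Nat.le_ceil _).trans (Nat.cast_le (α := ℝ) |>.2 hn)
    rw [div_le_iff₀ hc0] at this
    linarith
  set n : ℝ := (Fintype.card V : ℝ) with hnn
  have hM0 : (0 : ℝ) ≤ M := Nat.cast_nonneg M
  have hn0 : 0 ≤ n := Nat.cast_nonneg _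
  have hc16 : c ≤ 1 / 16 := by linarith
  have hδ1 : δ ≤ 1 / 8 := by linarith
  have hnM : 320 * ((M : ℝ) + 1) ≤ n := by nlinarith
  have huniv : ((Finset.univ : Finset (V × V)).card : ℝ) = n ^ 2 := by
    rw [Finset.card_univ, Fintype.card_prod, pow_two]; push_cast; rfl
  have h1 := hη (Finset.univ : Finset (V × V))
  have h2 := hη' (Finset.univ : Finset (V × V))
  rw [huniv] at h1 h2
  have hT : ∀ A : Finset V, ((badCross γ d A).ncard : ℝ) ≤ 2 ^ (2 * n + 2 + (1 / 4 - γ ^ 2 / 2) * n ^ 2) := by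
    intro A
    have e1 : (({X | X ⊆ A ×ˢ Aᶜ ∧ (A.card * Aᶜ.card : ℝ) ≤ (1 / 4 - γ ^ 2) * n ^ 2} :
        Set (Finset (V × V))).ncard : ℝ) ≤ 2 ^ (2 * n + 1 + (1 / 4 - γ ^ 2 / 2) * n ^ 2) := by
      by_cases ha : (A.card * Aᶜ.card : ℝ) ≤ (1 / 4 - γ ^ 2) * n ^ 2
      · simp only [ha, and_true]
        rw [ncard_subsets, Finset.card_product]
        push_cast
        rw [← Real.rpow_natCast]
        push_cast
        refine Real.rpow_le_rpow_of_exponent_le (by norm_num) (ha.trans ?_)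
        nlinarith [mul_nonneg (sq_nonneg γ) (sq_nonneg n)]
      · simp only [ha, and_false]
        rw [Set.ofPred_false, Set.ncard_empty, Nat.cast_zero]
        positivity
    have e2 := hPR A Aᶜ (γ * n) (by positivity)
    have e3 : (2 : ℝ) ^ (2 * (Fintype.card V : ℝ) + 1 + (A.card * Aᶜ.card : ℝ) - (γ * n) ^ 2 / 2) ≤
        2 ^ (2 * n + 1 + (1 / 4 - γ ^ 2 / 2) * n ^ 2) := by
      refine Real.rpow_le_rpow_of_exponent_le (by norm_num) ?_
      have := card_mul_card_compl_le' A
      rw [← hnn] at this ⊢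
      nlinarith
    have e4 := Set.ncard_union_le
      {X | X ⊆ A ×ˢ Aᶜ ∧ (A.card * Aᶜ.card : ℝ) ≤ (1 / 4 - γ ^ 2) * n ^ 2}
      {X | ∃ G : SimpleGraph V, ¬PR G A Aᶜ (γ * n) d ∧ crossEdges G (A ×ˢ Aᶜ) = X}
    have e5 : ((badCross γ d A).ncard : ℝ) ≤ 2 ^ (2 * n + 1 + (1 / 4 - γ ^ 2 / 2) * n ^ 2) +
        2 ^ (2 * n + 1 + (1 / 4 - γ ^ 2 / 2) * n ^ 2) := by
      refine (Nat.cast_le.2 e4).trans ?_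
      push_cast
      exact add_le_add e1 (e2.trans e3)
    refine e5.trans (le_of_eq ?_)
    rw [← two_mul, two_mul_two_rpow]
    congr 1; ring
  set S : Fin (M + 1) → SimpleGraph V → Prop := fun k G =>
    (∃ i : (V → Fin k) × Finset (Fin k × Fin k) × Finset (Fin k × Fin k),
      ((Finset.univ.filter fun p : V × V => (i.1 p.1, i.1 p.2) ∈ i.2.1).card : ℝ) ≤
        (1 / 4 - δ / 2) * (n + M) ^ 2 ∧
      ((Finset.univ.filter fun p : V × V =>
        p ∉ (Finset.univ.filter fun p : V × V => (i.1 p.1, i.1 p.2) ∈ i.2.1) ∧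
        p.swap ∉ (Finset.univ.filter fun p : V × V => (i.1 p.1, i.1 p.2) ∈ i.2.1) ∧
        ¬(G.Adj p.1 p.2 ↔ (i.1 p.1, i.1 p.2) ∈ i.2.2)).card : ℝ) ≤ η' * n ^ 2) ∨
    (∃ i : Finset V × (V → Fin k) × Finset (Fin k × Fin k),
      crossEdges G (i.1 ×ˢ i.1ᶜ) ∈ badCross γ d i.1 ∧
      ((Finset.univ.filter fun p : V × V =>
        p ∉ i.1 ×ˢ i.1ᶜ ∧ p.swap ∉ i.1 ×ˢ i.1ᶜ ∧
        ¬(G.Adj p.1 p.2 ↔ (i.2.1 p.1, i.2.1 p.2) ∈ i.2.2)).card : ℝ) ≤ η * n ^ 2) with hS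
  have hsub : {G : SimpleGraph V | C5Free G ∧ ¬∃ A : Finset V, PR G A Aᶜ (γ * n) d ∧
      |(A.card : ℝ) - n / 2| ≤ γ * n} ⊆ {G | ∃ k, S k G} := by
    rintro G ⟨hG, hGA⟩
    have hMn : 16 * M ≤ Fintype.card V := by
      have : ((16 * M : ℕ) : ℝ) ≤ (Fintype.card V : ℕ) := by push_cast; linarith
      exact_mod_cast this
    obtain ⟨k, hk0, hkM, φ, Γ, r, hΓ, hs, he⟩ := hM G hG hMn
    refine ⟨⟨k, by omega⟩, ?_⟩
    have hk0' : (0 : ℝ) < k := by exact_mod_cast hk0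
    have hkM' : (k : ℝ) ≤ M := by exact_mod_cast hkM
    have hks : (k : ℝ) * (n / k + 1) = n + k := by field_simp
    have hε1 : min (η / 2) η' * n ^ 2 ≤ η' * n ^ 2 :=
      mul_le_mul_of_nonneg_right (min_le_right _ _) (sq_nonneg n)
    have hε2 : min (η / 2) η' * n ^ 2 ≤ η / 2 * n ^ 2 :=
      mul_le_mul_of_nonneg_right (min_le_left _ _) (sq_nonneg n)
    rcases exists_deviation_form (δ := δ) hk0 hΓ hs he with ⟨i, h3, h4⟩ | ⟨i, h3⟩
    · refine Or.inl ⟨i, h3.trans ?_, h4.trans hε1⟩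
      rw [hks]
      have : 0 ≤ 1 / 4 - δ / 2 := by linarith
      gcongr
    · refine Or.inr ⟨i, ?_, h3.trans ?_⟩
      · by_cases hb : |(i.1.card : ℝ) - n / 2| ≤ γ * n
        · exact Or.inr ⟨G, fun hp => hGA ⟨i.1, hp, hb⟩, rfl⟩
        · exact Or.inl ⟨Finset.filter_subset _ _, card_mul_card_compl_le _ hγ.le hb⟩
      · rw [hks]
        have : δ * (n + k) ^ 2 ≤ δ * (4 * n ^ 2) := by
          gcongr
          nlinarith
        have e8 : δ * (4 * n ^ 2) = η / 2 * n ^ 2 := by rw [hδ]; ring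
        linarith
  refine (Nat.cast_le.2 (Set.ncard_le_ncard hsub (Set.toFinite _))).trans ?_
  refine (ncard_exists_le S (2 ^ ((1 / 4 - 2 * c) * n ^ 2 + 1)) fun k => ?_).trans ?_
  · have hkM : ((k : ℕ) : ℝ) ≤ M := by exact_mod_cast Nat.lt_succ_iff.1 k.2
    have hkn : (((k : ℕ) : ℝ) ^ Fintype.card V) ≤ 2 ^ ((M : ℝ) * n) := by
      refine (natCast_pow_le_two_rpow _ _).trans ?_
      refine Real.rpow_le_rpow_of_exponent_le (by norm_num) ?_
      exact mul_le_mul_of_nonneg_right hkM hn0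
    have hk2 : ((2 : ℝ) ^ (k : ℕ) ^ 2) ≤ 2 ^ ((M : ℝ) ^ 2) := by
      rw [← Real.rpow_natCast]
      refine Real.rpow_le_rpow_of_exponent_le (by norm_num) ?_
      push_cast
      gcongr
    have b1 := count_sparse_structures (V := V) k ((1 / 4 - δ / 2) * (n + M) ^ 2) (η' * n ^ 2)
    have b2 := count_bipartite_structures (V := V) k (badCross γ d) _ (η * n ^ 2) hT
    have c1 : ((k : ℕ) : ℝ) ^ Fintype.card V * 2 ^ (k : ℕ) ^ 2 * 2 ^ (k : ℕ) ^ 2 *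
        (2 ^ ((1 / 4 - δ / 2) * (n + M) ^ 2) *
        (((Finset.univ : Finset (V × V)).powerset.filter fun Y => (Y.card : ℝ) ≤ η' * n ^ 2).card : ℝ)) ≤
        2 ^ ((1 / 4 - 2 * c) * n ^ 2) := by
      calc _ ≤ (2 : ℝ) ^ ((M : ℝ) * n) * 2 ^ ((M : ℝ) ^ 2) * 2 ^ ((M : ℝ) ^ 2) *
            (2 ^ ((1 / 4 - δ / 2) * (n + M) ^ 2) * 2 ^ (δ / 8 * n ^ 2)) := by gcongr
        _ = 2 ^ ((M : ℝ) * n + (M : ℝ) ^ 2 + (M : ℝ) ^ 2 + ((1 / 4 - δ / 2) * (n + M) ^ 2 +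
            δ / 8 * n ^ 2)) := by
          simp only [← Real.rpow_add (show (0 : ℝ) < 2 by norm_num)]
        _ ≤ _ := by
          refine Real.rpow_le_rpow_of_exponent_le (by norm_num) ?_
          exact sparse_exponent_le hM0 hc0 hc16 hc2 hδ1 hn1
    have c2 : 2 ^ Fintype.card V * ((k : ℕ) : ℝ) ^ Fintype.card V * 2 ^ (k : ℕ) ^ 2 *
        (2 ^ (2 * n + 2 + (1 / 4 - γ ^ 2 / 2) * n ^ 2) *
        (((Finset.univ : Finset (V × V)).powerset.filter fun Y => (Y.card : ℝ) ≤ η * n ^ 2).card : ℝ)) ≤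
        2 ^ ((1 / 4 - 2 * c) * n ^ 2) := by
      calc _ ≤ (2 : ℝ) ^ n * 2 ^ ((M : ℝ) * n) * 2 ^ ((M : ℝ) ^ 2) *
            (2 ^ (2 * n + 2 + (1 / 4 - γ ^ 2 / 2) * n ^ 2) * 2 ^ (γ ^ 2 / 8 * n ^ 2)) := by
            rw [← Real.rpow_natCast 2 (Fintype.card V)]
            gcongr
        _ = 2 ^ (n + (M : ℝ) * n + (M : ℝ) ^ 2 + ((2 * n + 2 + (1 / 4 - γ ^ 2 / 2) * n ^ 2) +
            γ ^ 2 / 8 * n ^ 2)) := by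
          simp only [← Real.rpow_add (show (0 : ℝ) < 2 by norm_num)]
        _ ≤ _ := by
          refine Real.rpow_le_rpow_of_exponent_le (by norm_num) ?_
          exact bipartite_exponent_le hM0 hc0 hc16 hc1 hn1
    have e : {x | S k x} ⊆ {x | _} ∪ {x | _} := fun x hx => hx
    refine (Nat.cast_le.2 ((Set.ncard_le_ncard e (Set.toFinite _)).trans (Set.ncard_union_le _ _))).trans ?_
    push_cast
    refine (add_le_add (b1.trans c1) (b2.trans c2)).trans (le_of_eq ?_)
    rw [← two_mul, two_mul_two_rpow]
  · rw [Fintype.card_fin]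
    have e1 : ((M + 1 : ℕ) : ℝ) ≤ 2 ^ ((M + 1 : ℕ) : ℝ) := by
      rw [Real.rpow_natCast]
      exact_mod_cast Nat.lt_two_pow_self.le
    calc ((M + 1 : ℕ) : ℝ) * 2 ^ ((1 / 4 - 2 * c) * n ^ 2 + 1) ≤
        2 ^ ((M + 1 : ℕ) : ℝ) * 2 ^ ((1 / 4 - 2 * c) * n ^ 2 + 1) := by gcongr
      _ = 2 ^ (((M + 1 : ℕ) : ℝ) + ((1 / 4 - 2 * c) * n ^ 2 + 1)) := by
        rw [← Real.rpow_add (show (0 : ℝ) < 2 by norm_num)]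
      _ ≤ _ := by
        refine Real.rpow_le_rpow_of_exponent_le (by norm_num) ?_
        push_cast
        nlinarith

def rowOf {V : Type*} (E : Finset (V × V)) (a : V) : Finset V :=
  (E.filter fun p => p.1 = a).image Prod.snd

theorem mem_rowOf {V : Type*} {E : Finset (V × V)} {a b : V} : b ∈ rowOf E a ↔ (a, b) ∈ E := by
  simp only [rowOf, Finset.mem_image, Finset.mem_filter]
  constructor
  · rintro ⟨⟨x, y⟩, ⟨h1, h2⟩, h3⟩
    simp only at h2 h3
    rw [← h2, ← h3]; exact h1
  · intro h; exact ⟨(a, b), ⟨h, rfl⟩, rfl⟩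

theorem card_eq_sum_rowOf {V : Type*} {E : Finset (V × V)} {X Y : Finset V} (hE : E ⊆ X ×ˢ Y) :
    E.card = ∑ a ∈ X, (rowOf E a).card := by
  rw [Finset.card_eq_sum_card_fiberwise (t := X) (f := Prod.fst)
    (fun p hp => (Finset.mem_product.1 (hE hp)).1)]
  refine Finset.sum_congr rfl fun a _ => ?_
  rw [rowOf, Finset.card_image_of_injOn]
  rintro ⟨x, y⟩ h1 ⟨z, w⟩ h2 h
  simp only [Finset.coe_filter, Set.mem_ofPred_eq] at h1 h2 h
  rw [h1.2, h2.2, h]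

theorem card_rich_rows {V : Type*} {E : Finset (V × V)} {X Y : Finset V} {N x : ℝ}
    (hE : E ⊆ X ×ˢ Y) (hX : X.card ≤ N) (hY : Y.card ≤ N) (hN : 0 < N) (hx : 0 ≤ x)
    (h : 2 * x * N ≤ E.card) : x ≤ ((X.filter fun a => x ≤ ((rowOf E a).card : ℝ)).card : ℝ) := by
  have h1 : (E.card : ℝ) ≤ ∑ a ∈ X, ((if x ≤ ((rowOf E a).card : ℝ) then N else 0) + x) := by
    rw [card_eq_sum_rowOf hE]; push_cast
    refine Finset.sum_le_sum fun a _ => ?_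
    split_ifs with hc
    · have : ((rowOf E a).card : ℝ) ≤ N := by
        refine le_trans (Nat.cast_le.2 (Finset.card_le_card ?_)) hY
        intro b hb
        exact (Finset.mem_product.1 (hE (mem_rowOf.1 hb))).2
      linarith
    · linarith
  rw [Finset.sum_add_distrib, ← Finset.sum_filter, Finset.sum_const, Finset.sum_const,
    nsmul_eq_mul, nsmul_eq_mul] at h1
  have h2 : (X.card : ℝ) * x ≤ N * x := mul_le_mul_of_nonneg_right hX hx
  by_contra! hcon
  have := mul_lt_mul_of_pos_right hcon hN
  linarith

theorem PR.exists_extension {V : Type*} {G : SimpleGraph V} {A B B' : Finset V} {E : Finset (V × V)}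
    {g d N x : ℝ} (h : PR G A B g d) (hAB : Disjoint A B) (hg : 0 < g) (hd : 0 < d)
    (hE : E ⊆ A ×ˢ A) (hA : A.card ≤ N) (hN : 0 < N) (hx : 2 * x * N ≤ E.card) (hB : B' ⊆ B)
    (hgx : 2 * g ≤ x) (hgB : g ≤ B'.card) (hgB' : g ≤ d * B'.card) (p q : Bool) : ∃ b ∈ B',
      d ^ 2 * x ^ 2 / 2 ≤ ((E.filter fun e => (G.Adj e.1 b ↔ p = true) ∧
        (G.Adj e.2 b ↔ q = true)).card : ℝ) := by
  have hx0 : 0 < x := by linarith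
  set X0 := A.filter fun a => x ≤ ((rowOf E a).card : ℝ) with hX0
  have h0 : x ≤ (X0.card : ℝ) := card_rich_rows hE hA hA hN hx0.le hx
  set X1 := X0.filter fun a => ¬((nb G B' a p).card : ℝ) < d * B'.card with hX1
  have h1 : x / 2 ≤ (X1.card : ℝ) := by
    have e1 := Finset.card_filter_add_card_filter_not (s := X0)
      (fun a => ((nb G B' a p).card : ℝ) < d * B'.card)
    have e2 : ((X0.filter fun a => ((nb G B' a p).card : ℝ) < d * B'.card).card : ℝ) < g :=
      lt_of_le_of_lt (Nat.cast_le.2 (Finset.card_le_card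
        (Finset.filter_subset_filter _ (Finset.filter_subset _ _)))) (h.card_bad_lt hAB hg hB hgB p)
    have e3 : ((X0.filter fun a => ((nb G B' a p).card : ℝ) < d * B'.card).card : ℝ) +
      X1.card = X0.card := by exact_mod_cast e1
    linarith
  have hBpos : (0 : ℝ) < B'.card := hg.trans_le hgB
  have h2 : ∑ b ∈ B', ((E.filter fun e => (G.Adj e.1 b ↔ p = true) ∧
        (G.Adj e.2 b ↔ q = true)).card : ℝ) =
      ∑ a ∈ A, (((rowOf E a ×ˢ B').filter fun e => (G.Adj a e.2 ↔ p = true) ∧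
        (G.Adj e.1 e.2 ↔ q = true)).card : ℝ) := by
    have e1 : ∀ b, ((E.filter fun e => (G.Adj e.1 b ↔ p = true) ∧
        (G.Adj e.2 b ↔ q = true)).card) = ∑ a ∈ A, ((rowOf E a).filter fun a' =>
          (G.Adj a b ↔ p = true) ∧ (G.Adj a' b ↔ q = true)).card := by
      intro b
      rw [card_eq_sum_rowOf (X := A) (Y := A) ((Finset.filter_subset _ _).trans hE)]
      refine Finset.sum_congr rfl fun a _ => ?_
      congr 1
      ext a'
      simp only [mem_rowOf, Finset.mem_filter]
    simp only [e1]
    push_cast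
    rw [Finset.sum_comm]
    refine Finset.sum_congr rfl fun a _ => ?_
    rw [Finset.card_filter, Finset.sum_product_right]
    push_cast
    refine Finset.sum_congr rfl fun b _ => ?_
    rw [Finset.card_filter]
    push_cast
    rfl
  have h3 : ∀ a ∈ X1, d ^ 2 * x * B'.card ≤ (((rowOf E a ×ˢ B').filter fun e =>
      (G.Adj a e.2 ↔ p = true) ∧ (G.Adj e.1 e.2 ↔ q = true)).card : ℝ) := by
    intro a ha
    simp only [hX1, hX0, Finset.mem_filter, not_lt] at ha
    obtain ⟨⟨haA, hr⟩, hnb⟩ := ha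
    have e1 := h (rowOf E a) (fun b hb => (Finset.mem_product.1 (hE (mem_rowOf.1 hb))).2)
      (nb G B' a p) ((nb_subset _ _ _ _).trans hB) (by linarith) (by linarith) q
    refine le_trans ?_ (e1.trans (Nat.cast_le.2 (Finset.card_le_card ?_)))
    · have : d * x * (d * B'.card) ≤ d * (rowOf E a).card * (nb G B' a p).card := by gcongr
      linarith
    · intro e he
      simp only [Finset.mem_filter, Finset.mem_product, mem_nb] at he ⊢
      tauto
  have h4 : d ^ 2 * x ^ 2 / 2 * B'.card ≤ ∑ b ∈ B', ((E.filter fun e => (G.Adj e.1 b ↔ p = true) ∧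
        (G.Adj e.2 b ↔ q = true)).card : ℝ) := by
    rw [h2]
    refine le_trans ?_ (Finset.sum_le_sum_of_subset_of_nonneg
      ((Finset.filter_subset _ _).trans (Finset.filter_subset _ _) : X1 ⊆ A)
      fun _ _ _ => Nat.cast_nonneg _)
    refine le_trans ?_ (Finset.card_nsmul_le_sum X1 _ _ h3)
    rw [nsmul_eq_mul]
    have : x / 2 * (d ^ 2 * x * B'.card) ≤ X1.card * (d ^ 2 * x * B'.card) := by gcongr
    linarith
  by_contra! hcon
  have h5 := Finset.sum_lt_sum_of_nonempty (Finset.card_pos.1 (Nat.cast_pos.1 hBpos)) hcon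
  rw [Finset.sum_const, nsmul_eq_mul] at h5
  linarith

theorem PR.exists_pattern {V : Type*} {G : SimpleGraph V} {A B : Finset V} {E F : Finset (V × V)}
    {g d N x : ℝ} (h : PR G A B g d) (hAB : Disjoint A B) (hg : 0 < g) (hd : 0 < d) (hd1 : d ≤ 1)
    (hE : E ⊆ A ×ˢ A) (hF : F ⊆ B ×ˢ B) (hA : A.card ≤ N) (hB : B.card ≤ N) (hN : 0 < N)
    (hx : 2 * x * N ≤ E.card) (hx' : 2 * x * N ≤ F.card)
    (hx0 : 0 < x)
    (hgx : 8 * g * N ≤ d ^ 2 * x ^ 2) (hxN : x ≤ N)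
    (p₁ q₁ p₂ q₂ : Bool) : ∃ e ∈ E, ∃ f ∈ F, (G.Adj e.1 f.1 ↔ p₁ = true) ∧
      (G.Adj e.2 f.1 ↔ q₁ = true) ∧ (G.Adj e.1 f.2 ↔ p₂ = true) ∧ (G.Adj e.2 f.2 ↔ q₂ = true) := by
  have hgx1 : 8 * g ≤ d * x := by
    refine le_of_mul_le_mul_right ?_ hN
    calc 8 * g * N ≤ d ^ 2 * x ^ 2 := hgx
      _ = (d * x) * (d * x) := by ring
      _ ≤ (d * x) * (1 * N) := by gcongr
      _ = d * x * N := by ring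
  have hgx2 : d * x ≤ x := by nlinarith
  obtain ⟨b, hb, hEb⟩ := h.exists_extension hAB hg hd hE hA hN hx
    (B' := B.filter fun a => x ≤ ((rowOf F a).card : ℝ)) (Finset.filter_subset _ _) (by linarith)
    (by linarith [card_rich_rows hF hB hB hN hx0.le hx'])
    (by nlinarith [card_rich_rows hF hB hB hN hx0.le hx']) p₁ q₁
  rw [Finset.mem_filter] at hb
  obtain ⟨b', hb', hE'⟩ := h.exists_extension hAB hg hd
    ((Finset.filter_subset (fun e : V × V => (G.Adj e.1 b ↔ p₁ = true) ∧
      (G.Adj e.2 b ↔ q₁ = true)) E).trans hE) hA hN (x := d ^ 2 * x ^ 2 / (4 * N))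
    (by refine le_trans (le_of_eq ?_) hEb; field_simp; ring) (B' := rowOf F b)
    (fun b' hb' => (Finset.mem_product.1 (hF (mem_rowOf.1 hb'))).2)
    (by rw [le_div_iff₀ (by positivity)]; linarith) (by linarith) (by nlinarith) p₂ q₂
  have hpos : 0 < d ^ 2 * (d ^ 2 * x ^ 2 / (4 * N)) ^ 2 / 2 := by positivity
  obtain ⟨e, he⟩ := Finset.card_pos.1 (Nat.cast_pos.1 (hpos.trans_le hE'))
  simp only [Finset.mem_filter] at he
  exact ⟨e, he.1.1, (b, b'), mem_rowOf.1 hb', he.1.2.1, he.1.2.2, he.2.1, he.2.2⟩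

/-- the vertices of `D` that distinguish `u` from `v` -/
def disc {V : Type*} (G : SimpleGraph V) (D : Finset V) (u v : V) : Finset V :=
  D.filter fun w => w ≠ u ∧ w ≠ v ∧ ¬(G.Adj u w ↔ G.Adj v w)

theorem mem_disc {V : Type*} {G : SimpleGraph V} {D : Finset V} {u v w : V} :
    w ∈ disc G D u v ↔ w ∈ D ∧ w ≠ u ∧ w ≠ v ∧ ¬(G.Adj u w ↔ G.Adj v w) := Finset.mem_filter

theorem disc_compl {V : Type*} (G : SimpleGraph V) (D : Finset V) (u v : V) :
    disc Gᶜ D u v = disc G D u v := by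
  ext w
  simp only [mem_disc, SimpleGraph.compl_adj]
  constructor <;> rintro ⟨h1, h2, h3, h4⟩ <;> refine ⟨h1, h2, h3, ?_⟩ <;>
    simp only [h2.symm, h3.symm, ne_eq, not_false_eq_true, true_and] at * <;> tauto

/-- `v` is almost homogeneous to `D`, or has the same neighbourhood in `D`, up to few vertices,
as many vertices of `D`. -/
def SimpleOn {V : Type*} (G : SimpleGraph V) (D : Finset V) (v : V) (s κ m : ℝ) : Prop :=
  (∃ b, ((nb G D v b).card : ℝ) ≤ s) ∨
    m ≤ ((D.filter fun u => u ≠ v ∧ ((disc G D u v).card : ℝ) ≤ κ).card : ℝ)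

theorem SimpleOn.of_compl {V : Type*} {G : SimpleGraph V} {D : Finset V} {v : V} {s κ m : ℝ}
    (h : SimpleOn Gᶜ D v s κ m) : SimpleOn G D v s κ m := by
  refine h.imp ?_ ?_
  · rintro ⟨b, hb⟩
    exact ⟨!b, by rwa [nb_compl] at hb⟩
  · simp only [disc_compl]
    exact id

theorem SimpleOn.compl {V : Type*} {G : SimpleGraph V} {D : Finset V} {v : V} {s κ m : ℝ}
    (h : SimpleOn G D v s κ m) : SimpleOn Gᶜ D v s κ m :=
  SimpleOn.of_compl (by rwa [compl_compl])

def pairsOn {V : Type*} (G : SimpleGraph V) (X Y : Finset V) (b : Bool) : Finset (V × V) :=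
  (X ×ˢ Y).filter fun e => e.1 ≠ e.2 ∧ (G.Adj e.1 e.2 ↔ b = true)

theorem mem_pairsOn {V : Type*} {G : SimpleGraph V} {X Y : Finset V} {b : Bool} {e : V × V} :
    e ∈ pairsOn G X Y b ↔ (e.1 ∈ X ∧ e.2 ∈ Y) ∧ e.1 ≠ e.2 ∧ (G.Adj e.1 e.2 ↔ b = true) := by
  rw [pairsOn, Finset.mem_filter, Finset.mem_product]

theorem pairsOn_compl {V : Type*} (G : SimpleGraph V) (X Y : Finset V) (b : Bool) :
    pairsOn Gᶜ X Y b = pairsOn G X Y (!b) := by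
  ext e
  simp only [mem_pairsOn, SimpleGraph.compl_adj]
  cases b <;> simp
  all_goals tauto

theorem card_pairsOn_swap {V : Type*} (G : SimpleGraph V) (X Y : Finset V) (b : Bool) :
    (pairsOn G X Y b).card = (pairsOn G Y X b).card := by
  refine Finset.card_bij (fun e _ => e.swap) ?_ ?_ ?_
  · intro e he
    simp only [mem_pairsOn, Prod.fst_swap, Prod.snd_swap] at he ⊢
    exact ⟨he.1.symm, he.2.1.symm, by rw [G.adj_comm]; exact he.2.2⟩
  · intro e _ f _ h; exact Prod.swap_injective h
  · intro e he
    refine ⟨e.swap, ?_, by simp⟩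
    simp only [mem_pairsOn, Prod.fst_swap, Prod.snd_swap] at he ⊢
    exact ⟨he.1.symm, he.2.1.symm, by rw [G.adj_comm]; exact he.2.2⟩

theorem card_pairsOn_add {V : Type*} (G : SimpleGraph V) {X Y : Finset V} (h : Disjoint X Y) :
    (pairsOn G X Y true).card + (pairsOn G X Y false).card = X.card * Y.card := by
  rw [← Finset.card_product, ← Finset.card_filter_add_card_filter_not (s := X ×ˢ Y)
    (fun e => G.Adj e.1 e.2)]
  congr 2 <;> ext e <;> simp only [mem_pairsOn, Finset.mem_filter, Finset.mem_product]
    <;> constructor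
  · rintro ⟨h1, -, h2⟩; simpa [h1] using h2
  · rintro ⟨h1, h2⟩; exact ⟨h1, h2.ne, by simpa using h2⟩
  · rintro ⟨h1, -, h2⟩; exact ⟨h1, by simpa using h2⟩
  · rintro ⟨h1, h2⟩
    exact ⟨h1, fun he => (Finset.disjoint_left.1 h) h1.1 (he ▸ h1.2), by simpa using h2⟩

theorem disjoint_nb {V : Type*} (G : SimpleGraph V) (D : Finset V) (v : V) :
    Disjoint (nb G D v true) (nb G D v false) := by
  rw [Finset.disjoint_left]
  intro w h1 h2
  simp only [mem_nb] at h1 h2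
  simp_all

theorem simpleOn_of_few_pairs {V : Type*} {G : SimpleGraph V} {D : Finset V} {v : V} {s : ℝ}
    (hs : 0 < s) (h1 : s ≤ ((nb G D v true).card : ℝ))
    (h2 : ((pairsOn G (nb G D v true) (nb G D v true) false).card : ℝ) +
      (pairsOn G (nb G D v true) (nb G D v false) true).card ≤ s ^ 2 / 2) :
    SimpleOn G D v s s (s / 2) := by
  right
  set D1 := nb G D v true with hD1
  have e1 : ((∑ u ∈ D1, (disc G D u v).card : ℕ) : ℝ) ≤ s ^ 2 / 2 := by
    refine le_trans ?_ h2
    rw [card_eq_sum_rowOf (E := pairsOn G D1 D1 false) (Finset.filter_subset _ _),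
      card_eq_sum_rowOf (E := pairsOn G D1 (nb G D v false) true) (Finset.filter_subset _ _)]
    norm_cast
    rw [← Finset.sum_add_distrib]
    refine Finset.sum_le_sum fun u hu => ?_
    refine le_trans (Finset.card_le_card ?_) (Finset.card_union_le _ _)
    intro w hw
    rw [mem_disc] at hw
    simp only [Finset.mem_union, mem_rowOf, mem_pairsOn, hD1, mem_nb] at hu ⊢
    by_cases hvw : G.Adj v w
    · left
      exact ⟨⟨hu, hw.1, hw.2.2.1, by simpa using hvw⟩, hw.2.1.symm, by simp; tauto⟩
    · right
      exact ⟨⟨hu, hw.1, hw.2.2.1, by simpa using hvw⟩, hw.2.1.symm, by simp; tauto⟩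
  have e2 : ((D1.filter fun u => ¬((disc G D u v).card : ℝ) ≤ s).card : ℝ) * s ≤ s ^ 2 / 2 := by
    refine le_trans ?_ e1
    push_cast
    refine le_trans ?_ (Finset.sum_le_sum_of_subset_of_nonneg (Finset.filter_subset
      (fun u => ¬((disc G D u v).card : ℝ) ≤ s) D1) fun _ _ _ => Nat.cast_nonneg _)
    rw [← nsmul_eq_mul]
    refine Finset.card_nsmul_le_sum _ _ _ fun u hu => ?_
    exact (not_le.1 (Finset.mem_filter.1 hu).2).le
  have e3 := Finset.card_filter_add_card_filter_not (s := D1)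
    (fun u => ((disc G D u v).card : ℝ) ≤ s)
  have e4 : ((D1.filter fun u => ((disc G D u v).card : ℝ) ≤ s).card : ℝ) +
      (D1.filter fun u => ¬((disc G D u v).card : ℝ) ≤ s).card = D1.card := by exact_mod_cast e3
  have e5 : ((D1.filter fun u => ¬((disc G D u v).card : ℝ) ≤ s).card : ℝ) ≤ s / 2 := by
    rw [← mul_le_mul_iff_left₀ hs]; linarith
  have e6 : ((D1.filter fun u => ((disc G D u v).card : ℝ) ≤ s).card : ℝ) ≤
      ((D.filter fun u => u ≠ v ∧ ((disc G D u v).card : ℝ) ≤ s).card : ℝ) := by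
    refine Nat.cast_le.2 (Finset.card_le_card fun u hu => ?_)
    simp only [Finset.mem_filter, hD1, mem_nb] at hu ⊢
    exact ⟨hu.1.1, hu.1.2.1, hu.2⟩
  linarith

theorem PR.few_pairs {V : Type*} {G : SimpleGraph V} {A B : Finset V} {g d N x : ℝ}
    (h : PR G A B g d) (hAB : Disjoint A B) (hg : 0 < g) (hd : 0 < d)
    (hd1 : d ≤ 1) (hA : A.card ≤ N) (hB : B.card ≤ N) (hN : 0 < N) (hx0 : 0 < x) (hxN : x ≤ N)
    (hgx : 8 * g * N ≤ d ^ 2 * x ^ 2) {X Y Z W : Finset V} (p q r s t u : Bool)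
    (hX : X ⊆ A) (hY : Y ⊆ A) (hZ : Z ⊆ B) (hW : W ⊆ B)
    (hC : ∀ a ∈ X, ∀ a' ∈ Y, ∀ b ∈ Z, ∀ b' ∈ W, (G.Adj a a' ↔ p = true) → (G.Adj b b' ↔ q = true) →
      a ≠ a' → b ≠ b' → (G.Adj a b ↔ r = true) → (G.Adj a' b ↔ s = true) →
      (G.Adj a b' ↔ t = true) → (G.Adj a' b' ↔ u = true) → False) :
    ((pairsOn G X Y p).card : ℝ) < 2 * x * N ∨ ((pairsOn G Z W q).card : ℝ) < 2 * x * N := by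
  by_contra! hcon
  obtain ⟨e, he, f, hf, h1, h2, h3, h4⟩ := h.exists_pattern hAB hg hd hd1 (E := pairsOn G X Y p)
    (F := pairsOn G Z W q)
    ((Finset.filter_subset _ _).trans (Finset.product_subset_product hX hY))
    ((Finset.filter_subset _ _).trans (Finset.product_subset_product hZ hW)) hA hB hN hcon.1
    hcon.2 hx0 hgx hxN r s t u
  rw [mem_pairsOn] at he hf
  exact hC e.1 he.1.1 e.2 he.1.2 f.1 hf.1.1 f.2 hf.1.2 he.2.2 hf.2.2 he.2.1 hf.2.1 h1 h2 h3 h4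

theorem simpleOn_or_of_dense {V : Type*} {G : SimpleGraph V} {A B : Finset V} {v : V}
    {g d N s : ℝ} (hfree : C5Free G) (h : PR G A B g d) (hAB : Disjoint A B) (hg : 0 < g)
    (hd : 0 < d) (hd1 : d ≤ 1) (hA : A.card ≤ N) (hB : B.card ≤ N) (hs : 0 < s) (hsN : s ≤ N)
    (hgs : 512 * g * N ^ 3 ≤ d ^ 2 * s ^ 4) (h1 : ∀ b, s ≤ ((nb G A v b).card : ℝ))
    (h2 : ∀ b, s ≤ ((nb G B v b).card : ℝ))
    (h3 : s ^ 2 / 4 ≤ ((pairsOn G (nb G A v true) (nb G A v false) true).card : ℝ)) :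
    SimpleOn G A v s s (s / 2) ∨ SimpleOn G B v s s (s / 2) := by
  have hN : 0 < N := hs.trans_le hsN
  have hx0 : 0 < s ^ 2 / (8 * N) := by positivity
  have hxN : s ^ 2 / (8 * N) ≤ N := by
    rw [div_le_iff₀ (by positivity)]; nlinarith
  have hgx : 8 * g * N ≤ d ^ 2 * (s ^ 2 / (8 * N)) ^ 2 := by
    rw [div_pow, mul_div_assoc', le_div_iff₀ (by positivity)]
    nlinarith
  have hx2 : 2 * (s ^ 2 / (8 * N)) * N = s ^ 2 / 4 := by field_simp; ring
  have key := fun {X Y Z W : Finset V} => h.few_pairs hAB hg hd hd1 hA hB hN hx0 hxN hgx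
    (X := X) (Y := Y) (Z := Z) (W := W)
  rw [hx2] at key
  have c1 : ((pairsOn G (nb G B v true) (nb G B v false) true).card : ℝ) < s ^ 2 / 4 := by
    refine (key true true false false false true (nb_subset _ _ _ _) (nb_subset _ _ _ _)
      (nb_subset _ _ _ _) (nb_subset _ _ _ _) ?_).resolve_left (not_lt.2 h3)
    intro a ha a' ha' b hb b' hb' e1 e2 _ _ e3 e4 e5 e6
    simp only [mem_nb, iff_true, Bool.false_eq_true, iff_false] at *
    exact hfree v a a' b' b ha.2.2 e1 e6 e2.symm hb.2.2.symm ha'.2.2 e5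
      (fun h => e4 h) (fun h => hb'.2.2 h.symm) (fun h => e3 h.symm)
  have c2 : s ^ 2 / 4 ≤ ((pairsOn G (nb G B v true) (nb G B v false) false).card : ℝ) := by
    have := card_pairsOn_add G (disjoint_nb G B v)
    have h4 : ((pairsOn G (nb G B v true) (nb G B v false) true).card : ℝ) +
      (pairsOn G (nb G B v true) (nb G B v false) false).card =
        (nb G B v true).card * (nb G B v false).card := by exact_mod_cast this
    have : s * s ≤ (nb G B v true).card * ((nb G B v false).card : ℝ) :=
      mul_le_mul (h2 _) (h2 _) hs.le (Nat.cast_nonneg _)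
    nlinarith
  have c3 : ((pairsOn G (nb G A v true) (nb G A v false) false).card : ℝ) < s ^ 2 / 4 := by
    refine (key false false false true true true (nb_subset _ _ _ _) (nb_subset _ _ _ _)
      (nb_subset _ _ _ _) (nb_subset _ _ _ _) ?_).resolve_right (not_lt.2 c2)
    intro a ha a' ha' b hb b' hb' e1 e2 n1 n2 e3 e4 e5 e6
    simp only [mem_nb, iff_true, Bool.false_eq_true, iff_false] at *
    have n3 : a ≠ b := fun h => (Finset.disjoint_left.1 hAB) ha.1 (h ▸ hb.1)
    refine hfree.compl v a' a b b' ?_ ?_ ?_ ?_ ?_ ?_ ?_ ?_ ?_ ?_ <;>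
      simp only [SimpleGraph.compl_adj, not_and, not_not]
    · exact ⟨ha'.2.1.symm, ha'.2.2⟩
    · exact ⟨n1.symm, fun h => e1 h.symm⟩
    · exact ⟨n3, e3⟩
    · exact ⟨n2, e2⟩
    · exact ⟨hb'.2.1, fun h => hb'.2.2 h.symm⟩
    · exact fun _ => ha.2.2
    · exact fun _ => e4
    · exact fun _ => e5
    · exact fun _ => hb.2.2.symm
    · exact fun _ => e6.symm
  rcases key (X := nb G A v false) (Y := nb G A v false) (Z := nb G B v true) (W := nb G B v true)
    true false true false false true (nb_subset _ _ _ _) (nb_subset _ _ _ _)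
      (nb_subset _ _ _ _) (nb_subset _ _ _ _) (by
    intro a ha a' ha' b hb b' hb' e1 e2 n1 n2 e3 e4 e5 e6
    simp only [mem_nb, iff_true, Bool.false_eq_true, iff_false] at *
    exact hfree v b a a' b' hb.2.2 e3.symm e1 e6 hb'.2.2.symm ha.2.2 (fun h => e4 h.symm) e5
      (fun h => ha'.2.2 h.symm) (fun h => e2 h.symm)) with c4 | c4
  · left
    refine (simpleOn_of_few_pairs (G := Gᶜ) hs ?_ ?_).of_compl
    · rw [nb_compl]; exact h1 _
    · rw [nb_compl, nb_compl, pairsOn_compl, pairsOn_compl, card_pairsOn_swap G (nb G A v (!true))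
        (nb G A v (!false))]
      simp only [Bool.not_true, Bool.not_false]
      linarith
  · right
    exact simpleOn_of_few_pairs hs (h2 _) (by linarith)

theorem simpleOn_or {V : Type*} {G : SimpleGraph V} {A B : Finset V} (v : V)
    {g d N s : ℝ} (hfree : C5Free G) (h : PR G A B g d) (hAB : Disjoint A B) (hg : 0 < g)
    (hd : 0 < d) (hd1 : d ≤ 1) (hA : A.card ≤ N) (hB : B.card ≤ N) (hs : 0 < s) (hsN : s ≤ N)
    (hgs : 512 * g * N ^ 3 ≤ d ^ 2 * s ^ 4) :
    SimpleOn G A v s s (s / 2) ∨ SimpleOn G B v s s (s / 2) := by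
  by_cases h1 : ∃ b, ((nb G A v b).card : ℝ) ≤ s
  · exact .inl (.inl h1)
  by_cases h2 : ∃ b, ((nb G B v b).card : ℝ) ≤ s
  · exact .inr (.inl h2)
  push Not at h1 h2
  rcases le_or_gt (s ^ 2 / 4) ((pairsOn G (nb G A v true) (nb G A v false) true).card : ℝ)
    with h3 | h3
  · exact simpleOn_or_of_dense hfree h hAB hg hd hd1 hA hB hs hsN hgs (fun b => (h1 b).le)
      (fun b => (h2 b).le) h3
  · refine (simpleOn_or_of_dense (v := v) hfree.compl (h.compl hAB) hAB hg hd hd1 hA hB hs hsN hgs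
      (fun b => by rw [nb_compl]; exact (h1 _).le) (fun b => by rw [nb_compl]; exact (h2 _).le)
      ?_).imp SimpleOn.of_compl SimpleOn.of_compl
    rw [nb_compl, nb_compl, pairsOn_compl, card_pairsOn_swap]
    simp only [Bool.not_true, Bool.not_false]
    have := card_pairsOn_add G (disjoint_nb G A v)
    have h4 : ((pairsOn G (nb G A v true) (nb G A v false) true).card : ℝ) +
      (pairsOn G (nb G A v true) (nb G A v false) false).card =
        (nb G A v true).card * (nb G A v false).card := by exact_mod_cast this
    have : s * s ≤ (nb G A v true).card * ((nb G A v false).card : ℝ) :=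
      mul_le_mul (h1 _).le (h1 _).le hs.le (Nat.cast_nonneg _)
    nlinarith

theorem PR.card_twins_lt {V : Type*} {G : SimpleGraph V} {P Q D : Finset V} {g d κ : ℝ}
    (h : PR G P Q g d) (hPQ : Disjoint P Q) (hQD : Q ⊆ D) (hg : 0 < g)
    (hκ : 2 * κ < d * (Q.card - 1)) (hgQ : 2 * g ≤ Q.card - 1) (u : V) :
    ((P.filter fun v => u ≠ v ∧ ((disc G D u v).card : ℝ) ≤ κ).card : ℝ) < g := by
  obtain ⟨b, hb⟩ : ∃ b, ((Q.card : ℝ) - 1) / 2 ≤ ((nb G Q u b).card : ℝ) := by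
    by_contra! hcon
    have h1 : Q ⊆ insert u (nb G Q u true ∪ nb G Q u false) := by
      intro w hw
      simp only [Finset.mem_insert, Finset.mem_union, mem_nb, hw, true_and]
      by_cases e1 : w = u <;> by_cases e2 : G.Adj u w <;> simp [e1, e2]
    have h2 := (Finset.card_le_card h1).trans ((Finset.card_insert_le _ _).trans
      (Nat.add_le_add_right (Finset.card_union_le _ _) 1))
    have h3 : (Q.card : ℝ) ≤ (nb G Q u true).card + (nb G Q u false).card + 1 := by exact_mod_cast h2
    linarith [hcon true, hcon false]
  refine lt_of_le_of_lt (Nat.cast_le.2 (Finset.card_le_card fun v hv => ?_))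
    (h.card_bad_lt hPQ hg (nb_subset G Q u b) (by linarith) (!b))
  rw [Finset.mem_filter] at hv ⊢
  refine ⟨hv.1, ?_⟩
  have h1 : ((nb G (nb G Q u b) v (!b)).card : ℝ) ≤ (disc G D u v).card := by
    refine Nat.cast_le.2 (Finset.card_le_card fun w hw => ?_)
    simp only [mem_nb, mem_disc] at hw ⊢
    refine ⟨hQD hw.1.1, hw.1.2.1, hw.2.1, fun he => ?_⟩
    have h2 := hw.1.2.2
    have h3 := hw.2.2
    rw [he] at h2
    cases b <;> simp_all
  nlinarith [hv.2.2]

theorem PR.card_simple_le {V : Type*} {G : SimpleGraph V} {P Q D Z : Finset V} {g d s κ m n : ℝ}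
    (h : PR G P Q g d) (hPQ : Disjoint P Q) (hQD : Q ⊆ D) (hZ : Z ⊆ P)
    (hZs : ∀ v ∈ Z, SimpleOn G D v s κ m) (hg : 0 < g) (hs : s < d * Q.card)
    (hκ : 2 * κ < d * (Q.card - 1)) (hgQ : 2 * g ≤ Q.card - 1)
    (hm : 0 < m) (hn : (D.card : ℝ) ≤ n) : (Z.card : ℝ) ≤ 2 * g + g * n / m := by
  set Y := Z.filter fun v => m ≤ ((D.filter fun u => u ≠ v ∧ ((disc G D u v).card : ℝ) ≤ κ).card : ℝ)
    with hY
  have h1 : (Y.card : ℝ) * m ≤ g * n := by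
    calc (Y.card : ℝ) * m ≤ ∑ v ∈ Y, ((D.filter fun u => u ≠ v ∧
          ((disc G D u v).card : ℝ) ≤ κ).card : ℝ) := by
          rw [← nsmul_eq_mul]
          exact Finset.card_nsmul_le_sum _ _ _ fun v hv => (Finset.mem_filter.1 hv).2
      _ = ∑ u ∈ D, ((Y.filter fun v => u ≠ v ∧ ((disc G D u v).card : ℝ) ≤ κ).card : ℝ) := by
          simp only [Finset.card_filter]
          push_cast
          exact Finset.sum_comm
      _ ≤ ∑ u ∈ D, g := Finset.sum_le_sum fun u _ => (le_trans (Nat.cast_le.2 (Finset.card_le_card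
          (Finset.filter_subset_filter _ ((Finset.filter_subset _ _).trans hZ))))
            (h.card_twins_lt hPQ hQD hg hκ hgQ u).le)
      _ = g * D.card := by rw [Finset.sum_const, nsmul_eq_mul, mul_comm]
      _ ≤ g * n := by gcongr
  have h2 : Z ⊆ Y ∪ (P.filter (fun v => ((nb G Q v true).card : ℝ) < d * Q.card) ∪
      P.filter (fun v => ((nb G Q v false).card : ℝ) < d * Q.card)) := by
    intro v hv
    simp only [Finset.mem_union, hY, Finset.mem_filter, hv, hZ hv, true_and]
    rcases hZs v hv with ⟨b, hb⟩ | h3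
    · right
      have h4 : ((nb G Q v b).card : ℝ) ≤ (nb G D v b).card :=
        Nat.cast_le.2 (Finset.card_le_card (Finset.filter_subset_filter _ hQD))
      cases b
      · right; linarith
      · left; linarith
    · exact .inl h3
  have h3 : (Z.card : ℝ) ≤ Y.card + ((P.filter (fun v => ((nb G Q v true).card : ℝ) < d * Q.card)).card +
      (P.filter (fun v => ((nb G Q v false).card : ℝ) < d * Q.card)).card) := by
    exact_mod_cast (Finset.card_le_card h2).trans ((Finset.card_union_le _ _).trans
      (Nat.add_le_add_left (Finset.card_union_le _ _) _))
  have h4 := h.card_bad_lt hPQ hg (le_refl Q) (by linarith) true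
  have h5 := h.card_bad_lt hPQ hg (le_refl Q) (by linarith) false
  have h6 : (Y.card : ℝ) ≤ g * n / m := by rwa [le_div_iff₀ hm]
  linarith

theorem SimpleOn.mono {V : Type*} {G : SimpleGraph V} {D : Finset V} {v : V} {s κ m s' κ' m' : ℝ}
    (h : SimpleOn G D v s κ m) (hs : s ≤ s') (hκ : κ ≤ κ') (hm : m' ≤ m) :
    SimpleOn G D v s' κ' m' := by
  refine h.imp (fun ⟨b, hb⟩ => ⟨b, hb.trans hs⟩) fun h1 => (hm.trans h1).trans
    (Nat.cast_le.2 (Finset.card_le_card fun u hu => ?_))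
  rw [Finset.mem_filter] at hu ⊢
  exact ⟨hu.1, hu.2.1, hu.2.2.trans hκ⟩

theorem card_le_add_of_forall_mem {V : Type*} {F F' R : Finset V} {t : ℝ}
    (h : ∀ w ∈ F', w ∈ F ∨ w ∈ R) (hR : (R.card : ℝ) ≤ t) : (F'.card : ℝ) ≤ F.card + t := by
  have h1 : F' ⊆ F ∪ R := fun w hw => Finset.mem_union.2 (h w hw)
  have h2 : (F'.card : ℝ) ≤ F.card + R.card := by
    exact_mod_cast (Finset.card_le_card h1).trans (Finset.card_union_le _ _)
  linarith

theorem SimpleOn.transfer {V : Type*} [DecidableEq V] {G : SimpleGraph V} {D D' : Finset V} {v : V}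
    {s κ m t : ℝ} (h : SimpleOn G D v s κ m) (h1 : ((D' \ D).card : ℝ) ≤ t)
    (h2 : ((D \ D').card : ℝ) ≤ t) : SimpleOn G D' v (s + t) (κ + t) (m - t) := by
  rcases h with ⟨b, hb⟩ | h3
  · refine .inl ⟨b, (card_le_add_of_forall_mem (F := nb G D v b) (fun w hw => ?_) h1).trans
      (add_le_add hb le_rfl)⟩
    simp only [mem_nb, Finset.mem_sdiff] at hw ⊢
    tauto
  · right
    rw [sub_le_iff_le_add]
    refine h3.trans (card_le_add_of_forall_mem (fun u hu => ?_) h2)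
    simp only [Finset.mem_filter, Finset.mem_sdiff] at hu ⊢
    by_cases huD : u ∈ D'
    · refine .inl ⟨huD, hu.2.1, (card_le_add_of_forall_mem (F := disc G D u v)
        (fun w hw => ?_) h1).trans (add_le_add hu.2.2 le_rfl)⟩
      simp only [mem_disc, Finset.mem_sdiff] at hw ⊢
      tauto
    · exact .inr ⟨hu.1, huD⟩

theorem PR.transfer {V : Type*} [DecidableEq V] {G : SimpleGraph V} {A B A' B' : Finset V} {g d t g' : ℝ}
    (h : PR G A B g d) (hd : 0 ≤ d) (h1 : ((A' \ A).card : ℝ) ≤ t) (h2 : ((B' \ B).card : ℝ) ≤ t)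
    (ht : 2 * t ≤ g') (hg : 2 * g ≤ g') : PR G A' B' g' (d / 4) := by
  intro X hX Y hY hXg hYg b
  have key : ∀ {C C' Z : Finset V}, ((C' \ C).card : ℝ) ≤ t → Z ⊆ C' → g' ≤ (Z.card : ℝ) →
      (Z.card : ℝ) / 2 ≤ (Z ∩ C).card := by
    intro C C' Z hC hZ hZg
    have e1 := Finset.card_sdiff_add_card_inter Z C
    have e2 : ((Z \ C).card : ℝ) + (Z ∩ C).card = Z.card := by exact_mod_cast e1
    have e3 : ((Z \ C).card : ℝ) ≤ (C' \ C).card :=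
      Nat.cast_le.2 (Finset.card_le_card (Finset.sdiff_subset_sdiff hZ le_rfl))
    linarith
  have kX := key h1 hX hXg
  have kY := key h2 hY hYg
  have h3 := h (X ∩ A) Finset.inter_subset_right (Y ∩ B) Finset.inter_subset_right
    (by linarith) (by linarith) b
  refine le_trans ?_ (h3.trans (Nat.cast_le.2 (Finset.card_le_card (Finset.filter_subset_filter _
    (Finset.product_subset_product Finset.inter_subset_left Finset.inter_subset_left)))))
  calc d / 4 * X.card * Y.card = d * (X.card / 2) * (Y.card / 2) := by ring
    _ ≤ d * (X ∩ A).card * (Y ∩ B).card := by gcongr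

/-- `A` and its complement are almost balanced, the pair is generic, and every vertex is simple on
its own side. -/
structure Near {V : Type*} [Fintype V] [DecidableEq V] (G : SimpleGraph V) (A : Finset V) (ζ d σ μ : ℝ) :
    Prop where
  card_le : (A.card : ℝ) ≤ (1 / 2 + ζ) * Fintype.card V
  card_compl_le : ((Aᶜ).card : ℝ) ≤ (1 / 2 + ζ) * Fintype.card V
  pr : PR G A Aᶜ (ζ * Fintype.card V) d
  simple : ∀ v ∈ A, SimpleOn G A v (σ * Fintype.card V) (σ * Fintype.card V) (μ * Fintype.card V)
  simple_compl : ∀ v ∈ Aᶜ,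
    SimpleOn G Aᶜ v (σ * Fintype.card V) (σ * Fintype.card V) (μ * Fintype.card V)

theorem Near.symm {V : Type*} [Fintype V] [DecidableEq V] {G : SimpleGraph V} {A : Finset V} {ζ d σ μ : ℝ}
    (h : Near G A ζ d σ μ) : Near G Aᶜ ζ d σ μ :=
  ⟨h.card_compl_le, by rw [compl_compl]; exact h.card_le, by rw [compl_compl]; exact h.pr.symm,
    h.simple_compl, by rw [compl_compl]; exact h.simple⟩

theorem Near.compl {V : Type*} [Fintype V] [DecidableEq V] {G : SimpleGraph V} {A : Finset V} {ζ d σ μ : ℝ}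
    (h : Near G A ζ d σ μ) : Near Gᶜ A ζ d σ μ :=
  ⟨h.card_le, h.card_compl_le, h.pr.compl disjoint_compl_right,
    fun v hv => (h.simple v hv).compl, fun v hv => (h.simple_compl v hv).compl⟩

theorem card_not_simple_le {V : Type*} {G : SimpleGraph V} {A B : Finset V} {n γ d η : ℝ}
    (hfree : C5Free G) (h : PR G A B (γ * n) d) (hAB : Disjoint A B) (hd : 0 < d) (hd1 : d ≤ 1)
    (hγ : 0 < γ) (hη : 0 < η) (hη1 : 32 * η ≤ d) (hγη : 512 * γ ≤ d ^ 2 * η ^ 4)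
    (hA : A.card ≤ n) (hB : B.card ≤ n) (hBn : n / 4 ≤ B.card) (hn : 8 ≤ n) :
    ((A.filter fun v => ¬SimpleOn G A v (η * n) (η * n) (η * n / 2)).card : ℝ) ≤ 4 * γ / η * n := by
  have hγ1 : 512 * γ ≤ η := by
    refine hγη.trans ?_
    have : d ^ 2 * η ^ 3 ≤ 1 * 1 := by
      gcongr
      · exact pow_le_one₀ hd.le hd1
      · exact pow_le_one₀ hη.le (by linarith)
    calc d ^ 2 * η ^ 4 = (d ^ 2 * η ^ 3) * η := by ring
      _ ≤ 1 * 1 * η := by gcongr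
      _ = η := by ring
  have hn0 : 0 < n := by linarith
  have e1 : η * n ≤ d / 32 * n := by gcongr; linarith
  have e2 : d * (n / 4) ≤ d * B.card := by gcongr
  have e3 : γ * n ≤ 1 / 64 * n := by gcongr; linarith
  have e4 : d * 8 ≤ d * n := by gcongr
  have := h.card_simple_le (D := B) (s := η * n) (κ := η * n) (m := η * n / 2) (n := n) hAB le_rfl
    (Finset.filter_subset (fun v => ¬SimpleOn G A v (η * n) (η * n) (η * n / 2)) A)
    (fun v hv => (simpleOn_or v hfree h hAB (by positivity) hd hd1 hA hB (s := η * n)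
      (by positivity) (by nlinarith) (by
        calc 512 * (γ * n) * n ^ 3 = 512 * γ * n ^ 4 := by ring
          _ ≤ d ^ 2 * η ^ 4 * n ^ 4 := by gcongr
          _ = d ^ 2 * (η * n) ^ 4 := by ring)).resolve_left (Finset.mem_filter.1 hv).2)
    (by positivity) (by linarith) (by linarith) (by linarith) (by positivity) hB
  refine this.trans ?_
  have e5 : γ * n * n / (η * n / 2) = 2 * γ / η * n := by field_simp
  have e6 : 2 * (γ * n) ≤ 2 * γ / η * n := by
    rw [div_mul_eq_mul_div, le_div_iff₀ hη]
    nlinarith [mul_pos hγ hn0]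
  rw [e5]
  calc _ ≤ 2 * γ / η * n + 2 * γ / η * n := by gcongr
    _ = _ := by ring

theorem exists_near {V : Type*} [Fintype V] [DecidableEq V] {G : SimpleGraph V} {A : Finset V} {γ d η ζ : ℝ}
    (hfree : C5Free G) (h : PR G A Aᶜ (γ * Fintype.card V) d) (hd : 0 < d) (hd1 : d ≤ 1)
    (hγ : 0 < γ) (hη : 0 < η) (hη1 : 32 * η ≤ d) (hγη : 512 * γ ≤ d ^ 2 * η ^ 4)
    (hA : |(A.card : ℝ) - Fintype.card V / 2| ≤ γ * Fintype.card V) (hn : 8 ≤ Fintype.card V)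
    (hζ : 16 * γ / η ≤ ζ) (hγη' : 16 * γ ≤ η ^ 2) :
    ∃ A', Near G A' ζ (d / 4) (2 * η) (η / 4) := by
  set n : ℝ := (Fintype.card V : ℝ) with hn'
  have hn8 : (8 : ℝ) ≤ n := by rw [hn']; exact_mod_cast hn
  have hc : (A.card : ℝ) + (Aᶜ).card = n := by
    rw [hn']; exact_mod_cast Finset.card_add_card_compl A
  have hη2 : η ≤ 1 / 32 := by linarith
  have hγ1 : γ ≤ η / 16 := by nlinarith
  obtain ⟨hA1, hA2⟩ := abs_le.1 hA
  have e3 : γ * n ≤ 1 / 64 * n := by gcongr; linarith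
  have ht0 : 0 < γ / η := by positivity
  have ht : 4 * γ / η ≤ η / 4 := by
    rw [div_le_iff₀ hη]; nlinarith
  have ht2 : 4 * γ ≤ 4 * γ / η := by
    rw [le_div_iff₀ hη]; nlinarith
  have ht3 : 16 * γ / η = 4 * (4 * γ / η) := by ring
  set t := 4 * γ / η with ht'
  have hAd : Disjoint A Aᶜ := disjoint_compl_right
  set ZA := A.filter fun v => ¬SimpleOn G A v (η * n) (η * n) (η * n / 2) with hZA
  set ZB := (Aᶜ).filter fun v => ¬SimpleOn G Aᶜ v (η * n) (η * n) (η * n / 2) with hZB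
  have cA : (ZA.card : ℝ) ≤ t * n := card_not_simple_le hfree h hAd hd hd1 hγ hη hη1 hγη
    (by linarith) (by linarith) (by linarith) hn8
  have cB : (ZB.card : ℝ) ≤ t * n := card_not_simple_le hfree h.symm hAd.symm hd hd1 hγ hη hη1 hγη
    (by linarith) (by linarith) (by linarith) hn8
  have hor : ∀ v, SimpleOn G A v (η * n) (η * n) (η * n / 2) ∨
      SimpleOn G Aᶜ v (η * n) (η * n) (η * n / 2) := fun v =>
    simpleOn_or v hfree h hAd (N := n) (by positivity) hd hd1 (by linarith) (by linarith)
      (s := η * n) (by positivity) (by nlinarith) (by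
        calc 512 * (γ * n) * n ^ 3 = 512 * γ * n ^ 4 := by ring
          _ ≤ d ^ 2 * η ^ 4 * n ^ 4 := by gcongr
          _ = d ^ 2 * (η * n) ^ 4 := by ring)
  set A' := (A \ ZA) ∪ ZB with hA'
  have s1 : A' \ A ⊆ ZB := by
    intro v; simp only [hA', Finset.mem_sdiff, Finset.mem_union]; tauto
  have s2 : A \ A' ⊆ ZA := by
    intro v; simp only [hA', Finset.mem_sdiff, Finset.mem_union]; tauto
  have s3 : A'ᶜ \ Aᶜ ⊆ ZA := by
    intro v; simp only [hA', Finset.mem_sdiff, Finset.mem_union, Finset.mem_compl]; tauto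
  have s4 : Aᶜ \ A'ᶜ ⊆ ZB := by
    intro v; simp only [hA', Finset.mem_sdiff, Finset.mem_union, Finset.mem_compl]; tauto
  have c1 := (Nat.cast_le (α := ℝ).2 (Finset.card_le_card s1)).trans cB
  have c2 := (Nat.cast_le (α := ℝ).2 (Finset.card_le_card s2)).trans cA
  have c3 := (Nat.cast_le (α := ℝ).2 (Finset.card_le_card s3)).trans cA
  have c4 := (Nat.cast_le (α := ℝ).2 (Finset.card_le_card s4)).trans cB
  have hle : ∀ {X Y : Finset V}, ((X \ Y).card : ℝ) ≤ t * n → (X.card : ℝ) ≤ Y.card + t * n := by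
    intro X Y hXY
    refine card_le_add_of_forall_mem (fun w hw => ?_) hXY
    rw [Finset.mem_sdiff]
    tauto
  have hsz : ∀ {x : ℝ}, x ≤ n / 2 + γ * n → x + t * n ≤ (1 / 2 + ζ) * n := by
    intro x hx
    have : (γ + t) * n ≤ ζ * n := by gcongr; linarith
    linarith
  have htn : t * n ≤ η / 4 * n := by gcongr
  have hηn : 0 < η * n := by positivity
  refine ⟨A', (hle c1).trans (hsz (by linarith)), (hle c3).trans (hsz (by linarith)),
    h.transfer hd.le c1 c3 ?_ ?_, fun v hv => ?_, fun v hv => ?_⟩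
  · calc 2 * (t * n) = 2 * t * n := by ring
      _ ≤ ζ * n := by gcongr; linarith
  · calc 2 * (γ * n) = 2 * γ * n := by ring
      _ ≤ ζ * n := by gcongr; linarith
  · refine (SimpleOn.transfer (D := A) (s := η * n) (κ := η * n) (m := η * n / 2) (t := t * n) ?_ c1 c2).mono (by linarith) (by linarith)
      (by linarith)
    simp only [hA', Finset.mem_union, Finset.mem_sdiff] at hv
    rcases hv with hv | hv
    · by_contra hcon
      exact hv.2 (Finset.mem_filter.2 ⟨hv.1, hcon⟩)
    · exact (hor v).resolve_right (Finset.mem_filter.1 hv).2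
  · refine (SimpleOn.transfer (D := Aᶜ) (s := η * n) (κ := η * n) (m := η * n / 2) (t := t * n) ?_ c3 c4).mono (by linarith) (by linarith)
      (by linarith)
    simp only [hA', Finset.mem_union, Finset.mem_sdiff, Finset.mem_compl, not_or] at hv
    by_cases hvA : v ∈ A
    · have : v ∈ ZA := by tauto
      exact (hor v).resolve_left (Finset.mem_filter.1 this).2
    · by_contra hcon
      exact hv.2 (Finset.mem_filter.2 ⟨Finset.mem_compl.2 hvA, hcon⟩)

theorem exists_few_not_near : ∃ d : ℝ, 0 < d ∧ d < 1 ∧ ∀ σ : ℝ, 0 < σ → ∃ μ : ℝ, 0 < μ ∧ μ ≤ σ ∧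
    ∀ ζ : ℝ, 0 < ζ → ∃ c : ℝ, 0 < c ∧ ∃ n₀ : ℕ, ∀ {V : Type} [Fintype V] [DecidableEq V],
      n₀ ≤ Fintype.card V →
      ({G : SimpleGraph V | C5Free G ∧ ¬∃ A, Near G A ζ d σ μ}.ncard : ℝ) ≤
        2 ^ ((1 / 4 - c) * (Fintype.card V : ℝ) ^ 2) := by
  obtain ⟨d, hd, hd1, H⟩ := exists_few_unbalanced
  refine ⟨d / 4, by linarith, by linarith, fun σ hσ => ?_⟩
  set η := min (σ / 2) (d / 32) with hη'
  have hη : 0 < η := by positivity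
  have hη1 : η ≤ σ / 2 := min_le_left _ _
  have hη2 : η ≤ d / 32 := min_le_right _ _
  refine ⟨η / 4, by positivity, by linarith, fun ζ hζ => ?_⟩
  set γ := min (d ^ 2 * η ^ 4 / 512) (min (η * ζ / 16) (η ^ 2 / 16)) with hγ'
  have hγ : 0 < γ := by positivity
  have hγ1 : γ ≤ d ^ 2 * η ^ 4 / 512 := min_le_left _ _
  have hγ2 : γ ≤ η * ζ / 16 := (min_le_right _ _).trans (min_le_left _ _)
  have hγ3 : γ ≤ η ^ 2 / 16 := (min_le_right _ _).trans (min_le_right _ _)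
  obtain ⟨c, hc, n₀, Hc⟩ := H γ hγ
  refine ⟨c, hc, max n₀ 8, fun {V} _ _ hn => ?_⟩
  refine le_trans (Nat.cast_le.2 (Set.ncard_le_ncard ?_ (Set.toFinite _))) (Hc (V := V)
    ((le_max_left _ _).trans hn))
  rintro G ⟨h1, h2⟩
  refine ⟨h1, fun ⟨A, hA, hA2⟩ => h2 ?_⟩
  obtain ⟨A', hA'⟩ := exists_near h1 hA hd hd1.le hγ hη (by linarith) (by linarith) hA2
    ((le_max_right _ _).trans hn) (ζ := ζ) (by rw [div_le_iff₀ hη]; linarith) (by linarith)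
  exact ⟨A', hA'.card_le, hA'.card_compl_le, hA'.pr,
    fun v hv => (hA'.simple v hv).mono (by gcongr; linarith) (by gcongr; linarith) le_rfl,
    fun v hv => (hA'.simple_compl v hv).mono (by gcongr; linarith) (by gcongr; linarith) le_rfl⟩

theorem PR.congr {V : Type*} {G G' : SimpleGraph V} {A B : Finset V} {g d : ℝ}
    (h : PR G A B g d) (hG : ∀ x ∈ A, ∀ y ∈ B, (G.Adj x y ↔ G'.Adj x y)) : PR G' A B g d := by
  intro X hX Y hY h1 h2 b
  refine (h X hX Y hY h1 h2 b).trans (Nat.cast_le.2 (Finset.card_le_card fun e he => ?_))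
  rw [Finset.mem_filter, Finset.mem_product] at he ⊢
  rw [← hG _ (hX he.1.1) _ (hY he.1.2)]
  exact he

theorem Near.inter_small {V : Type*} [Fintype V] [DecidableEq V] {G G' : SimpleGraph V}
    {A A' K : Finset V} {ζ d σ μ ρ : ℝ} (h : Near G A ζ d σ μ) (h' : Near G' A' ζ d σ μ)
    (hGG : ∀ x ∉ K, ∀ y ∉ K, (G.Adj x y ↔ G'.Adj x y)) (hK : K.card ≤ 3) (hd : 0 < d)
    (hζ : 0 < ζ) (hμ : 0 < μ) (hσ : 8 * σ ≤ d * ρ) (hζρ : 2 * ζ + ζ / μ ≤ ρ / 2)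
    (hn : 16 ≤ ρ * Fintype.card V) :
    ((A ∩ A').card : ℝ) ≤ ρ * Fintype.card V ∨ ((A ∩ A'ᶜ).card : ℝ) ≤ ρ * Fintype.card V := by
  by_contra! hcon
  set n : ℝ := (Fintype.card V : ℝ) with hn'
  have hn0 : 0 < n := by
    rw [hn'] ; rw [hn'] at hn
    rcases Nat.eq_zero_or_pos (Fintype.card V) with h0 | h0
    · rw [h0] at hn; norm_num at hn
    · exact_mod_cast h0
  have hK' : ∀ X : Finset V, (X.card : ℝ) ≤ (X \ K).card + 3 := fun X =>
    card_le_add_of_forall_mem (R := K) (fun w hw => by rw [Finset.mem_sdiff]; tauto)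
      (by exact_mod_cast hK)
  have h1 := hK' (A ∩ A')
  have h2 := hK' (A ∩ A'ᶜ)
  have hζμ : 0 < ζ / μ := by positivity
  have e1 : 2 * ζ * n ≤ ρ / 2 * n := by gcongr; linarith
  have e2 : 8 * σ * n ≤ d * ρ * n := by gcongr
  have e3 : d * (ρ * n / 2) < d * (((A ∩ A'ᶜ) \ K).card - 1) := by gcongr; linarith
  have hpr : PR G ((A ∩ A') \ K) ((A ∩ A'ᶜ) \ K) (ζ * n) d :=
    (h'.pr.mono (Finset.sdiff_subset.trans Finset.inter_subset_right)
      (Finset.sdiff_subset.trans Finset.inter_subset_right) le_rfl le_rfl).congr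
      fun x hx y hy => (hGG x (Finset.mem_sdiff.1 hx).2 y (Finset.mem_sdiff.1 hy).2).symm
  have h3 := hpr.card_simple_le (D := A) (s := σ * n) (κ := σ * n) (m := μ * n) (n := n)
    (Finset.disjoint_of_subset_left (Finset.sdiff_subset.trans Finset.inter_subset_right)
      (Finset.disjoint_of_subset_right (Finset.sdiff_subset.trans Finset.inter_subset_right)
        disjoint_compl_right)) (Finset.sdiff_subset.trans Finset.inter_subset_left) le_rfl
    (fun v hv => h.simple v (Finset.mem_inter.1 (Finset.mem_sdiff.1 hv).1).1) (by positivity)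
    (by nlinarith) (by nlinarith) (by nlinarith) (by positivity)
    (by rw [hn']; exact_mod_cast Finset.card_le_univ _)
  have e4 : ζ * n * n / (μ * n) = ζ / μ * n := by field_simp
  have e5 : (2 * ζ + ζ / μ) * n ≤ ρ / 2 * n := by gcongr
  rw [e4] at h3
  linarith

theorem Near.symmDiff_small {V : Type*} [Fintype V] [DecidableEq V] {G G' : SimpleGraph V}
    {A A' K : Finset V} {ζ d σ μ ρ : ℝ} (h : Near G A ζ d σ μ) (h' : Near G' A' ζ d σ μ)
    (hGG : ∀ x ∉ K, ∀ y ∉ K, (G.Adj x y ↔ G'.Adj x y)) (hK : K.card ≤ 3) (hd : 0 < d)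
    (hζ : 0 < ζ) (hμ : 0 < μ) (hσ : 8 * σ ≤ d * ρ) (hζρ : 2 * ζ + ζ / μ ≤ ρ / 2) (hρ : ρ < 1 / 8)
    (hn : 16 ≤ ρ * Fintype.card V) :
    ((symmDiff A A').card : ℝ) ≤ 2 * ρ * Fintype.card V ∨
      ((symmDiff Aᶜ A').card : ℝ) ≤ 2 * ρ * Fintype.card V := by
  have h1 := h.inter_small h' hGG hK hd hζ hμ hσ hζρ hn
  have h2 := h.symm.inter_small h' hGG hK hd hζ hμ hσ hζρ hn
  have hζμ : 0 < ζ / μ := by positivity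
  have hn1 : (0 : ℝ) < Fintype.card V := by
    rcases Nat.eq_zero_or_pos (Fintype.card V) with h0 | h0
    · rw [h0] at hn; norm_num at hn
    · exact_mod_cast h0
  have hle : ∀ X Y Z : Finset V, (∀ w ∈ X, w ∈ Y ∨ w ∈ Z) → (X.card : ℝ) ≤ Y.card + Z.card :=
    fun X Y Z hX => card_le_add_of_forall_mem hX le_rfl
  have hcc : ∀ X : Finset V, (X.card : ℝ) + (Xᶜ).card = Fintype.card V := fun X => by
    exact_mod_cast Finset.card_add_card_compl X
  have e1 : (ζ + 2 * ρ) * Fintype.card V < (1 / 2) * (Fintype.card V : ℝ) := by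
    gcongr; linarith
  have c1 := hcc A'
  have c2 := h'.card_le
  have c3 := h'.card_compl_le
  have k1 := hle A' (A ∩ A') (Aᶜ ∩ A') (fun w hw => by simp only [Finset.mem_inter, Finset.mem_compl]; tauto)
  have k2 := hle A'ᶜ (A ∩ A'ᶜ) (Aᶜ ∩ A'ᶜ) (fun w hw => by
    simp only [Finset.mem_inter, Finset.mem_compl] at *; tauto)
  have k3 := hle (symmDiff A A') (A ∩ A'ᶜ) (Aᶜ ∩ A') (fun w hw => by
    simp only [Finset.mem_symmDiff, Finset.mem_inter, Finset.mem_compl] at *; tauto)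
  have k4 := hle (symmDiff Aᶜ A') (A ∩ A') (Aᶜ ∩ A'ᶜ) (fun w hw => by
    simp only [Finset.mem_symmDiff, Finset.mem_inter, Finset.mem_compl] at *; tauto)
  rcases h1 with h1 | h1 <;> rcases h2 with h2 | h2
  · exfalso; linarith
  · right; linarith
  · left; linarith
  · exfalso; linarith

theorem ncard_symmDiff_le {β ι : Type*} [Fintype β] [DecidableEq β] [Fintype ι] {η ε x : ℝ}
    (H : ∀ R : Finset β, ((R.powerset.filter fun Y => (Y.card : ℝ) ≤ η * R.card).card : ℝ) ≤
      2 ^ (ε * R.card)) (S : ι → Finset β) (hx : x ≤ η * Fintype.card β) :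
    ({A : Finset β | ∃ i, ((symmDiff (S i) A).card : ℝ) ≤ x}.ncard : ℝ) ≤
      Fintype.card ι * 2 ^ (ε * Fintype.card β) := by
  refine ncard_exists_le _ _ fun i => ?_
  refine le_trans ?_ (H Finset.univ)
  rw [← Set.ncard_coe_finset]
  refine Nat.cast_le.2 (Set.ncard_le_ncard_of_injOn (fun A => symmDiff (S i) A) ?_ ?_
    (Set.toFinite _))
  · intro A hA
    simp only [Finset.coe_filter, Finset.powerset_univ, Finset.mem_univ, true_and,
      Finset.card_univ, Set.mem_ofPred_eq] at hA ⊢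
    exact hA.trans hx
  · intro A _ B _ hAB
    exact symmDiff_right_injective (S i) hAB

theorem ncard_le_mul_of_exists {α β : Type*} [Finite α] [Finite β] (S : Set α) (T : Set β)
    (P : α → β → Prop) (hP : ∀ x ∈ S, ∃ y ∈ T, P x y) (m : ℝ)
    (h : ∀ y ∈ T, ({x | x ∈ S ∧ P x y}.ncard : ℝ) ≤ m) : (S.ncard : ℝ) ≤ T.ncard * m := by
  rcases S.eq_empty_or_nonempty with rfl | ⟨x0, hx0⟩
  · rcases T.eq_empty_or_nonempty with rfl | ⟨y, hy⟩
    · simp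
    · have := (Nat.cast_nonneg _).trans (h y hy)
      simp only [Set.ncard_empty, Nat.cast_zero]
      positivity
  · obtain ⟨y0, -, -⟩ := hP x0 hx0
    refine ncard_le_mul_of_fiber S T (fun x => if hx : x ∈ S then (hP x hx).choose else y0)
      (fun x hx => ?_) m fun y hy => ?_
    · simp only [hx, dif_pos]
      exact (hP x hx).choose_spec.1
    · refine le_trans (Nat.cast_le.2 (Set.ncard_le_ncard ?_ (Set.toFinite _))) (h y hy)
      rintro x ⟨hx, hxy⟩
      simp only [hx, dif_pos] at hxy
      exact ⟨hx, hxy ▸ (hP x hx).choose_spec.2⟩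

theorem ncard_avoid_le {α κ : Type*} [Fintype α] [Fintype κ] {t : ℕ} (m : Fin t × Bool → α)
    (hm : Function.Injective m) (k₁ k₂ : κ) :
    {g : α → κ | ∀ i, ¬(g (m (i, true)) = k₁ ∧ g (m (i, false)) = k₂)}.ncard *
      (Fintype.card κ ^ 2) ^ t ≤ (Fintype.card κ ^ 2 - 1) ^ t * Fintype.card κ ^ Fintype.card α := by
  have h1 : {g : α → κ | ∀ i, ¬(g (m (i, true)) = k₁ ∧ g (m (i, false)) = k₂)}.ncard ≤
      Nat.card ((Fin t → {p : κ × κ // p ≠ (k₁, k₂)}) × ({x // x ∉ Set.range m} → κ)) := by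
    rw [← Nat.card_coe_set_eq]
    refine Nat.card_le_card_of_injective (fun g => (fun i => ⟨(g.1 (m (i, true)), g.1 (m (i, false))),
      fun h => g.2 i (Prod.mk_inj.1 h)⟩, fun x => g.1 x.1)) ?_
    rintro ⟨g, hg⟩ ⟨g', hg'⟩ h
    simp only [Prod.mk.injEq] at h
    ext x
    by_cases hx : x ∈ Set.range m
    · obtain ⟨⟨i, b⟩, rfl⟩ := hx
      have := congrArg Subtype.val (congrFun h.1 i)
      simp only [Prod.mk.injEq] at this
      cases b
      · exact this.2
      · exact this.1
    · exact congrFun h.2 ⟨x, hx⟩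
  have h2 : Fintype.card {x // x ∈ Set.range m} = 2 * t := by
    rw [← Nat.card_eq_fintype_card, Nat.card_range_of_injective hm]
    simp [mul_comm]
  have h3 := Fintype.card_subtype_compl (fun x => x ∈ Set.range m)
  have h4 : Fintype.card {x // x ∈ Set.range m} ≤ Fintype.card α := Fintype.card_subtype_le _
  have h5 : Fintype.card {p : κ × κ // p ≠ (k₁, k₂)} = Fintype.card κ ^ 2 - 1 := by
    rw [Fintype.card_subtype_compl, Fintype.card_subtype_eq, Fintype.card_prod, sq]
  rw [Nat.card_eq_fintype_card, Fintype.card_prod, Fintype.card_fun, Fintype.card_fun, h5, h3, h2,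
    Fintype.card_fin] at h1
  rw [h2] at h4
  calc _ ≤ _ * (Fintype.card κ ^ 2) ^ t := Nat.mul_le_mul_right _ h1
    _ = (Fintype.card κ ^ 2 - 1) ^ t *
        Fintype.card κ ^ (Fintype.card α - 2 * t + 2 * t) := by rw [pow_add, pow_mul]; ring
    _ = _ := by rw [Nat.sub_add_cancel h4]

/-- the number of graphs on `m` vertices without induced five-cycle -/
def c5count (m : ℕ) : ℕ := {G : SimpleGraph (Fin m) | C5Free G}.ncard

theorem C5Free.comap {V W : Type*} {G : SimpleGraph V} (h : C5Free G) (f : W → V) :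
    C5Free (G.comap f) := fun a b c d e => h (f a) (f b) (f c) (f d) (f e)

theorem ncard_c5Free (V : Type*) [Fintype V] :
    {G : SimpleGraph V | C5Free G}.ncard = c5count (Fintype.card V) := by
  have e := Fintype.equivFin V
  refine Set.ncard_congr (fun G _ => G.comap e.symm) (fun G hG => C5Free.comap hG _) ?_ ?_
  · intro G G' _ _ h
    have := congrArg (SimpleGraph.comap e) h
    simpa [SimpleGraph.comap_comap] using this
  · intro G hG
    exact ⟨G.comap e, C5Free.comap hG _, by simp [SimpleGraph.comap_comap]⟩

/-- a matching in `A` indexed by `Fin t` -/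
def IsMatchingIn {V : Type*} (G : SimpleGraph V) (A : Finset V) {t : ℕ} (m : Fin t × Bool → V) :
    Prop :=
  Function.Injective m ∧ (∀ e, m e ∈ A) ∧ ∀ i, G.Adj (m (i, true)) (m (i, false))

def IsPathOutside {V : Type*} (G : SimpleGraph V) (A : Finset V) (b : Fin 3 → V) : Prop :=
  (∀ i, b i ∉ A) ∧ G.Adj (b 0) (b 1) ∧ G.Adj (b 1) (b 2) ∧ ¬G.Adj (b 0) (b 2) ∧ b 0 ≠ b 2

theorem Near.neighbors_mem {V : Type*} [Fintype V] [DecidableEq V] {G G₁ : SimpleGraph V}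
    {A K : Finset V} {ζ d σ μ x : ℝ} (h : Near G A ζ d σ μ)
    (hGG : ∀ x ∉ K, ∀ y ∉ K, (G.Adj x y ↔ G₁.Adj x y)) (hK : K.card ≤ 3)
    (hμ : 3 < μ * Fintype.card V) (hx : σ * Fintype.card V + 5 ≤ x) {v : V} (hv : v ∉ A) :
    ∃ j : V ⊕ Bool, ((symmDiff ((Sum.elim (fun u => nb G₁ Aᶜ u true)
      (fun b => if b = true then Aᶜ else ∅) : V ⊕ Bool → Finset V) j)
        (nb G Aᶜ v true)).card : ℝ) ≤ x := by
  rcases h.simple_compl v (Finset.mem_compl.2 hv) with ⟨b, hb⟩ | h1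
  · cases b
    · refine ⟨.inr true, ?_⟩
      simp only [Sum.elim_inr, if_true]
      refine (card_le_add_of_forall_mem (F := nb G Aᶜ v false) (R := {v}) (t := 1) (fun w hw => ?_)
        (by simp)).trans (by linarith)
      simp only [Finset.mem_symmDiff, mem_nb, Finset.mem_singleton, Finset.mem_compl] at hw ⊢
      simp only [iff_true, Bool.false_eq_true, iff_false] at hw ⊢
      tauto
    · refine ⟨.inr false, ?_⟩
      simp only [Sum.elim_inr, Bool.false_eq_true, if_false]
      rw [← Finset.bot_eq_empty, bot_symmDiff]
      linarith
  · have : (K.card : ℝ) ≤ 3 := by exact_mod_cast hK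
    obtain ⟨u, hu, huK⟩ := Finset.exists_mem_notMem_of_card_lt_card
      ((Nat.cast_lt (α := ℝ)).1 ((this.trans_lt hμ).trans_le h1))
    simp only [Finset.mem_filter] at hu
    refine ⟨.inl u, ?_⟩
    simp only [Sum.elim_inl]
    refine (card_le_add_of_forall_mem (F := disc G Aᶜ u v) (R := insert u (insert v K)) (t := 5)
      (fun w hw => ?_) ?_).trans ?_
    · simp only [Finset.mem_symmDiff, mem_nb, Finset.mem_insert, Finset.mem_compl, mem_disc] at hw ⊢
      simp only [iff_true] at hw
      by_cases hwK : w ∈ K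
      · tauto
      · have := hGG u huK w hwK
        by_cases e1 : w = u
        · tauto
        · by_cases e2 : w = v
          · tauto
          · left; tauto
    · have := (Finset.card_insert_le u (insert v K)).trans
        (Nat.add_le_add_right (Finset.card_insert_le v K) 1)
      have h5 : (insert u (insert v K)).card ≤ 5 := by omega
      exact_mod_cast h5
    · linarith [hu.2.2]

theorem card_fixed_side_le {V : Type} [Fintype V] [DecidableEq V] {G₁ : SimpleGraph V}
    {A K : Finset V} {ζ d σ μ ε η : ℝ} {t : ℕ} {m : Fin t × Bool → V}
    (H : ∀ R : Finset V, ((R.powerset.filter fun Y => (Y.card : ℝ) ≤ η * R.card).card : ℝ) ≤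
      2 ^ (ε * R.card)) {b : Fin 3 → V} (hKb : K = Finset.univ.image b)
    (hm : IsMatchingIn G₁ A m)
    (hμ : 3 < μ * Fintype.card V) (hση : σ * Fintype.card V + 5 ≤ η * Fintype.card V) :
    ({G : SimpleGraph V | C5Free G ∧ (∀ x ∉ K, ∀ y ∉ K, (G.Adj x y ↔ G₁.Adj x y)) ∧
      Near G A ζ d σ μ ∧ IsPathOutside G A b}.ncard : ℝ) ≤
      (((Fintype.card V + 2 : ℕ) : ℝ) * 2 ^ (ε * Fintype.card V)) ^ 3 *
        (8 ^ A.card * (63 / 64) ^ t) := by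
  have hK3 : K.card ≤ 3 := by
    rw [hKb]; exact Finset.card_image_le.trans (by simp)
  set S : V ⊕ Bool → Finset V := Sum.elim (fun u => nb G₁ Aᶜ u true)
      (fun b => if b = true then Aᶜ else ∅) with hS
  set 𝒯 : Finset (Finset V) := Finset.univ.filter fun X =>
    ∃ j, ((symmDiff (S j) X).card : ℝ) ≤ η * Fintype.card V with h𝒯
  have h𝒯c : (𝒯.card : ℝ) ≤ ((Fintype.card V + 2 : ℕ) : ℝ) * 2 ^ (ε * Fintype.card V) := by
    have := ncard_symmDiff_le H S le_rfl
    rw [Fintype.card_sum, Fintype.card_bool] at this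
    refine le_trans (le_of_eq ?_) this
    rw [← Set.ncard_coe_finset]
    congr 2
    ext X; simp [h𝒯]
  set m' : Fin t × Bool → {x // x ∈ A} := fun e => ⟨m e, hm.2.1 e⟩ with hm'
  have hm'i : Function.Injective m' := fun e f h => hm.1 (congrArg Subtype.val h)
  set 𝒢 : Set ({x // x ∈ A} → Fin 3 → Bool) := {g | ∀ i, ¬(g (m' (i, true)) = ![true, false, false] ∧
    g (m' (i, false)) = ![false, false, true])} with h𝒢
  have h𝒢c : (𝒢.ncard : ℝ) ≤ 8 ^ A.card * (63 / 64) ^ t := by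
    have := ncard_avoid_le m' hm'i (![true, false, false] : Fin 3 → Bool) ![false, false, true]
    simp only [Fintype.card_fun, Fintype.card_bool, Fintype.card_fin, Fintype.card_coe] at this
    rw [show ((2 ^ 3) ^ 2 - 1 : ℕ) = 63 by norm_num, show (2 ^ 3) ^ 2 = 64 by norm_num,
      show 2 ^ 3 = 8 by norm_num] at this
    rw [div_pow, mul_div_assoc', le_div_iff₀ (by positivity), mul_comm ((8 : ℝ) ^ A.card)]
    exact_mod_cast this
  have hcode : {G : SimpleGraph V | C5Free G ∧ (∀ x ∉ K, ∀ y ∉ K, (G.Adj x y ↔ G₁.Adj x y)) ∧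
      Near G A ζ d σ μ ∧ IsPathOutside G A b}.ncard ≤
      (((Fintype.piFinset fun _ : Fin 3 => 𝒯 : Finset _) : Set (Fin 3 → Finset V)) ×ˢ 𝒢).ncard := by
    refine Set.ncard_le_ncard_of_injOn (fun G => (fun i => nb G Aᶜ (b i) true,
      fun a i => decide (G.Adj a.1 (b i)))) ?_ ?_ (Set.toFinite _)
    · rintro G ⟨hfree, hGG, hnear, hb, h01, h12, h02, hne⟩
      refine Set.mem_prod.2 ⟨?_, ?_⟩
      · rw [Finset.mem_coe, Fintype.mem_piFinset]
        intro i
        rw [h𝒯, Finset.mem_filter]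
        exact ⟨Finset.mem_univ _, hnear.neighbors_mem hGG hK3 hμ hση (hb i)⟩
      · rintro i ⟨e1, e2⟩
        have hnot : ∀ e, m e ∉ K := by
          intro e he
          rw [hKb, Finset.mem_image] at he
          obtain ⟨j, -, hj⟩ := he
          exact hb j (hj ▸ hm.2.1 e)
        have hadj := (hGG _ (hnot _) _ (hnot _)).2 (hm.2.2 i)
        have f1 := fun j => congrFun e1 j
        have f2 := fun j => congrFun e2 j
        have a0 := f1 0
        have a1 := f1 1
        have a2 := f1 2
        have c0 := f2 0
        have c1 := f2 1
        have c2 := f2 2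
        simp [hm'] at a0 a1 a2 c0 c1 c2
        exact hfree (m (i, true)) (b 0) (b 1) (b 2) (m (i, false)) a0 h01 h12 c2.symm hadj.symm
          a1 h02 (fun h => c1 h.symm) (fun h => a2 h.symm) c0
    · rintro G ⟨-, hGG, -, hb⟩ G' ⟨-, hGG', -, hb'⟩ heq
      simp only [Prod.mk.injEq] at heq
      have key : ∀ i y, G.Adj (b i) y ↔ G'.Adj (b i) y := by
        intro i y
        by_cases hy : y ∈ A
        · have := congrFun (congrFun heq.2 ⟨y, hy⟩) i
          simp only [decide_eq_decide] at this
          rw [G.adj_comm, G'.adj_comm]; exact this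
        · have h1 := Finset.ext_iff.1 (congrFun heq.1 i) y
          simp only [mem_nb, Finset.mem_compl, hy, not_false_eq_true, true_and, iff_true] at h1
          by_cases hyb : y = b i
          · subst hyb; simp
          · simpa [hyb] using h1
      ext x y
      by_cases hx : x ∈ K
      · rw [hKb, Finset.mem_image] at hx
        obtain ⟨i, -, rfl⟩ := hx
        exact key i y
      · by_cases hy : y ∈ K
        · rw [hKb, Finset.mem_image] at hy
          obtain ⟨i, -, rfl⟩ := hy
          rw [G.adj_comm, G'.adj_comm]; exact key i x
        · rw [hGG x hx y hy, hGG' x hx y hy]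
  have h3 : ((((Fintype.piFinset fun _ : Fin 3 => 𝒯 : Finset _) : Set (Fin 3 → Finset V)) ×ˢ
      𝒢).ncard : ℝ) = (𝒯.card : ℝ) ^ 3 * 𝒢.ncard := by
    rw [Set.ncard_prod, Set.ncard_coe_finset, Fintype.card_piFinset]
    simp
  calc _ ≤ _ := Nat.cast_le.2 hcode
    _ = (𝒯.card : ℝ) ^ 3 * 𝒢.ncard := h3
    _ ≤ _ := by gcongr

theorem count_path_matching {V : Type} [Fintype V] [DecidableEq V] {ζ d σ μ ρ ε η : ℝ} {t : ℕ}
    (H : ∀ R : Finset V, ((R.powerset.filter fun Y => (Y.card : ℝ) ≤ η * R.card).card : ℝ) ≤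
      2 ^ (ε * R.card)) (hd : 0 < d)
    (hζ : 0 < ζ) (hμ0 : 0 < μ) (hσ : 8 * σ ≤ d * ρ) (hζρ : 2 * ζ + ζ / μ ≤ ρ / 2) (hρ : ρ < 1 / 8)
    (hn : 16 ≤ ρ * Fintype.card V) (hρη : 2 * ρ ≤ η)
    (hμ : 3 < μ * Fintype.card V) (hση : σ * Fintype.card V + 5 ≤ η * Fintype.card V) :
    ({G : SimpleGraph V | C5Free G ∧ ∃ A, Near G A ζ d σ μ ∧ (∃ b, IsPathOutside G A b) ∧
      ∃ m : Fin t × Bool → V, IsMatchingIn G A m}.ncard : ℝ) ≤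
      (Fintype.card V : ℝ) ^ 3 * (c5count (Fintype.card V - 3) *
        ((2 * 2 ^ (ε * Fintype.card V)) *
        ((((Fintype.card V + 2 : ℕ) : ℝ) * 2 ^ (ε * Fintype.card V)) ^ 3 *
        (2 ^ (3 * ((1 / 2 + ζ) * Fintype.card V)) * (63 / 64) ^ t)))) := by
  set n : ℝ := (Fintype.card V : ℝ) with hn'
  have hset : {G : SimpleGraph V | C5Free G ∧ ∃ A, Near G A ζ d σ μ ∧ (∃ b, IsPathOutside G A b) ∧
      ∃ m : Fin t × Bool → V, IsMatchingIn G A m} = {G | ∃ b : Fin 3 → V, C5Free G ∧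
        ∃ A, Near G A ζ d σ μ ∧ IsPathOutside G A b ∧ ∃ m : Fin t × Bool → V, IsMatchingIn G A m} := by
    ext G
    constructor
    · rintro ⟨h1, A, h2, ⟨b, h3⟩, h4⟩; exact ⟨b, h1, A, h2, h3, h4⟩
    · rintro ⟨b, h1, A, h2, h3, h4⟩; exact ⟨h1, A, h2, ⟨b, h3⟩, h4⟩
  have hcard : (Fintype.card (Fin 3 → V) : ℝ) = n ^ 3 := by simp [hn']
  rw [hset, ← hcard]
  refine ncard_exists_le _ _ fun b => ?_
  by_cases hb : b 0 ≠ b 1 ∧ b 1 ≠ b 2 ∧ b 0 ≠ b 2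
  swap
  · rw [show {G : SimpleGraph V | C5Free G ∧ ∃ A, Near G A ζ d σ μ ∧ IsPathOutside G A b ∧
      ∃ m : Fin t × Bool → V, IsMatchingIn G A m} = ∅ from ?_]
    · simp only [Set.ncard_empty, Nat.cast_zero]; positivity
    · rw [Set.eq_empty_iff_forall_notMem]
      rintro G ⟨-, A, -, ⟨-, h01, h12, -, h02⟩, -⟩
      exact hb ⟨h01.ne, h12.ne, h02⟩
  set K : Finset V := Finset.univ.image b with hK
  have hbi : Function.Injective b := by
    intro i j hij
    fin_cases i <;> fin_cases j <;> simp_all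
  have hK3 : K.card = 3 := by rw [hK, Finset.card_image_of_injective _ hbi]; simp
  have hsub : Fintype.card {x // x ∉ K} = Fintype.card V - 3 := by
    rw [Fintype.card_subtype_compl, Fintype.card_coe, hK3]
  have hc5 := ncard_c5Free {x // x ∉ K}
  rw [hsub] at hc5
  rw [← hc5]
  refine ncard_le_mul_of_fiber _ {H : SimpleGraph {x // x ∉ K} | C5Free H}
    (fun G => G.comap Subtype.val) (fun G hG => hG.1.comap _) _ fun G₀ _ => ?_
  set F := {G : SimpleGraph V | (C5Free G ∧ ∃ A, Near G A ζ d σ μ ∧ IsPathOutside G A b ∧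
      ∃ m : Fin t × Bool → V, IsMatchingIn G A m) ∧ G.comap Subtype.val = G₀} with hF
  change (F.ncard : ℝ) ≤ _
  have hagree : ∀ G ∈ F, ∀ G' ∈ F, ∀ x ∉ K, ∀ y ∉ K, (G.Adj x y ↔ G'.Adj x y) := by
    rintro G ⟨-, e1⟩ G' ⟨-, e2⟩ x hx y hy
    have e3 : (G.comap (Subtype.val : {x // x ∉ K} → V)).Adj ⟨x, hx⟩ ⟨y, hy⟩ ↔
      (G'.comap (Subtype.val : {x // x ∉ K} → V)).Adj ⟨x, hx⟩ ⟨y, hy⟩ := by rw [e1, e2]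
    exact e3
  rcases F.eq_empty_or_nonempty with hF0 | ⟨G2, hG2⟩
  · rw [hF0]; simp only [Set.ncard_empty, Nat.cast_zero]; positivity
  obtain ⟨A2, hA2, -⟩ := hG2.1.2
  set T : Set (Finset V) := {A | ∃ i : Bool, ((symmDiff (if i = true then A2 else A2ᶜ) A).card : ℝ) ≤
    2 * ρ * n} with hT
  have hTc : (T.ncard : ℝ) ≤ 2 * 2 ^ (ε * n) := by
    have := ncard_symmDiff_le H (fun i : Bool => if i = true then A2 else A2ᶜ)
      (x := 2 * ρ * n) (by gcongr)
    rw [Fintype.card_bool] at this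
    exact_mod_cast this
  refine (ncard_le_mul_of_exists F T (fun G A => Near G A ζ d σ μ ∧ IsPathOutside G A b ∧
      ∃ m : Fin t × Bool → V, IsMatchingIn G A m) ?_ _ fun A _ => ?_).trans
    (mul_le_mul_of_nonneg_right hTc ?_)
  · intro G hG
    obtain ⟨A, hA, h1⟩ := hG.1.2
    refine ⟨A, ?_, hA, h1⟩
    rcases hA2.symmDiff_small hA (hagree G2 hG2 G hG) hK3.le hd hζ hμ0 hσ hζρ hρ hn with h | h
    · exact ⟨true, by simpa using h⟩
    · exact ⟨false, by simpa using h⟩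
  · rcases ({x | x ∈ F ∧ Near x A ζ d σ μ ∧ IsPathOutside x A b ∧
      ∃ m : Fin t × Bool → V, IsMatchingIn x A m}).eq_empty_or_nonempty with h0 | ⟨G₁, hG₁, hn1, -, m, hm⟩
    · rw [h0]; simp only [Set.ncard_empty, Nat.cast_zero]; positivity
    refine le_trans (Nat.cast_le.2 (Set.ncard_le_ncard ?_ (Set.toFinite _)))
      ((card_fixed_side_le (ζ := ζ) (d := d) H hK hm hμ hση).trans ?_)
    · rintro G ⟨h1, h2, h3, -⟩
      exact ⟨h1.1.1, hagree G h1 G₁ hG₁, h2, h3⟩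
    · gcongr
      rw [Real.rpow_mul (by norm_num), show (2 : ℝ) ^ (3 : ℝ) = 8 by norm_num,
        ← Real.rpow_natCast]
      exact Real.rpow_le_rpow_of_exponent_le (by norm_num) hn1.card_le
  · positivity

def AlmostClique {V : Type*} (G : SimpleGraph V) (D : Set V) (t : ℕ) : Prop :=
  ∃ W : Finset V, W.card ≤ 2 * t ∧ G.IsClique (D \ ↑W)

def SideSimple {V : Type*} (G : SimpleGraph V) (D : Set V) (t : ℕ) : Prop :=
  (P3Free G D ∨ P3Free Gᶜ D) ∧ (AlmostClique G D t ∨ AlmostClique Gᶜ D t)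

/-- The vertex set splits into two parts, on each of which the graph has a very restricted
structure; such graphs are rare. -/
def IsDegenerate {V : Type*} (G : SimpleGraph V) (t : ℕ) : Prop :=
  ∃ A : Set V, SideSimple G A t ∧ SideSimple G Aᶜ t

theorem AlmostClique.of_isClique {V : Type*} {G : SimpleGraph V} {D : Set V} (h : G.IsClique D)
    (t : ℕ) : AlmostClique G D t :=
  ⟨∅, by simp, by simpa using h⟩

theorem AlmostClique.not_compl {V : Type*} {G : SimpleGraph V} {D : Finset V} {t : ℕ}
    (h : AlmostClique G D t) (hD : 4 * t + 2 ≤ D.card) : ¬AlmostClique Gᶜ D t := by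
  rintro ⟨W₂, h₂, hc₂⟩
  obtain ⟨W₁, h₁, hc₁⟩ := h
  have : 1 < (D \ (W₁ ∪ W₂)).card := by
    have h3 := Finset.le_card_sdiff (W₁ ∪ W₂) D
    have h4 := Finset.card_union_le W₁ W₂
    omega
  obtain ⟨x, hx, y, hy, hne⟩ := Finset.one_lt_card.1 this
  simp only [Finset.mem_sdiff, Finset.mem_union, not_or] at hx hy
  have a1 := hc₁ (show x ∈ (D : Set V) \ W₁ by simp [hx]) (show y ∈ (D : Set V) \ W₁ by simp [hy]) hne
  have a2 := hc₂ (show x ∈ (D : Set V) \ W₂ by simp [hx]) (show y ∈ (D : Set V) \ W₂ by simp [hy]) hne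
  exact ((G.compl_adj x y).1 a2).2 a1

theorem SideSimple.compl {V : Type*} {G : SimpleGraph V} {D : Set V} {t : ℕ}
    (h : SideSimple G D t) : SideSimple Gᶜ D t :=
  ⟨by rw [compl_compl]; exact h.1.symm, by rw [compl_compl]; exact h.2.symm⟩

theorem IsDegenerate.of_compl {V : Type*} {G : SimpleGraph V} {t : ℕ}
    (h : IsDegenerate Gᶜ t) : IsDegenerate G t := by
  obtain ⟨A, h1, h2⟩ := h
  exact ⟨A, by simpa using h1.compl, by simpa using h2.compl⟩

theorem IsClique.p3Free {V : Type*} {G : SimpleGraph V} {D : Set V} (h : G.IsClique D) :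
    P3Free G D :=
  fun _ hx _ _ _ hz _ _ hne => h hx hz hne

theorem P3Free.homogeneous {V : Type*} {G : SimpleGraph V} {D : Set V} (h : P3Free G D)
    (h' : P3Free Gᶜ D) : G.IsClique D ∨ Gᶜ.IsClique D := by
  by_cases hc : Gᶜ.IsClique D
  · exact .inr hc
  left
  obtain ⟨x, hx, y, hy, hne, hxy⟩ : ∃ x ∈ D, ∃ y ∈ D, x ≠ y ∧ G.Adj x y := by
    by_contra hno
    push Not at hno
    exact hc fun x hx y hy hne => (G.compl_adj x y).2 ⟨hne, hno x hx y hy hne⟩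
  have key : ∀ z ∈ D, z ≠ x → G.Adj x z := by
    intro z hz hzx
    by_contra hn
    by_cases hzy : z = y
    · exact hn (hzy ▸ hxy)
    by_cases hadj : G.Adj z y
    · exact hn (h z hz y hy x hx hadj hxy.symm hzx).symm
    · exact ((G.compl_adj x y).1 (h' x hx z hz y hy ((G.compl_adj x z).2 ⟨hzx.symm, hn⟩)
        ((G.compl_adj z y).2 ⟨hzy, hadj⟩) hne)).2 hxy
  intro z hz w hw hzw
  by_cases e1 : z = x
  · subst e1; exact key w hw (Ne.symm hzw)
  by_cases e2 : w = x
  · subst e2; exact (key z hz hzw).symm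
  exact h z hz x hx w hw (key z hz e1).symm (key w hw e2) hzw

theorem exists_matching_or {V : Type*} (G : SimpleGraph V) (A : Finset V) (t : ℕ) :
    (∃ m : Fin t × Bool → V, IsMatchingIn G A m) ∨ AlmostClique Gᶜ (A : Set V) t := by
  induction t with
  | zero =>
    left
    exact ⟨fun e => e.1.elim0, fun e => e.1.elim0, fun e => e.1.elim0, fun i => i.elim0⟩
  | succ t ih =>
    rcases ih with ⟨m, hinj, hA, hadj⟩ | ⟨W, hW, hc⟩
    swap
    · exact .inr ⟨W, by omega, hc⟩
    by_cases h : ∃ u ∈ A, ∃ v ∈ A, u ∉ Finset.univ.image m ∧ v ∉ Finset.univ.image m ∧ G.Adj u v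
    · left
      obtain ⟨u, hu, v, hv, hum, hvm, huv⟩ := h
      simp only [Finset.mem_image, Finset.mem_univ, true_and, not_exists] at hum hvm
      refine ⟨fun e => Fin.cases (if e.2 then u else v) (fun j => m (j, e.2)) e.1, ?_, ?_, ?_⟩
      · rintro ⟨i, b⟩ ⟨j, b'⟩ he
        induction i using Fin.cases with
        | zero =>
          induction j using Fin.cases with
          | zero =>
            cases b <;> cases b' <;> simp at he ⊢
            · exact huv.ne he.symm
            · exact huv.ne he
          | succ j =>
            simp only [Fin.cases_zero, Fin.cases_succ] at he
            split_ifs at he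
            · exact absurd he.symm (hum _)
            · exact absurd he.symm (hvm _)
        | succ i =>
          induction j using Fin.cases with
          | zero =>
            simp only [Fin.cases_zero, Fin.cases_succ] at he
            split_ifs at he
            · exact absurd he (hum _)
            · exact absurd he (hvm _)
          | succ j =>
            simp only [Fin.cases_succ] at he
            have := hinj he
            simp only [Prod.mk.injEq] at this ⊢
            exact ⟨by rw [this.1], this.2⟩
      · rintro ⟨i, b⟩
        induction i using Fin.cases with
        | zero => cases b <;> simpa
        | succ i => exact hA _
      · intro i
        induction i using Fin.cases with
        | zero => simpa using huv
        | succ i => exact hadj i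
    · right
      refine ⟨Finset.univ.image m, ?_, ?_⟩
      · refine Finset.card_image_le.trans ?_
        simp only [Finset.card_univ, Fintype.card_prod, Fintype.card_fin, Fintype.card_bool]
        omega
      · intro x hx y hy hne
        push Not at h
        exact (G.compl_adj x y).2 ⟨hne, h x hx.1 y hy.1 (by simpa using hx.2) (by simpa using hy.2)⟩

theorem p3Free_of_no_path {V : Type*} [Fintype V] [DecidableEq V] {G : SimpleGraph V} {A : Finset V}
    (h : ¬∃ b, IsPathOutside G A b) : P3Free G (A : Set V)ᶜ := by
  intro x hx y hy z hz hxy hyz hne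
  by_contra hn
  refine h ⟨![x, y, z], ?_, hxy, hyz, hn, hne⟩
  intro i
  fin_cases i
  · exact hx
  · exact hy
  · exact hz

/-- A path in one side together with a large matching in the other one. -/
def HasPathMatching {V : Type*} [Fintype V] [DecidableEq V] (G : SimpleGraph V) (ζ d σ μ : ℝ)
    (t : ℕ) : Prop :=
  ∃ A, Near G A ζ d σ μ ∧ (∃ b, IsPathOutside G A b) ∧ ∃ m : Fin t × Bool → V, IsMatchingIn G A m

theorem Near.p3Free_or {V : Type*} [Fintype V] [DecidableEq V] {G : SimpleGraph V} {A : Finset V}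
    {ζ d σ μ : ℝ} {t : ℕ} (h : Near G A ζ d σ μ) (hG : ¬HasPathMatching G ζ d σ μ t) :
    P3Free G (A : Set V)ᶜ ∨ AlmostClique Gᶜ (A : Set V) t := by
  rcases exists_matching_or G A t with h1 | h1
  · exact .inl (p3Free_of_no_path fun h2 => hG ⟨A, h, h2, h1⟩)
  · exact .inr h1

theorem unipolar_of_both {V : Type*} {G : SimpleGraph V} {D E : Finset V} {t : ℕ}
    (hDE : (D : Set V)ᶜ = E)
    (hE : 4 * t + 2 ≤ E.card)
    (h1 : P3Free G (E : Set V)) (h2 : P3Free Gᶜ (E : Set V))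
    (h3 : P3Free G (D : Set V) ∨ AlmostClique Gᶜ (E : Set V) t)
    (h4 : P3Free Gᶜ (D : Set V) ∨ AlmostClique G (E : Set V) t) : IsGenSplit G := by
  have hDE' : (E : Set V)ᶜ = D := by rw [← hDE, compl_compl]
  rcases h1.homogeneous h2 with hc | hc
  · left
    refine ⟨E, (isUnipolarArrangement_iff _ _).2 ⟨hc, ?_⟩⟩
    rw [hDE']
    exact h3.resolve_right ((AlmostClique.of_isClique hc t).not_compl hE)
  · right
    refine ⟨E, (isUnipolarArrangement_iff _ _).2 ⟨hc, ?_⟩⟩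
    rw [hDE']
    refine h4.resolve_right fun h5 => h5.not_compl hE (AlmostClique.of_isClique hc t)

theorem Near.isGenSplit_or {V : Type*} [Fintype V] [DecidableEq V] {G : SimpleGraph V} {A : Finset V}
    {ζ d σ μ : ℝ} {t : ℕ} (h : Near G A ζ d σ μ) (hG : ¬HasPathMatching G ζ d σ μ t)
    (hG' : ¬HasPathMatching Gᶜ ζ d σ μ t) (hA : 4 * t + 2 ≤ A.card) (hB : 4 * t + 2 ≤ (Aᶜ).card) :
    IsGenSplit G ∨ IsDegenerate G t := by
  have cA : (A : Set V)ᶜ = ((Aᶜ : Finset V) : Set V) := by simp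
  have cB : ((Aᶜ : Finset V) : Set V)ᶜ = (A : Set V) := by simp
  have a1 := h.p3Free_or hG
  have a2 := h.compl.p3Free_or hG'
  have b1 := h.symm.p3Free_or hG
  have b2 := h.symm.compl.p3Free_or hG'
  rw [compl_compl] at a2 b2
  rw [cA] at a1 a2
  rw [cB] at b1 b2
  by_cases hA2 : P3Free G ((Aᶜ : Finset V) : Set V) ∧ P3Free Gᶜ ((Aᶜ : Finset V) : Set V)
  · exact .inl (unipolar_of_both cA hB hA2.1 hA2.2 b1 b2)
  by_cases hB2 : P3Free G (A : Set V) ∧ P3Free Gᶜ (A : Set V)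
  · exact .inl (unipolar_of_both cB hA hB2.1 hB2.2 a1 a2)
  right
  have nA : ¬(AlmostClique G (A : Set V) t ∧ AlmostClique Gᶜ (A : Set V) t) :=
    fun h => h.1.not_compl hA h.2
  have nB : ¬(AlmostClique G ((Aᶜ : Finset V) : Set V) t ∧
    AlmostClique Gᶜ ((Aᶜ : Finset V) : Set V) t) := fun h => h.1.not_compl hB h.2
  refine ⟨A, ⟨?_, ?_⟩, ?_⟩
  · exact b1.elim .inl fun h3 => b2.elim .inr fun h4 => (nB ⟨h4, h3⟩).elim
  · exact a1.elim (fun h3 => a2.elim (fun h4 => (hA2 ⟨h3, h4⟩).elim) .inl) .inr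
  rw [cA]
  refine ⟨?_, ?_⟩
  · exact a1.elim .inl fun h3 => a2.elim .inr fun h4 => (nA ⟨h4, h3⟩).elim
  · exact b1.elim (fun h3 => b2.elim (fun h4 => (hB2 ⟨h3, h4⟩).elim) .inl) .inr

/-- Functions that agree with the identity or with a constant function off a small set. -/
def simpleReps (V : Type*) (t : ℕ) : Set (V → V) :=
  {r | ∃ W : Finset V, W.card ≤ 2 * t ∧ ∃ o : Option V, ∀ v ∉ W, r v = o.getD v}

theorem ncard_simpleReps (V : Type) [Fintype V] [Nonempty V] (t : ℕ) :
    ((simpleReps V t).ncard : ℝ) ≤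
      2 ^ Fintype.card V * (Fintype.card V + 1) * (Fintype.card V : ℝ) ^ (2 * t) := by
  have h1 : simpleReps V t = {r | ∃ p : Finset V × Option V, p.1.card ≤ 2 * t ∧
      ∀ v ∉ p.1, r v = p.2.getD v} := by
    ext r
    constructor
    · rintro ⟨W, hW, o, h⟩; exact ⟨(W, o), hW, h⟩
    · rintro ⟨⟨W, o⟩, hW, h⟩; exact ⟨W, hW, o, h⟩
  have hn : (1 : ℝ) ≤ Fintype.card V := by exact_mod_cast Fintype.card_pos (α := V)
  rw [h1]
  refine (ncard_exists_le _ ((Fintype.card V : ℝ) ^ (2 * t)) ?_).trans (le_of_eq ?_)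
  · rintro ⟨W, o⟩
    by_cases hW : W.card ≤ 2 * t
    · refine le_trans ?_ (pow_le_pow_right₀ hn hW)
      have : {r : V → V | W.card ≤ 2 * t ∧ ∀ v ∉ W, r v = o.getD v}.ncard ≤
          (Set.univ : Set (W → V)).ncard := by
        refine Set.ncard_le_ncard_of_injOn (fun r v => r v) (fun _ _ => Set.mem_univ _) ?_
          (Set.toFinite _)
        rintro r ⟨-, hr⟩ r' ⟨-, hr'⟩ he
        ext v
        by_cases hv : v ∈ W
        · exact congrFun he ⟨v, hv⟩
        · rw [hr v hv, hr' v hv]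
      rw [Set.ncard_univ, Nat.card_eq_fintype_card, Fintype.card_fun, Fintype.card_coe] at this
      exact_mod_cast this
    · simp only [hW, false_and]
      simp only [Set.ofPred_false, Set.ncard_empty, Nat.cast_zero]
      positivity
  · simp

theorem P3Free.exists_simpleRep {V : Type*} {G : SimpleGraph V} {D : Set V} {t : ℕ}
    (h : P3Free G D) (h' : AlmostClique G D t ∨ AlmostClique Gᶜ D t) :
    ∃ r ∈ simpleReps V t, ∀ x ∈ D, ∀ y ∈ D, x ≠ y → (G.Adj x y ↔ r x = r y) := by
  let s : Setoid V :=
    { r := fun x y => x = y ∨ (x ∈ D ∧ y ∈ D ∧ G.Adj x y)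
      iseqv :=
        { refl := fun x => .inl rfl
          symm := by
            rintro x y (rfl | ⟨h1, h2, h3⟩)
            · exact .inl rfl
            · exact .inr ⟨h2, h1, h3.symm⟩
          trans := by
            rintro x y z (rfl | ⟨h1, h2, h3⟩) (rfl | ⟨h4, h5, h6⟩)
            · exact .inl rfl
            · exact .inr ⟨h4, h5, h6⟩
            · exact .inr ⟨h1, h2, h3⟩
            · by_cases hxz : x = z
              · exact .inl hxz
              · exact .inr ⟨h1, h5, h x h1 y h2 z h5 h3 h6 hxz⟩ } }
  have hs : ∀ x ∈ D, ∀ y ∈ D, x ≠ y → (G.Adj x y ↔ s x y) := by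
    intro x hx y hy hne
    constructor
    · exact fun h => .inr ⟨hx, hy, h⟩
    · rintro (h | h)
      · exact (hne h).elim
      · exact h.2.2
  have hout : ∀ x, s (Quotient.mk s x).out x := fun x => Quotient.exact (Quotient.out_eq _)
  have houteq : ∀ x y, (Quotient.mk s x).out = (Quotient.mk s y).out ↔ s x y := by
    intro x y
    rw [Quotient.out_inj]
    exact ⟨fun h => Quotient.exact h, fun h => Quotient.sound h⟩
  suffices hmain : ∃ r ∈ simpleReps V t, ∀ x ∈ D, ∀ y ∈ D, (s x y ↔ r x = r y) by
    obtain ⟨r, hr, hr'⟩ := hmain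
    exact ⟨r, hr, fun x hx y hy hne => (hs x hx y hy hne).trans (hr' x hx y hy)⟩
  have indep : AlmostClique Gᶜ D t → ∃ r ∈ simpleReps V t, ∀ x ∈ D, ∀ y ∈ D,
      (s x y ↔ r x = r y) := by
    rintro ⟨W, hW, hc⟩
    have huniq : ∀ u ∈ D \ W, ∀ u' ∈ D \ W, s u u' → u = u' := by
      intro u hu u' hu' h
      by_contra hne
      exact ((G.compl_adj u u').1 (hc hu hu' hne)).2 ((hs u hu.1 u' hu'.1 hne).2 h)
    let r : V → V := fun v => if h : ∃ u ∈ D \ W, s v u then h.choose else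
      if v ∈ D then (Quotient.mk s v).out else v
    have hr1 : ∀ v, ∀ u ∈ D \ W, s v u → r v = u := by
      intro v u hu hvu
      have h : ∃ u ∈ D \ W, s v u := ⟨u, hu, hvu⟩
      have h2 : r v = h.choose := dif_pos h
      rw [h2]
      exact huniq _ h.choose_spec.1 _ hu (s.trans (s.symm h.choose_spec.2) hvu)
    have hr2 : ∀ v ∈ D, (¬∃ u ∈ D \ W, s v u) → r v = (Quotient.mk s v).out := by
      intro v hv h
      have h2 : r v = if v ∈ D then (Quotient.mk s v).out else v := dif_neg h
      rw [h2, if_pos hv]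
    refine ⟨r, ⟨W, hW, none, ?_⟩, ?_⟩
    · intro v hv
      rw [Option.getD_none]
      by_cases hvD : v ∈ D
      · exact hr1 v v ⟨hvD, hv⟩ (s.refl v)
      · have h : ¬∃ u ∈ D \ (W : Set V), s v u := by
          rintro ⟨u, hu, rfl | h⟩
          · exact hvD hu.1
          · exact hvD h.1
        have h2 : r v = if v ∈ D then (Quotient.mk s v).out else v := dif_neg h
        rw [h2, if_neg hvD]
    · intro x hx y hy
      by_cases h1 : ∃ u ∈ D \ (W : Set V), s x u
      · obtain ⟨u, hu, hxu⟩ := h1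
        rw [hr1 x u hu hxu]
        by_cases h2 : ∃ u ∈ D \ (W : Set V), s y u
        · obtain ⟨u', hu', hyu'⟩ := h2
          rw [hr1 y u' hu' hyu']
          constructor
          · exact fun h => huniq u hu u' hu' (s.trans (s.symm hxu) (s.trans h hyu'))
          · rintro rfl; exact s.trans hxu (s.symm hyu')
        · rw [hr2 y hy h2]
          constructor
          · exact fun h => (h2 ⟨u, hu, s.trans (s.symm h) hxu⟩).elim
          · intro h; exact (h2 ⟨u, hu, h ▸ s.symm (hout y)⟩).elim
      · rw [hr2 x hx h1]
        by_cases h2 : ∃ u ∈ D \ (W : Set V), s y u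
        · obtain ⟨u', hu', hyu'⟩ := h2
          rw [hr1 y u' hu' hyu']
          constructor
          · exact fun h => (h1 ⟨u', hu', s.trans h hyu'⟩).elim
          · intro h; exact (h1 ⟨u', hu', h ▸ s.symm (hout x)⟩).elim
        · rw [hr2 y hy h2, houteq]
  rcases h' with ⟨W, hW, hc⟩ | h'
  swap
  · exact indep h'
  rcases (D \ (W : Set V)).eq_empty_or_nonempty with h0 | ⟨r₀, hr₀⟩
  · exact indep ⟨W, hW, by rw [h0]; exact SimpleGraph.isClique_empty⟩
  refine ⟨fun v => if v ∈ D ∧ ¬s v r₀ then (Quotient.mk s v).out else r₀, ⟨W, hW, some r₀, ?_⟩, ?_⟩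
  · intro v hv
    rw [Option.getD_some]
    refine if_neg ?_
    rintro ⟨hvD, hn⟩
    by_cases hvr : v = r₀
    · exact hn (.inl hvr)
    · exact hn ((hs v hvD r₀ hr₀.1 hvr).1 (hc ⟨hvD, hv⟩ hr₀ hvr))
  · intro x hx y hy
    simp only [hx, hy, true_and]
    by_cases h1 : s x r₀ <;> by_cases h2 : s y r₀ <;> simp only [h1, h2, not_true, not_false_eq_true, if_true, if_false]
    · simpa using s.trans h1 (s.symm h2)
    · exact iff_of_false (fun h => h2 (s.trans (s.symm h) h1)) fun h => h2 (h ▸ s.symm (hout y))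
    · exact iff_of_false (fun h => h1 (s.trans h h2)) fun h => h1 (h ▸ s.symm (hout x))
    · exact (houteq x y).symm

theorem SideSimple.exists_simpleRep {V : Type*} {G : SimpleGraph V} {D : Set V} {t : ℕ}
    (h : SideSimple G D t) : ∃ r ∈ simpleReps V t, ∃ b : Bool, ∀ x ∈ D, ∀ y ∈ D, x ≠ y →
      (G.Adj x y ↔ (r x = r y ↔ b = true)) := by
  rcases h.1 with h1 | h1
  · obtain ⟨r, hr, h2⟩ := h1.exists_simpleRep h.2
    exact ⟨r, hr, true, by simpa using h2⟩
  · obtain ⟨r, hr, h2⟩ := h1.exists_simpleRep h.compl.2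
    refine ⟨r, hr, false, fun x hx y hy hne => ?_⟩
    have := h2 x hx y hy hne
    rw [G.compl_adj] at this
    simp only [Bool.false_eq_true, iff_false]
    tauto

theorem ncard_isDegenerate_le (V : Type) [Fintype V] [DecidableEq V] [Nonempty V] (t : ℕ) :
    ({G : SimpleGraph V | IsDegenerate G t}.ncard : ℝ) ≤
      4 * 2 ^ (Fintype.card V : ℝ) * ((2 ^ Fintype.card V * (Fintype.card V + 1) *
        (Fintype.card V : ℝ) ^ (2 * t)) ^ 2 * 2 ^ ((1 / 4 : ℝ) * (Fintype.card V : ℝ) ^ 2)) := by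
  set P : Finset V × Bool × Bool → SimpleGraph V → Prop := fun p G =>
    ∃ q : (V → V) × (V → V), (q.1 ∈ simpleReps V t ∧ q.2 ∈ simpleReps V t) ∧
      (∀ x ∈ p.1, ∀ y ∈ p.1, x ≠ y → (G.Adj x y ↔ (q.1 x = q.1 y ↔ p.2.1 = true))) ∧
      ∀ x ∉ p.1, ∀ y ∉ p.1, x ≠ y → (G.Adj x y ↔ (q.2 x = q.2 y ↔ p.2.2 = true)) with hP
  have hset : {G : SimpleGraph V | IsDegenerate G t} ⊆ {G | ∃ p, P p G} := by
    rintro G ⟨A, hA, hB⟩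
    obtain ⟨r, hr, b, h1⟩ := hA.exists_simpleRep
    obtain ⟨r', hr', b', h2⟩ := hB.exists_simpleRep
    refine ⟨(Finset.univ.filter fun x => x ∈ A, b, b'), (r, r'), ⟨hr, hr'⟩, ?_, ?_⟩
    · simpa using h1
    · simpa using h2
  refine (Nat.cast_le.2 (Set.ncard_le_ncard hset (Set.toFinite _))).trans ?_
  refine (ncard_exists_le P _ fun p => ?_).trans (mul_le_mul_of_nonneg_right (le_of_eq ?_) ?_)
  · obtain ⟨A, b, b'⟩ := p
    refine (ncard_le_mul_of_exists {G | P (A, b, b') G} ((simpleReps V t) ×ˢ (simpleReps V t))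
      (fun G q => (∀ x ∈ A, ∀ y ∈ A, x ≠ y → (G.Adj x y ↔ (q.1 x = q.1 y ↔ b = true))) ∧
      ∀ x ∉ A, ∀ y ∉ A, x ≠ y → (G.Adj x y ↔ (q.2 x = q.2 y ↔ b' = true))) ?_
      (2 ^ ((1 / 4 : ℝ) * (Fintype.card V : ℝ) ^ 2)) ?_).trans
      (mul_le_mul_of_nonneg_right ?_ (by positivity))
    · rintro G ⟨q, hq, h⟩
      exact ⟨q, Set.mem_prod.2 hq, h⟩
    · rintro q -
      have h1 : {G | G ∈ {G | P (A, b, b') G} ∧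
          (∀ x ∈ A, ∀ y ∈ A, x ≠ y → (G.Adj x y ↔ (q.1 x = q.1 y ↔ b = true))) ∧
          ∀ x ∉ A, ∀ y ∉ A, x ≠ y → (G.Adj x y ↔ (q.2 x = q.2 y ↔ b' = true))}.ncard ≤
          {X : Finset (V × V) | X ⊆ A ×ˢ Aᶜ}.ncard := by
        refine Set.ncard_le_ncard_of_injOn (fun G => crossEdges G (A ×ˢ Aᶜ))
          (fun G _ => Finset.filter_subset _ _) ?_ (Set.toFinite _)
        rintro G ⟨-, h1, h2⟩ G' ⟨-, h1', h2'⟩ he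
        have key : ∀ x ∈ A, ∀ y ∉ A, (G.Adj x y ↔ G'.Adj x y) := by
          intro x hx y hy
          have := Finset.ext_iff.1 he (x, y)
          simpa [crossEdges, hx, hy] using this
        ext x y
        by_cases hxy : x = y
        · simp [hxy]
        by_cases hx : x ∈ A <;> by_cases hy : y ∈ A
        · rw [h1 x hx y hy hxy, h1' x hx y hy hxy]
        · exact key x hx y hy
        · rw [G.adj_comm, G'.adj_comm]; exact key y hy x hx
        · rw [h2 x hx y hy hxy, h2' x hx y hy hxy]
      rw [ncard_subsets, Finset.card_product] at h1
      refine (Nat.cast_le (α := ℝ).2 h1).trans ?_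
      rw [Nat.cast_pow, Nat.cast_ofNat, ← Real.rpow_natCast]
      refine Real.rpow_le_rpow_of_exponent_le (by norm_num) ?_
      rw [Nat.cast_mul]
      exact card_mul_card_compl_le' A
    · rw [Set.ncard_prod, Nat.cast_mul, ← sq]
      gcongr
      exact ncard_simpleReps V t
  · simp only [Fintype.card_prod, Fintype.card_finset, Fintype.card_bool]
    push_cast
    rw [Real.rpow_natCast]
    ring
  · positivity

theorem finite_setoid (α : Type*) [Finite α] : Finite (Setoid α) :=
  Finite.of_injective (fun s : Setoid α => fun x y => s x y) fun s s' h => by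
    ext x y
    exact iff_of_eq (congrFun (congrFun h x) y)

theorem card_setoid_fin (m : ℕ) : Nat.card (Setoid (Fin m)) = bell m := by
  refine Nat.card_eq_of_bijective (fun s => Finpartition.ofSetoid s) ⟨?_, ?_⟩
  · intro s s' h
    ext a b
    rw [← Finpartition.mem_part_ofSetoid_iff_rel, ← Finpartition.mem_part_ofSetoid_iff_rel (s := s')]
    simp only at h
    rw [h]
  · intro P
    have hmem : ∀ a, a ∈ (Finset.univ : Finset (Fin m)) := Finset.mem_univ
    let s : Setoid (Fin m) :=
      { r := fun a b => P.part a = P.part b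
        iseqv := ⟨fun _ => rfl, fun h => h.symm, fun h h' => h.trans h'⟩ }
    refine ⟨s, ?_⟩
    have hpart : ∀ Q : Finpartition (Finset.univ : Finset (Fin m)), Q.parts = Finset.univ.image Q.part := by
      intro Q
      ext X
      rw [Finset.mem_image]
      constructor
      · intro hX
        obtain ⟨a, ha⟩ := Q.nonempty_of_mem_parts hX
        exact ⟨a, hmem a, Q.part_eq_of_mem hX ha⟩
      · rintro ⟨a, -, rfl⟩
        exact Q.part_mem.2 (hmem a)
    refine Finpartition.ext ?_
    rw [hpart, hpart P]
    congr 1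
    ext a b
    rw [Finpartition.mem_part_ofSetoid_iff_rel]
    change P.part a = P.part b ↔ _
    rw [P.mem_part_iff_part_eq_part (hmem _) (hmem _)]
    exact eq_comm

theorem card_setoid (α : Type*) [Fintype α] : Nat.card (Setoid α) = bell (Fintype.card α) := by
  rw [← card_setoid_fin]
  let e := Fintype.equivFin α
  refine Nat.card_congr ⟨Setoid.comap e.symm, Setoid.comap e, ?_, ?_⟩
  · intro s; ext x y; simp [Setoid.comap_rel]
  · intro s; ext x y; simp [Setoid.comap_rel]

theorem pow_le_bell (r k : ℕ) : r ^ k ≤ bell (r + k) := by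
  have h := card_setoid (Fin r ⊕ Fin k)
  rw [Fintype.card_sum, Fintype.card_fin, Fintype.card_fin] at h
  have h2 : Nat.card (Fin k → Fin r) = r ^ k := by simp
  rw [← h, ← h2]
  have := finite_setoid (Fin r ⊕ Fin k)
  refine Nat.card_le_card_of_injective (fun f => Setoid.ker (Sum.elim id f)) fun f g h => ?_
  ext y
  have h1 : Setoid.ker (Sum.elim id f) (.inl (f y)) (.inr y) := rfl
  simp only at h
  rw [h] at h1
  have h3 : f y = g y := h1
  rw [h3]

theorem bell_le_succ (m : ℕ) : bell m ≤ bell (m + 1) := by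
  have h1 := card_setoid (Option (Fin m))
  rw [Fintype.card_option, Fintype.card_fin] at h1
  rw [← card_setoid_fin, ← h1]
  have := finite_setoid (Option (Fin m))
  refine Nat.card_le_card_of_surjective (Setoid.comap some) fun s => ?_
  refine ⟨Setoid.ker (Option.map (Quotient.mk s)), ?_⟩
  ext x y
  rw [Setoid.comap_rel]
  change Option.map (Quotient.mk s) (some x) = Option.map (Quotient.mk s) (some y) ↔ _
  simp only [Option.map_some, Option.some.injEq]
  exact ⟨fun h => Quotient.exact h, fun h => Quotient.sound h⟩

theorem ncard_arrangements_fixed {V : Type*} [Fintype V] [DecidableEq V] (C : Finset V) :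
    {G : SimpleGraph V | IsUnipolarArrangement G (C : Set V)}.ncard =
      2 ^ (C.card * (Fintype.card V - C.card)) * bell (Fintype.card V - C.card) := by
  have hc : Fintype.card {x // x ∉ C} = Fintype.card V - C.card := by
    rw [Fintype.card_subtype_compl, Fintype.card_coe]
  have h1 : Nat.card (({x // x ∈ C} → {x // x ∉ C} → Bool) × Setoid {x // x ∉ C}) =
      2 ^ (C.card * (Fintype.card V - C.card)) * bell (Fintype.card V - C.card) := by
    rw [Nat.card_prod, card_setoid, hc, Nat.card_eq_fintype_card]
    simp only [Fintype.card_fun, Fintype.card_bool, hc, Fintype.card_coe]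
    rw [← pow_mul, mul_comm C.card]
  rw [← h1, ← Nat.card_coe_set_eq]
  have hfree : ∀ G : {G : SimpleGraph V | IsUnipolarArrangement G (C : Set V)},
      P3Free G.1 (C : Set V)ᶜ := fun G => ((isUnipolarArrangement_iff _ _).1 G.2).2
  refine Nat.card_eq_of_bijective (fun G => (fun c x => decide (G.1.Adj c x),
    { r := fun x y => x = y ∨ G.1.Adj x.1 y.1
      iseqv :=
        { refl := fun x => .inl rfl
          symm := by
            rintro x y (rfl | h)
            · exact .inl rfl
            · exact .inr h.symm
          trans := by
            rintro x y z (rfl | h) (rfl | h')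
            · exact .inl rfl
            · exact .inr h'
            · exact .inr h
            · by_cases hxz : x = z
              · exact .inl hxz
              · exact .inr (hfree G x.1 (by simp) y.1 (by simp) z.1
                  (by simp) h h' fun e => hxz (Subtype.ext e)) } })) ⟨?_, ?_⟩
  · rintro ⟨G, hG⟩ ⟨G', hG'⟩ he
    simp only [Prod.mk.injEq] at he
    have key : ∀ x ∈ C, ∀ y ∉ C, (G.Adj x y ↔ G'.Adj x y) := by
      intro x hx y hy
      have := congrFun (congrFun he.1 ⟨x, hx⟩) ⟨y, hy⟩
      simpa only [decide_eq_decide] using this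
    have key2 : ∀ x (hx : x ∉ C) y (hy : y ∉ C), x ≠ y → (G.Adj x y ↔ G'.Adj x y) := by
      intro x hx y hy hne
      have := Setoid.ext_iff.1 he.2 ⟨x, hx⟩ ⟨y, hy⟩
      have h2 : (⟨x, hx⟩ : {x // x ∉ C}) ≠ ⟨y, hy⟩ := fun e => hne (congrArg Subtype.val e)
      change (_ = _ ∨ _) ↔ (_ = _ ∨ _) at this
      simpa only [h2, false_or] using this
    have hc1 := ((isUnipolarArrangement_iff _ _).1 hG).1
    have hc2 := ((isUnipolarArrangement_iff _ _).1 hG').1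
    refine Subtype.ext ?_
    ext x y
    change G.Adj x y ↔ G'.Adj x y
    by_cases hne : x = y
    · simp [hne]
    by_cases hx : x ∈ C <;> by_cases hy : y ∈ C
    · exact iff_of_true (hc1 hx hy hne) (hc2 hx hy hne)
    · exact key x hx y hy
    · rw [G.adj_comm, G'.adj_comm]; exact key y hy x hx
    · exact key2 x hx y hy hne
  · rintro ⟨f, s⟩
    let G : SimpleGraph V :=
      { Adj := fun x y => x ≠ y ∧ if hx : x ∈ C then if hy : y ∈ C then True else f ⟨x, hx⟩ ⟨y, hy⟩ = true
          else if hy : y ∈ C then f ⟨y, hy⟩ ⟨x, hx⟩ = true else s ⟨x, hx⟩ ⟨y, hy⟩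
        symm := ⟨by
          rintro x y ⟨hne, h⟩
          refine ⟨hne.symm, ?_⟩
          by_cases hx : x ∈ C <;> by_cases hy : y ∈ C <;> simp only [hx, hy, dif_pos, dif_neg, not_false_eq_true] at h ⊢
          · exact h
          · exact h
          · exact s.symm h⟩
        loopless := ⟨fun x h => h.1 rfl⟩ }
    have hout : ∀ x (hx : x ∉ C) y (hy : y ∉ C), (G.Adj x y ↔ x ≠ y ∧ s ⟨x, hx⟩ ⟨y, hy⟩) := by
      intro x hx y hy
      change (x ≠ y ∧ _) ↔ _
      simp only [hx, hy, dif_neg, not_false_eq_true]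
    refine ⟨⟨G, (isUnipolarArrangement_iff _ _).2 ⟨?_, ?_⟩⟩, ?_⟩
    · intro x hx y hy hne
      refine ⟨hne, ?_⟩
      rw [dif_pos (by simpa using hx), dif_pos (by simpa using hy)]
      trivial
    · intro x hx y hy z hz hxy hyz hne
      have hx' : x ∉ C := by simpa using hx
      have hy' : y ∉ C := by simpa using hy
      have hz' : z ∉ C := by simpa using hz
      rw [hout x hx' y hy'] at hxy
      rw [hout y hy' z hz'] at hyz
      rw [hout x hx' z hz']
      exact ⟨hne, s.trans hxy.2 hyz.2⟩
    · refine Prod.ext ?_ ?_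
      · funext c x
        have hne : c.1 ≠ x.1 := fun e => x.2 (e ▸ c.2)
        have : G.Adj c.1 x.1 ↔ f c x = true := by
          change (_ ∧ _) ↔ _
          rw [dif_pos c.2, dif_neg x.2]
          simp [hne]
        refine Bool.eq_iff_iff.2 (Iff.trans ?_ this)
        simp only [decide_eq_true_eq]
      · ext x y
        change (x = y ∨ G.Adj x.1 y.1) ↔ _
        rw [hout x.1 x.2 y.1 y.2]
        constructor
        · rintro (rfl | h)
          · exact s.refl x
          · exact h.2
        · intro h
          by_cases hxy : x = y
          · exact .inl hxy
          · exact .inr ⟨fun e => hxy (Subtype.ext e), h⟩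

/-- The set of unipolar arrangements on a vertex set. -/
def arrangements (V : Type*) : Set (SimpleGraph V × Finset V) :=
  {p | IsUnipolarArrangement p.1 (p.2 : Set V)}

theorem ncard_arrangements (V : Type*) [Fintype V] [DecidableEq V] :
    (arrangements V).ncard = scrL (Fintype.card V) := by
  have h1 : (arrangements V).toFinset.card = ∑ C ∈ (Finset.univ : Finset V).powerset,
      {G : SimpleGraph V | IsUnipolarArrangement G (C : Set V)}.ncard := by
    rw [Finset.card_eq_sum_card_fiberwise (f := Prod.snd) (t := Finset.univ.powerset)
      (fun _ _ => by simp)]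
    refine Finset.sum_congr rfl fun C _ => ?_
    rw [Set.ncard_eq_toFinset_card']
    refine Finset.card_bij (fun p _ => p.1) ?_ ?_ ?_
    · rintro ⟨G, C'⟩ h
      simp only [Finset.mem_filter, Set.mem_toFinset] at h ⊢
      obtain ⟨h1, rfl⟩ := h
      exact h1
    · rintro ⟨G, C'⟩ h ⟨G', C''⟩ h' rfl
      simp only [Finset.mem_filter] at h h'
      rw [h.2, h'.2]
    · intro G hG
      refine ⟨(G, C), ?_, rfl⟩
      simp only [Finset.mem_filter, Set.mem_toFinset] at hG ⊢
      exact ⟨hG, trivial⟩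
  rw [Set.ncard_eq_toFinset_card', h1, Finset.sum_congr rfl fun C _ => ncard_arrangements_fixed C,
    Finset.sum_powerset_apply_card fun k =>
      2 ^ (k * (Fintype.card V - k)) * bell (Fintype.card V - k)]
  unfold scrL ell
  simp only [Finset.card_univ, smul_eq_mul, mul_assoc]

theorem scrL_le_succ (n : ℕ) : (scrL n : ℝ) ≤ 2 * 2 ^ (-(n / 2 : ℝ)) * scrL (n + 1) := by
  have hsub : ∀ k ≤ n, (ell n k : ℝ) ≤ 2 ^ (-(n / 2 : ℝ)) * (ell (n + 1) k + ell (n + 1) (k + 1)) := by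
    intro k hk
    have hk' : ((n - k : ℕ) : ℝ) = n - k := Nat.cast_sub hk
    rw [Real.rpow_neg (by norm_num), ← div_eq_inv_mul, le_div_iff₀ (by positivity), mul_comm]
    rcases le_total (n / 2 : ℝ) k with h | h
    · have h1 : 2 ^ k * ell n k ≤ ell (n + 1) k := by
        unfold ell
        rw [Nat.succ_sub hk, Nat.mul_succ, pow_add]
        calc _ = n.choose k * (2 ^ (k * (n - k)) * 2 ^ k) * bell (n - k) := by ring
          _ ≤ (n + 1).choose k * (2 ^ (k * (n - k)) * 2 ^ k) * bell (n - k + 1) := by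
            gcongr
            · exact Nat.le_succ n
            · exact bell_le_succ _
      have h2 : (2 : ℝ) ^ (n / 2 : ℝ) ≤ 2 ^ k := by
        rw [← Real.rpow_natCast]; exact Real.rpow_le_rpow_of_exponent_le (by norm_num) h
      calc _ ≤ (2 : ℝ) ^ k * ell n k := by gcongr
        _ ≤ (ell (n + 1) k : ℝ) := by exact_mod_cast h1
        _ ≤ _ := by linarith [(Nat.cast_nonneg (ell (n + 1) (k + 1)) : (0 : ℝ) ≤ _)]
    · have h1 : 2 ^ (n - k) * ell n k ≤ ell (n + 1) (k + 1) := by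
        unfold ell
        rw [Nat.add_sub_add_right, Nat.succ_mul, pow_add]
        calc _ = n.choose k * (2 ^ (k * (n - k)) * 2 ^ (n - k)) * bell (n - k) := by ring
          _ ≤ _ := by
            gcongr
            rw [Nat.choose_succ_succ]
            exact Nat.le_add_right _ _
      have h2 : (2 : ℝ) ^ (n / 2 : ℝ) ≤ 2 ^ (n - k) := by
        rw [← Real.rpow_natCast]
        exact Real.rpow_le_rpow_of_exponent_le (by norm_num) (by linarith)
      calc _ ≤ (2 : ℝ) ^ (n - k) * ell n k := by gcongr
        _ ≤ (ell (n + 1) (k + 1) : ℝ) := by exact_mod_cast h1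
        _ ≤ _ := by linarith [(Nat.cast_nonneg (ell (n + 1) k) : (0 : ℝ) ≤ _)]
  unfold scrL
  push_cast
  calc _ ≤ ∑ k ∈ Finset.range (n + 1), (2 : ℝ) ^ (-(n / 2 : ℝ)) *
        (ell (n + 1) k + ell (n + 1) (k + 1)) :=
        Finset.sum_le_sum fun k hk => hsub k (by simp at hk; omega)
    _ = 2 ^ (-(n / 2 : ℝ)) * (∑ k ∈ Finset.range (n + 1), (ell (n + 1) k : ℝ) +
        ∑ k ∈ Finset.range (n + 1), (ell (n + 1) (k + 1) : ℝ)) := by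
      rw [← Finset.mul_sum, Finset.sum_add_distrib]
    _ ≤ 2 ^ (-(n / 2 : ℝ)) * (∑ k ∈ Finset.range (n + 1 + 1), (ell (n + 1) k : ℝ) +
        ∑ k ∈ Finset.range (n + 1 + 1), (ell (n + 1) k : ℝ)) := by
      gcongr
      · exact Nat.le_succ n
      · rw [Finset.sum_range_succ' _ (n + 1)]
        exact le_add_of_nonneg_right (Nat.cast_nonneg _)
    _ = _ := by ring

theorem pow_mul_pow_le_scrL (n r : ℕ) (hr : r ≤ n - n / 2) :
    (2 : ℝ) ^ ((1 / 4 : ℝ) * n ^ 2 - 1) * r ^ (n - n / 2 - r) ≤ scrL n := by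
  have h1 : 2 ^ (n / 2 * (n - n / 2)) * r ^ (n - n / 2 - r) ≤ scrL n := by
    calc _ ≤ n.choose (n / 2) * 2 ^ (n / 2 * (n - n / 2)) * bell (n - n / 2) := by
          have := pow_le_bell r (n - n / 2 - r)
          rw [Nat.add_sub_cancel' hr] at this
          gcongr
          exact Nat.le_mul_of_pos_left _ (Nat.choose_pos (Nat.div_le_self _ _))
      _ ≤ scrL n := Finset.single_le_sum (f := ell n) (fun _ _ => Nat.zero_le _)
          (Finset.mem_range.2 (by omega))
  refine le_trans ?_ (Nat.cast_le.2 h1)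
  rw [Nat.cast_mul, Nat.cast_pow r]
  refine mul_le_mul_of_nonneg_right ?_ (by positivity)
  rw [Nat.cast_pow, ← Real.rpow_natCast ((2 : ℕ) : ℝ), Nat.cast_ofNat]
  refine Real.rpow_le_rpow_of_exponent_le one_le_two ?_
  rw [Nat.cast_mul, Nat.cast_sub (Nat.div_le_self _ _)]
  have h2 : ((n / 2 : ℕ) : ℝ) ≤ n / 2 := Nat.cast_div_le.trans_eq (by norm_num)
  have h3 : (n : ℝ) ≤ 2 * ((n / 2 : ℕ) : ℝ) + 1 := by
    exact_mod_cast (by omega : n ≤ 2 * (n / 2) + 1)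
  nlinarith

theorem eventually_le_scrL (K : ℝ) : ∀ᶠ n : ℕ in atTop,
    2 ^ (K * n) * (n : ℝ) ^ ((n : ℝ) / 20) * 2 ^ ((1 / 4 : ℝ) * (n : ℝ) ^ 2) ≤ scrL n := by
  filter_upwards [eventually_ge_atTop ⌈(2 : ℝ) ^ (5 * (K + 2))⌉₊, eventually_ge_atTop 8]
    with n hn hn8
  have hnK : (2 : ℝ) ^ (5 * (K + 2)) ≤ n := (Nat.le_ceil _).trans (by exact_mod_cast hn)
  have hn8' : (8 : ℝ) ≤ n := by exact_mod_cast hn8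
  have hn0 : (0 : ℝ) < n := by linarith
  refine le_trans ?_ (pow_mul_pow_le_scrL n (n / 4) (by omega))
  have h1 : ((n : ℝ) / 8) ^ ((n : ℝ) / 4) ≤ ((n / 4 : ℕ) : ℝ) ^ (n - n / 2 - n / 4) := by
    rw [← Real.rpow_natCast]
    have e1 : (n : ℝ) / 8 ≤ ((n / 4 : ℕ) : ℝ) := by
      have : (n : ℝ) ≤ 8 * ((n / 4 : ℕ) : ℝ) := by exact_mod_cast (by omega : n ≤ 8 * (n / 4))
      linarith
    have e2 : (n : ℝ) / 4 ≤ ((n - n / 2 - n / 4 : ℕ) : ℝ) := by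
      have : (n : ℝ) ≤ 4 * ((n - n / 2 - n / 4 : ℕ) : ℝ) := by
        exact_mod_cast (by omega : n ≤ 4 * (n - n / 2 - n / 4))
      linarith
    calc _ ≤ ((n / 4 : ℕ) : ℝ) ^ ((n : ℝ) / 4) := by gcongr
      _ ≤ _ := Real.rpow_le_rpow_of_exponent_le (by linarith) e2
  have h2 : ((n : ℝ) / 8) ^ ((n : ℝ) / 4) =
      (n : ℝ) ^ ((n : ℝ) / 20) * (n : ℝ) ^ ((n : ℝ) / 5) * 2 ^ (-(3 / 4 * n : ℝ)) := by
    rw [Real.div_rpow hn0.le (by norm_num), ← Real.rpow_add hn0, Real.rpow_neg (by norm_num),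
      ← div_eq_mul_inv, show (8 : ℝ) = 2 ^ (3 : ℝ) by norm_num, ← Real.rpow_mul (by norm_num)]
    congr 2 <;> ring
  have h3 : (2 : ℝ) ^ ((K + 2) * n) ≤ (n : ℝ) ^ ((n : ℝ) / 5) := by
    calc _ = ((2 : ℝ) ^ (5 * (K + 2))) ^ ((n : ℝ) / 5) := by
          rw [← Real.rpow_mul (by norm_num)]; congr 1; ring
      _ ≤ _ := by gcongr
  calc _ = 2 ^ (K * n) * 2 ^ ((1 / 4 : ℝ) * (n : ℝ) ^ 2) * (n : ℝ) ^ ((n : ℝ) / 20) := by ring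
    _ ≤ 2 ^ ((1 / 4 : ℝ) * (n : ℝ) ^ 2 - 1 + (K + 2) * n - 3 / 4 * n) *
        (n : ℝ) ^ ((n : ℝ) / 20) := by
      rw [← Real.rpow_add (by norm_num)]
      gcongr
      · norm_num
      · linarith
    _ = 2 ^ ((1 / 4 : ℝ) * (n : ℝ) ^ 2 - 1) *
        ((n : ℝ) ^ ((n : ℝ) / 20) * 2 ^ ((K + 2) * n) * 2 ^ (-(3 / 4 * n : ℝ))) := by
      rw [sub_eq_add_neg _ (3 / 4 * (n : ℝ)), Real.rpow_add (by norm_num),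
        Real.rpow_add (by norm_num)]
      ring
    _ ≤ _ := by
      refine mul_le_mul_of_nonneg_left (le_trans ?_ h1) (by positivity)
      rw [h2]
      gcongr

theorem natCast_add_one_le_two_rpow (n : ℕ) : (n : ℝ) + 1 ≤ 2 ^ (n : ℝ) := by
  rw [Real.rpow_natCast]
  exact_mod_cast Nat.lt_two_pow_self (n := n)

theorem eventually_ncard_isDegenerate_le (K : ℝ) : ∀ᶠ n : ℕ in atTop,
    ({G : SimpleGraph (Fin n) | IsDegenerate G ⌈(n : ℝ) / 100⌉₊}.ncard : ℝ) ≤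
      2 ^ (-(K * n)) * scrL n := by
  filter_upwards [eventually_le_scrL (K + 7), eventually_ge_atTop 400] with n hL hn
  have : Nonempty (Fin n) := ⟨⟨0, by omega⟩⟩
  have hn' : (400 : ℝ) ≤ n := by exact_mod_cast hn
  set t := ⌈(n : ℝ) / 100⌉₊ with ht
  have htn : (t : ℝ) ≤ n / 100 + 1 := (Nat.ceil_lt_add_one (by positivity)).le
  have h := ncard_isDegenerate_le (Fin n) t
  rw [Fintype.card_fin] at h
  refine h.trans ?_
  rw [Real.rpow_neg (by norm_num), ← div_eq_inv_mul, le_div_iff₀ (by positivity)]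
  refine le_trans ?_ hL
  have h1 : ((n : ℝ) ^ (2 * t)) ^ 2 ≤ (n : ℝ) ^ ((n : ℝ) / 20) := by
    rw [← pow_mul, ← Real.rpow_natCast]
    refine Real.rpow_le_rpow_of_exponent_le (by linarith) ?_
    push_cast
    linarith
  have h2 := natCast_add_one_le_two_rpow n
  have h4 : (4 : ℝ) ≤ 2 ^ (2 * n : ℝ) := by
    calc (4 : ℝ) = 2 ^ (2 : ℝ) := by norm_num
      _ ≤ _ := Real.rpow_le_rpow_of_exponent_le (by norm_num) (by linarith)
  set a : ℝ := 2 ^ (n : ℝ) with ha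
  have ha0 : 0 < a := by positivity
  have e2 : (2 : ℝ) ^ (2 * n : ℝ) = a ^ 2 := by
    rw [ha, ← Real.rpow_natCast, ← Real.rpow_mul (by norm_num)]; congr 1; push_cast; ring
  have e7 : (2 : ℝ) ^ ((K + 7) * n) = 2 ^ (K * n) * a ^ 7 := by
    rw [ha, ← Real.rpow_natCast, ← Real.rpow_mul (by norm_num), ← Real.rpow_add (by norm_num)]
    congr 1; push_cast; ring
  have ea : (2 : ℝ) ^ n = a := by rw [ha, Real.rpow_natCast]
  rw [e7, ea]
  rw [e2] at h4
  calc 4 * a * ((a * (n + 1) * (n : ℝ) ^ (2 * t)) ^ 2 * 2 ^ ((1 / 4 : ℝ) * (n : ℝ) ^ 2)) * 2 ^ (K * n)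
      = 4 * a * (a ^ 2 * (n + 1) ^ 2 * ((n : ℝ) ^ (2 * t)) ^ 2 * 2 ^ ((1 / 4 : ℝ) * (n : ℝ) ^ 2)) *
        2 ^ (K * n) := by ring
    _ ≤ a ^ 2 * a * (a ^ 2 * a ^ 2 * (n : ℝ) ^ ((n : ℝ) / 20) * 2 ^ ((1 / 4 : ℝ) * (n : ℝ) ^ 2)) *
        2 ^ (K * n) := by gcongr
    _ = _ := by ring

theorem eventually_two_rpow_le_scrL {c : ℝ} (hc : 0 < c) (K : ℝ) : ∀ᶠ n : ℕ in atTop,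
    (2 : ℝ) ^ ((1 / 4 - c) * (n : ℝ) ^ 2) ≤ 2 ^ (-(K * n)) * scrL n := by
  filter_upwards [eventually_le_scrL K, eventually_ge_atTop 1] with n hL hn
  have hn' : (1 : ℝ) ≤ n := by exact_mod_cast hn
  rw [Real.rpow_neg (by norm_num), ← div_eq_inv_mul, le_div_iff₀ (by positivity)]
  refine le_trans ?_ hL
  have h1 : 1 ≤ (n : ℝ) ^ ((n : ℝ) / 20) := Real.one_le_rpow hn' (by positivity)
  have h2 : (2 : ℝ) ^ ((1 / 4 - c) * (n : ℝ) ^ 2) ≤ 2 ^ ((1 / 4 : ℝ) * (n : ℝ) ^ 2) :=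
    Real.rpow_le_rpow_of_exponent_le (by norm_num) (by nlinarith [sq_nonneg (n : ℝ)])
  calc _ ≤ 2 ^ ((1 / 4 : ℝ) * (n : ℝ) ^ 2) * (2 : ℝ) ^ (K * n) := by gcongr
    _ = (2 : ℝ) ^ (K * n) * 1 * 2 ^ ((1 / 4 : ℝ) * (n : ℝ) ^ 2) := by ring
    _ ≤ _ := by gcongr

theorem eventually_pow_le_two_rpow (k : ℕ) {δ : ℝ} (hδ : 0 < δ) : ∀ᶠ n : ℕ in atTop,
    ((n : ℝ) + 2) ^ k ≤ 2 ^ (δ * n) := by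
  have h := ((isLittleO_pow_exp_pos_mul_atTop k (b := δ * Real.log 2)
    (by have := Real.log_pos one_lt_two; positivity)).comp_tendsto
    (tendsto_natCast_atTop_atTop (R := ℝ))).bound (show (0 : ℝ) < 2⁻¹ ^ k by positivity)
  filter_upwards [h, eventually_ge_atTop 2] with n hn hn2
  simp only [Function.comp, norm_pow, Real.norm_eq_abs, Real.abs_exp, Nat.abs_cast] at hn
  have hn2' : (2 : ℝ) ≤ n := by exact_mod_cast hn2
  rw [Real.rpow_def_of_pos (by norm_num), show Real.log 2 * (δ * n) = δ * Real.log 2 * n by ring]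
  calc ((n : ℝ) + 2) ^ k ≤ (2 * n) ^ k := by gcongr; linarith
    _ = 2 ^ k * (n : ℝ) ^ k := mul_pow _ _ _
    _ ≤ 2 ^ k * (2⁻¹ ^ k * Real.exp (δ * Real.log 2 * n)) := by gcongr
    _ = _ := by rw [← mul_assoc, ← mul_pow]; norm_num

theorem pow_63_64_le (t : ℕ) {x : ℝ} (hx0 : 0 ≤ x) (hx : x ≤ t) : (63 / 64 : ℝ) ^ t ≤ 2 ^ (-(x / 50)) := by
  have h1 : (63 / 64 : ℝ) ^ (50 : ℝ) ≤ 2⁻¹ := by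
    rw [show (50 : ℝ) = ((50 : ℕ) : ℝ) by norm_num, Real.rpow_natCast]
    norm_num
  calc (63 / 64 : ℝ) ^ t = (63 / 64 : ℝ) ^ (t : ℝ) := (Real.rpow_natCast _ _).symm
    _ ≤ (63 / 64 : ℝ) ^ x := Real.rpow_le_rpow_of_exponent_ge (by norm_num) (by norm_num) hx
    _ = (63 / 64 : ℝ) ^ (50 * (x / 50)) := by congr 1; ring
    _ ≤ _ := by
      rw [Real.rpow_mul (by norm_num), Real.rpow_neg (by norm_num), ← Real.inv_rpow (by norm_num)]
      gcongr

theorem eventually_ncard_hasPathMatching_le {ζ d σ μ ρ η : ℝ}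
    (H : ∀ {β : Type} (R : Finset β), ((R.powerset.filter fun Y => (Y.card : ℝ) ≤ η * R.card).card : ℝ) ≤
      2 ^ ((1 / 100000 : ℝ) * R.card)) (hd : 0 < d) (hζ1 : ζ ≤ 1 / 100000)
    (hζ : 0 < ζ) (hμ0 : 0 < μ) (hσ : 8 * σ ≤ d * ρ) (hζρ : 2 * ζ + ζ / μ ≤ ρ / 2) (hρ0 : 0 < ρ)
    (hρ : ρ < 1 / 8) (hρη : 2 * ρ ≤ η) (hση : σ < η) : ∀ᶠ n : ℕ in atTop,
    ({G : SimpleGraph (Fin n) | C5Free G ∧ HasPathMatching G ζ d σ μ ⌈(n : ℝ) / 100⌉₊}.ncard : ℝ) ≤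
      2⁻¹ * 2 ^ (-((n : ℝ) / 20000)) * (2 ^ ((3 / 2 : ℝ) * n) * c5count (n - 3)) := by
  filter_upwards [eventually_pow_le_two_rpow 8 (δ := 3 / 100000) (by norm_num),
    eventually_ge_atTop ⌈16 / ρ⌉₊, eventually_gt_atTop ⌈3 / μ⌉₊,
    eventually_ge_atTop ⌈5 / (η - σ)⌉₊, eventually_ge_atTop 2] with n hp h1 h2 h3 h4
  have h1' : 16 / ρ ≤ n := (Nat.le_ceil _).trans (by exact_mod_cast h1)
  have h2' : 3 / μ < n := (Nat.le_ceil _).trans_lt (by exact_mod_cast h2)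
  have h3' : 5 / (η - σ) ≤ n := (Nat.le_ceil _).trans (by exact_mod_cast h3)
  have h4' : (2 : ℝ) ≤ n := by exact_mod_cast h4
  rw [div_le_iff₀ hρ0] at h1'
  rw [div_lt_iff₀ hμ0] at h2'
  rw [div_le_iff₀ (by linarith)] at h3'
  have h := count_path_matching (V := Fin n) (t := ⌈(n : ℝ) / 100⌉₊) H hd hζ hμ0 hσ hζρ hρ
    (by rw [Fintype.card_fin]; linarith) hρη (by rw [Fintype.card_fin]; linarith)
    (by rw [Fintype.card_fin]; linarith)
  rw [Fintype.card_fin] at h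
  refine h.trans ?_
  have e1 := pow_63_64_le ⌈(n : ℝ) / 100⌉₊ (by positivity) (Nat.le_ceil _)
  have e2 : (2 : ℝ) ^ (3 * ((1 / 2 + ζ) * n)) ≤ 2 ^ ((3 / 2 : ℝ) * n + 3 / 100000 * n) :=
    Real.rpow_le_rpow_of_exponent_le (by norm_num) (by nlinarith)
  have e3 : ((n + 2 : ℕ) : ℝ) = n + 2 := by push_cast; ring
  rw [e3]
  set f : ℝ := ((c5count (n - 3) : ℕ) : ℝ)
  have hf : 0 ≤ f := Nat.cast_nonneg _
  have e4 : 2 * 2 * (n : ℝ) ^ 3 * ((n : ℝ) + 2) ^ 3 ≤ 2 ^ (3 / 100000 * n : ℝ) := by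
    refine le_trans ?_ hp
    calc _ ≤ ((n : ℝ) + 2) * ((n : ℝ) + 2) * ((n : ℝ) + 2) ^ 3 * ((n : ℝ) + 2) ^ 3 := by
          gcongr <;> linarith
      _ = _ := by ring
  calc _ = 2⁻¹ * (2 * 2 * (n : ℝ) ^ 3 * ((n : ℝ) + 2) ^ 3) * ((2 : ℝ) ^ ((1 / 100000 : ℝ) * n)) ^ 4 *
        (2 ^ (3 * ((1 / 2 + ζ) * n)) * (63 / 64) ^ ⌈(n : ℝ) / 100⌉₊) * f := by ring
    _ ≤ 2⁻¹ * 2 ^ (3 / 100000 * n : ℝ) * ((2 : ℝ) ^ ((1 / 100000 : ℝ) * n)) ^ 4 *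
        (2 ^ ((3 / 2 : ℝ) * n + 3 / 100000 * n) * 2 ^ (-((n : ℝ) / 100 / 50))) * f := by gcongr
    _ = 2⁻¹ * (2 ^ (3 / 100000 * n : ℝ) * ((2 : ℝ) ^ ((1 / 100000 : ℝ) * n)) ^ 4 *
        (2 ^ ((3 / 2 : ℝ) * n + 3 / 100000 * n) * 2 ^ (-((n : ℝ) / 100 / 50)))) * f := by ring
    _ ≤ 2⁻¹ * (2 ^ (-((n : ℝ) / 20000)) * 2 ^ ((3 / 2 : ℝ) * n)) * f := by
      refine mul_le_mul_of_nonneg_right (mul_le_mul_of_nonneg_left ?_ (by norm_num)) hf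
      rw [← Real.rpow_mul_natCast (by norm_num), ← Real.rpow_add (by norm_num),
        ← Real.rpow_add (by norm_num), ← Real.rpow_add (by norm_num), ← Real.rpow_add (by norm_num)]
      exact Real.rpow_le_rpow_of_exponent_le (by norm_num) (by push_cast; linarith)
    _ = _ := by ring

theorem eventually_ncard_not_isGenSplit_le : ∀ᶠ n : ℕ in atTop,
    ({G : SimpleGraph (Fin n) | C5Free G ∧ ¬IsGenSplit G}.ncard : ℝ) ≤
      2 ^ (-((n : ℝ) / 20000)) * (scrL n + 2 ^ ((3 / 2 : ℝ) * n) * c5count (n - 3)) := by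
  obtain ⟨d, hd, _, Hd⟩ := exists_few_not_near
  obtain ⟨η, hη, hη1, Hη⟩ := exists_few_small_subsets (1 / 100000) (by norm_num)
  set ρ := min (η / 2) (1 / 16) with hρ'
  have hρ0 : 0 < ρ := by positivity
  have hρη : ρ ≤ η / 2 := min_le_left _ _
  have hρ1 : ρ ≤ 1 / 16 := min_le_right _ _
  set σ := d * ρ / 8 with hσ'
  have hσ0 : 0 < σ := by positivity
  have hσ1 : σ < η := by
    have : d * ρ ≤ 1 * ρ := by gcongr
    linarith
  obtain ⟨μ, hμ, hμσ, Hμ⟩ := Hd σ hσ0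
  set ζ := min (1 / 100000) (ρ / (2 * (2 + 1 / μ))) with hζ'
  have hζ0 : 0 < ζ := by positivity
  have hζ1 : ζ ≤ 1 / 100000 := min_le_left _ _
  have hζ2 : 2 * ζ + ζ / μ ≤ ρ / 2 := by
    have h1 : ζ ≤ ρ / (2 * (2 + 1 / μ)) := min_le_right _ _
    rw [le_div_iff₀ (by positivity)] at h1
    have : ζ * (2 * (2 + 1 / μ)) = 2 * (2 * ζ + ζ / μ) := by ring
    linarith
  obtain ⟨c, hc, n₀, Hc⟩ := Hμ ζ hζ0
  filter_upwards [eventually_ge_atTop n₀, eventually_ge_atTop 100,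
    eventually_two_rpow_le_scrL hc 2, eventually_ncard_isDegenerate_le 2,
    eventually_ncard_hasPathMatching_le Hη hd hζ1 hζ0 hμ (by rw [hσ']; linarith) hζ2 hρ0
      (by linarith) (by linarith) hσ1] with n hn hn100 hN hD hY
  have hn' : (100 : ℝ) ≤ n := by exact_mod_cast hn100
  have hNear := Hc (V := Fin n) (by rwa [Fintype.card_fin])
  rw [Fintype.card_fin] at hNear
  set t := ⌈(n : ℝ) / 100⌉₊ with ht
  have htn : (t : ℝ) ≤ n / 100 + 1 := (Nat.ceil_lt_add_one (by positivity)).le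
  set Y := {G : SimpleGraph (Fin n) | C5Free G ∧ HasPathMatching G ζ d σ μ t} with hY'
  have hYc : {G : SimpleGraph (Fin n) | C5Free G ∧ HasPathMatching Gᶜ ζ d σ μ t}.ncard ≤ Y.ncard := by
    refine Set.ncard_le_ncard_of_injOn compl ?_ compl_injective.injOn (Set.toFinite _)
    rintro G ⟨h1, h2⟩
    exact ⟨h1.compl, h2⟩
  set D := {G : SimpleGraph (Fin n) | IsDegenerate G t} with hD'
  set N := {G : SimpleGraph (Fin n) | C5Free G ∧ ¬∃ A, Near G A ζ d σ μ} with hN'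
  have hsub : {G : SimpleGraph (Fin n) | C5Free G ∧ ¬IsGenSplit G} ⊆
      (N ∪ D) ∪ (Y ∪ {G : SimpleGraph (Fin n) | C5Free G ∧ HasPathMatching Gᶜ ζ d σ μ t}) := by
    rintro G ⟨hfree, hG⟩
    by_contra hcon
    simp only [Set.mem_union, not_or] at hcon
    obtain ⟨⟨c1, c2⟩, c3, c4⟩ := hcon
    have c1' : ∃ A, Near G A ζ d σ μ := by
      by_contra h; exact c1 ⟨hfree, h⟩
    obtain ⟨A, hA⟩ := c1'
    have hcard : (A.card : ℝ) + (Aᶜ).card = n := by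
      have := Finset.card_add_card_compl A
      rw [Fintype.card_fin] at this
      exact_mod_cast this
    have a1 := hA.card_le
    have a2 := hA.card_compl_le
    rw [Fintype.card_fin] at a1 a2
    have hζn : ζ * n ≤ 1 / 100000 * n := by gcongr
    rcases hA.isGenSplit_or (fun h => c3 ⟨hfree, h⟩) (fun h => c4 ⟨hfree, h⟩)
      (by exact_mod_cast (by push_cast; linarith : ((4 * t + 2 : ℕ) : ℝ) ≤ A.card))
      (by exact_mod_cast (by push_cast; linarith : ((4 * t + 2 : ℕ) : ℝ) ≤ (Aᶜ).card)) with h | h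
    · exact hG h
    · exact c2 h
  have hcount := (Set.ncard_le_ncard hsub (Set.toFinite _)).trans ((Set.ncard_union_le _ _).trans
    (add_le_add (Set.ncard_union_le _ _) (Set.ncard_union_le _ _)))
  have hcount' : ({G : SimpleGraph (Fin n) | C5Free G ∧ ¬IsGenSplit G}.ncard : ℝ) ≤
      N.ncard + D.ncard + (Y.ncard + Y.ncard) := by
    exact_mod_cast hcount.trans (by gcongr)
  have h2 : (2 : ℝ) ^ (-(2 * n : ℝ)) ≤ 2⁻¹ * 2 ^ (-((n : ℝ) / 20000)) := by
    rw [show (2⁻¹ : ℝ) = 2 ^ (-1 : ℝ) by norm_num, ← Real.rpow_add (by norm_num)]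
    exact Real.rpow_le_rpow_of_exponent_le (by norm_num) (by linarith)
  have h3 : (2 : ℝ) ^ (-(2 * n : ℝ)) * scrL n ≤ 2⁻¹ * 2 ^ (-((n : ℝ) / 20000)) * scrL n := by gcongr
  linarith [hNear.trans hN]

theorem ncard_isUnipolar_le (V : Type*) [Fintype V] [DecidableEq V] :
    {G : SimpleGraph V | IsUnipolar G}.ncard ≤ scrL (Fintype.card V) := by
  rw [← ncard_arrangements]
  have : {G : SimpleGraph V | IsUnipolar G} = Prod.fst '' arrangements V := by
    ext G
    constructor
    · rintro ⟨C, hC⟩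
      exact ⟨(G, C.toFinset), by simpa [arrangements] using hC, rfl⟩
    · rintro ⟨⟨G, C⟩, hC, rfl⟩
      exact ⟨C, hC⟩
  rw [this]
  exact Set.ncard_image_le (Set.toFinite _)

theorem ncard_isGenSplit_le (V : Type*) [Fintype V] [DecidableEq V] :
    {G : SimpleGraph V | IsGenSplit G}.ncard ≤ 2 * scrL (Fintype.card V) := by
  have h1 : {G : SimpleGraph V | IsCoUnipolar G}.ncard ≤ {G : SimpleGraph V | IsUnipolar G}.ncard :=
    Set.ncard_le_ncard_of_injOn compl (fun _ h => h) compl_injective.injOn (Set.toFinite _)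
  have h2 := Set.ncard_union_le {G : SimpleGraph V | IsUnipolar G} {G : SimpleGraph V | IsCoUnipolar G}
  have h3 := ncard_isUnipolar_le V
  change ({G : SimpleGraph V | IsUnipolar G} ∪ {G : SimpleGraph V | IsCoUnipolar G}).ncard ≤ _
  omega

theorem one_le_scrL (n : ℕ) : 1 ≤ scrL n := by
  have h := pow_mul_pow_le_scrL n (n - n / 2) le_rfl
  rw [Nat.sub_self, pow_zero, mul_one] at h
  have : (0 : ℝ) < scrL n := lt_of_lt_of_le (by positivity) h
  exact_mod_cast this

theorem two_rpow_mul_scrL_le (n : ℕ) (hn : 3 ≤ n) :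
    (2 : ℝ) ^ ((3 / 2 : ℝ) * n) * scrL (n - 3) ≤ 64 * scrL n := by
  obtain ⟨m, rfl⟩ := Nat.exists_eq_add_of_le hn
  rw [Nat.add_sub_cancel_left, show 3 + m = m + 1 + 1 + 1 by ring]
  have h1 := scrL_le_succ m
  have h2 := scrL_le_succ (m + 1)
  have h3 := scrL_le_succ (m + 1 + 1)
  push_cast at h1 h2 h3 ⊢
  set a : ℝ := ((scrL (m + 1 + 1 + 1) : ℕ) : ℝ)
  calc _ ≤ (2 : ℝ) ^ ((3 / 2 : ℝ) * (m + 1 + 1 + 1)) * (2 * 2 ^ (-(m / 2 : ℝ)) *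
        (2 * 2 ^ (-((m + 1) / 2 : ℝ)) * (2 * 2 ^ (-((m + 1 + 1) / 2 : ℝ)) * a))) := by
        refine mul_le_mul_of_nonneg_left (h1.trans ?_) (by positivity)
        refine mul_le_mul_of_nonneg_left (h2.trans ?_) (by positivity)
        exact mul_le_mul_of_nonneg_left h3 (by positivity)
    _ = 8 * ((2 : ℝ) ^ ((3 / 2 : ℝ) * (m + 1 + 1 + 1)) * 2 ^ (-(m / 2 : ℝ)) *
        2 ^ (-((m + 1) / 2 : ℝ)) * 2 ^ (-((m + 1 + 1) / 2 : ℝ))) * a := by ring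
    _ = 8 * 2 ^ (3 : ℝ) * a := by
      rw [← Real.rpow_add (by norm_num), ← Real.rpow_add (by norm_num), ← Real.rpow_add (by norm_num)]
      congr 3; ring
    _ = _ := by norm_num

theorem exists_c5count_le : ∃ M : ℝ, 0 ≤ M ∧ ∀ n, (c5count n : ℝ) ≤ M * scrL n := by
  have hsmall : ∀ᶠ n : ℕ in atTop, ((n : ℝ) + 2) ^ 8 ≤ 2 ^ (1 / 20000 * n : ℝ) :=
    eventually_pow_le_two_rpow 8 (by norm_num)
  obtain ⟨n₁, hn₁⟩ := eventually_atTop.1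
    ((hsmall.and eventually_ncard_not_isGenSplit_le).and (eventually_ge_atTop 3))
  set M : ℝ := 5 + ∑ k ∈ Finset.range n₁, (c5count k : ℝ) with hM
  have hM5 : 5 ≤ M := le_add_of_nonneg_right (Finset.sum_nonneg fun _ _ => Nat.cast_nonneg _)
  refine ⟨M, by linarith, fun n => ?_⟩
  induction n using Nat.strong_induction_on with
  | _ n ih =>
    have hL : (1 : ℝ) ≤ scrL n := by exact_mod_cast one_le_scrL n
    rcases lt_or_ge n n₁ with hn | hn
    · have h1 : (c5count n : ℝ) ≤ ∑ k ∈ Finset.range n₁, (c5count k : ℝ) :=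
        Finset.single_le_sum (f := fun k => (c5count k : ℝ)) (fun _ _ => Nat.cast_nonneg _)
          (Finset.mem_range.2 hn)
      have h2 : M * 1 ≤ M * scrL n := by gcongr
      linarith
    · obtain ⟨⟨h1, h2⟩, h3⟩ := hn₁ n hn
      have h3' : (3 : ℝ) ≤ n := by exact_mod_cast h3
      have hq : (2 : ℝ) ^ (-((n : ℝ) / 20000)) ≤ 1 / 130 := by
        rw [Real.rpow_neg (by norm_num), ← one_div]
        refine one_div_le_one_div_of_le (by norm_num) ?_
        calc (130 : ℝ) ≤ (3 + 2) ^ 8 := by norm_num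
          _ ≤ ((n : ℝ) + 2) ^ 8 := by gcongr
          _ ≤ _ := h1
          _ = _ := by congr 1; ring
      have h4 : (c5count n : ℝ) ≤ {G : SimpleGraph (Fin n) | IsGenSplit G}.ncard +
          {G : SimpleGraph (Fin n) | C5Free G ∧ ¬IsGenSplit G}.ncard := by
        refine (Nat.cast_le (α := ℝ).2 ((Set.ncard_le_ncard (fun G hG => ?_) (Set.toFinite _)).trans
          (Set.ncard_union_le _ _))).trans_eq (Nat.cast_add _ _)
        by_cases h : IsGenSplit G
        · exact .inl h
        · exact .inr ⟨hG, h⟩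
      have h5 : ({G : SimpleGraph (Fin n) | IsGenSplit G}.ncard : ℝ) ≤ 2 * scrL n := by
        have := ncard_isGenSplit_le (Fin n)
        rw [Fintype.card_fin] at this
        exact_mod_cast this
      have h6 := two_rpow_mul_scrL_le n h3
      have h7 : (2 : ℝ) ^ ((3 / 2 : ℝ) * n) * c5count (n - 3) ≤ 64 * M * scrL n := by
        calc _ ≤ (2 : ℝ) ^ ((3 / 2 : ℝ) * n) * (M * scrL (n - 3)) := by
              gcongr; exact ih _ (by omega)
          _ = M * (2 ^ ((3 / 2 : ℝ) * n) * scrL (n - 3)) := by ring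
          _ ≤ M * (64 * scrL n) := by gcongr
          _ = _ := by ring
      have h8 : (2 : ℝ) ^ (-((n : ℝ) / 20000)) * (scrL n + 2 ^ ((3 / 2 : ℝ) * n) * c5count (n - 3)) ≤
          1 / 130 * (scrL n + 64 * M * scrL n) := by gcongr
      nlinarith

theorem exists_few_not_isGenSplit : ∃ κ : ℝ, 0 < κ ∧ ∀ᶠ n : ℕ in atTop,
    ({G : SimpleGraph (Fin n) | C5Free G ∧ ¬IsGenSplit G}.ncard : ℝ) ≤ 2 ^ (-(κ * n)) * scrL n := by
  obtain ⟨M, hM, hf⟩ := exists_c5count_le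
  refine ⟨1 / 40000, by norm_num, ?_⟩
  filter_upwards [eventually_ncard_not_isGenSplit_le, eventually_ge_atTop 3,
    eventually_pow_le_two_rpow 1 (δ := 1 / 40000) (by norm_num),
    eventually_ge_atTop ⌈1 + 64 * M⌉₊] with n h1 h2 h3 h4
  have h4' : 1 + 64 * M ≤ n := (Nat.le_ceil _).trans (by exact_mod_cast h4)
  have h6 := two_rpow_mul_scrL_le n h2
  have h7 : (2 : ℝ) ^ ((3 / 2 : ℝ) * n) * c5count (n - 3) ≤ 64 * M * scrL n := by
    calc _ ≤ (2 : ℝ) ^ ((3 / 2 : ℝ) * n) * (M * scrL (n - 3)) := by gcongr; exact hf _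
      _ = M * (2 ^ ((3 / 2 : ℝ) * n) * scrL (n - 3)) := by ring
      _ ≤ M * (64 * scrL n) := by gcongr
      _ = _ := by ring
  calc _ ≤ 2 ^ (-((n : ℝ) / 20000)) * (scrL n + 64 * M * scrL n) := h1.trans (by gcongr)
    _ = 2 ^ (-((n : ℝ) / 20000)) * (1 + 64 * M) * scrL n := by ring
    _ ≤ 2 ^ (-((n : ℝ) / 20000)) * 2 ^ (1 / 40000 * n : ℝ) * scrL n := by
      gcongr
      linarith [pow_one ((n : ℝ) + 2)]
    _ = _ := by
      rw [← Real.rpow_add (by norm_num)]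
      congr 2; ring

theorem ncard_arrangements_le_of_crossEdges {V : Type} [Fintype V] [DecidableEq V] (C : Finset V)
    (S : Set (SimpleGraph V)) (T : Set (Finset (V × V)))
    (hS : ∀ G ∈ S, IsUnipolarArrangement G (C : Set V)) (hT : ∀ G ∈ S, crossEdges G (C ×ˢ Cᶜ) ∈ T) :
    (S.ncard : ℝ) ≤ (Fintype.card V : ℝ) ^ Fintype.card V * T.ncard := by
  have h := ncard_exists_le (ι := V → V) (α := SimpleGraph V)
    (fun r G => G ∈ S ∧ ∀ x ∉ C, ∀ y ∉ C, x ≠ y → (G.Adj x y ↔ r x = r y)) T.ncard (fun r => by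
      rw [Nat.cast_le]
      refine Set.ncard_le_ncard_of_injOn (fun G => crossEdges G (C ×ˢ Cᶜ)) (fun G hG => hT G hG.1) ?_
        (Set.toFinite _)
      rintro G ⟨hG, hG'⟩ H ⟨hH, hH'⟩ he
      have key : ∀ x ∈ C, ∀ y ∉ C, (G.Adj x y ↔ H.Adj x y) := by
        intro x hx y hy
        have := Finset.ext_iff.1 he (x, y)
        simpa [crossEdges, hx, hy] using this
      have hc1 := ((isUnipolarArrangement_iff _ _).1 (hS G hG)).1
      have hc2 := ((isUnipolarArrangement_iff _ _).1 (hS H hH)).1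
      ext x y
      by_cases hne : x = y
      · simp [hne]
      by_cases hx : x ∈ C <;> by_cases hy : y ∈ C
      · exact iff_of_true (hc1 hx hy hne) (hc2 hx hy hne)
      · exact key x hx y hy
      · rw [G.adj_comm, H.adj_comm]; exact key y hy x hx
      · rw [hG' x hx y hy hne, hH' x hx y hy hne])
  rw [Fintype.card_fun] at h
  push_cast at h
  refine le_trans ?_ h
  rw [Nat.cast_le]
  refine Set.ncard_le_ncard (fun G hG => ?_) (Set.toFinite _)
  have hfree := ((isUnipolarArrangement_iff _ _).1 (hS G hG)).2
  let s : Setoid V :=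
    { r := fun x y => x = y ∨ x ∉ C ∧ y ∉ C ∧ G.Adj x y
      iseqv :=
        { refl := fun x => .inl rfl
          symm := by
            rintro x y (rfl | ⟨h1, h2, h3⟩)
            · exact .inl rfl
            · exact .inr ⟨h2, h1, h3.symm⟩
          trans := by
            rintro x y z (rfl | ⟨h1, h2, h3⟩) (rfl | ⟨h4, h5, h6⟩)
            · exact .inl rfl
            · exact .inr ⟨h4, h5, h6⟩
            · exact .inr ⟨h1, h2, h3⟩
            · by_cases hxz : x = z
              · exact .inl hxz
              · exact .inr ⟨h1, h5, hfree x (by simpa using h1) y (by simpa using h2) z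
                  (by simpa using h5) h3 h6 hxz⟩ } }
  refine ⟨fun x => (Quotient.mk s x).out, hG, fun x hx y hy hne => ?_⟩
  simp only [Quotient.out_inj, Quotient.eq]
  change _ ↔ (x = y ∨ x ∉ C ∧ y ∉ C ∧ G.Adj x y)
  simp [hne, hx, hy]

theorem ncard_pairs_eq_sum {α β : Type*} [Finite α] [Fintype β] (P : α → β → Prop) :
    {p : α × β | P p.1 p.2}.ncard = ∑ b, {a | P a b}.ncard := by
  have := Fintype.ofFinite α
  rw [Set.ncard_eq_toFinset_card', Finset.card_eq_sum_card_fiberwise (f := Prod.snd)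
    (t := Finset.univ) (fun _ _ => by simp)]
  refine Finset.sum_congr rfl fun b _ => ?_
  rw [Set.ncard_eq_toFinset_card']
  refine Finset.card_bij (fun p _ => p.1) ?_ ?_ ?_
  · rintro ⟨a, b'⟩ h
    simp only [Finset.mem_filter, Set.mem_toFinset, Set.mem_ofPred_eq] at h ⊢
    obtain ⟨h1, rfl⟩ := h
    exact h1
  · rintro ⟨a, b₁⟩ h ⟨a', b₂⟩ h' rfl
    simp only [Finset.mem_filter] at h h'
    rw [h.2, h'.2]
  · intro a ha
    refine ⟨(a, b), ?_, rfl⟩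
    simp only [Finset.mem_filter, Set.mem_toFinset, Set.mem_ofPred_eq] at ha ⊢
    exact ⟨ha, trivial⟩

theorem ncard_pairs_eq_sum' {α β : Type*} [Fintype α] [Finite β] (P : α → β → Prop) :
    {p : α × β | P p.1 p.2}.ncard = ∑ a, {b | P a b}.ncard := by
  rw [← ncard_pairs_eq_sum (fun b a => P a b)]
  exact Set.ncard_congr (fun p _ => p.swap) (fun _ h => h)
    (fun p q _ _ h => Prod.swap_injective h) (fun p h => ⟨p.swap, h, Prod.swap_swap p⟩)

/-- The central clique has size about `n / 2` and its edges to the outside look random. -/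
def GenericCut {V : Type*} [Fintype V] [DecidableEq V] (G : SimpleGraph V) (C : Finset V) (γ d : ℝ) : Prop :=
  |(C.card : ℝ) - (Fintype.card V : ℝ) / 2| ≤ γ * Fintype.card V ∧ PR G C Cᶜ (γ * Fintype.card V) d

theorem exists_few_not_genericCut : ∃ d : ℝ, 0 < d ∧ d < 1 ∧ ∀ γ : ℝ, 0 < γ → ∀ K : ℝ, ∀ᶠ n : ℕ in atTop,
    ({p : SimpleGraph (Fin n) × Finset (Fin n) | IsUnipolarArrangement p.1 (p.2 : Set (Fin n)) ∧
      ¬GenericCut p.1 p.2 γ d}.ncard : ℝ) ≤ 2 ^ (-(K * n)) * scrL n := by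
  obtain ⟨d, hd, hd1, Hd⟩ := exists_few_not_PR
  refine ⟨d, hd, hd1, fun γ hγ K => ?_⟩
  filter_upwards [eventually_two_rpow_le_scrL (c := γ ^ 2 / 4) (by positivity) K,
    eventually_pow_le_two_rpow 1 (δ := γ ^ 2 / 8) (by positivity),
    eventually_ge_atTop ⌈32 / γ ^ 2⌉₊, eventually_ge_atTop 1] with n hL hp hn hn1
  refine le_trans ?_ hL
  have hn' : 32 / γ ^ 2 ≤ n := (Nat.le_ceil _).trans (by exact_mod_cast hn)
  have hn1' : (1 : ℝ) ≤ n := by exact_mod_cast hn1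
  rw [div_le_iff₀ (by positivity)] at hn'
  have hnn : (n : ℝ) ^ n ≤ 2 ^ (γ ^ 2 / 8 * n ^ 2 : ℝ) := by
    calc (n : ℝ) ^ n ≤ (2 ^ (γ ^ 2 / 8 * n : ℝ)) ^ n := by
          gcongr
          linarith [pow_one ((n : ℝ) + 2)]
      _ = _ := by
          rw [← Real.rpow_mul_natCast (by norm_num)]; congr 1; ring
  have key : ∀ C : Finset (Fin n), ({G : SimpleGraph (Fin n) | IsUnipolarArrangement G (C : Set (Fin n)) ∧
      ¬GenericCut G C γ d}.ncard : ℝ) ≤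
      2 ^ (γ ^ 2 / 8 * n ^ 2 + (2 * n + 1 + (1 / 4 - γ ^ 2 / 2) * n ^ 2) : ℝ) := by
    intro C
    suffices h : ∃ T : Set (Finset (Fin n × Fin n)),
        (∀ G : SimpleGraph (Fin n), ¬GenericCut G C γ d → crossEdges G (C ×ˢ Cᶜ) ∈ T) ∧
        (T.ncard : ℝ) ≤ 2 ^ (2 * n + 1 + (1 / 4 - γ ^ 2 / 2) * n ^ 2 : ℝ) by
      obtain ⟨T, h1, h2⟩ := h
      have := ncard_arrangements_le_of_crossEdges C {G : SimpleGraph (Fin n) |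
        IsUnipolarArrangement G (C : Set (Fin n)) ∧ ¬GenericCut G C γ d} T (fun G hG => hG.1)
        (fun G hG => h1 G hG.2)
      rw [Fintype.card_fin] at this
      refine this.trans ?_
      rw [Real.rpow_add (by norm_num)]
      gcongr
    by_cases hs : |(C.card : ℝ) - (Fintype.card (Fin n) : ℝ) / 2| ≤ γ * Fintype.card (Fin n)
    · refine ⟨{X | ∃ G : SimpleGraph (Fin n), ¬PR G C Cᶜ (γ * Fintype.card (Fin n)) d ∧
        crossEdges G (C ×ˢ Cᶜ) = X}, fun G hG => ⟨G, fun h => hG ⟨hs, h⟩, rfl⟩, (Hd C Cᶜ _ (by positivity)).trans ?_⟩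
      refine Real.rpow_le_rpow_of_exponent_le (by norm_num) ?_
      have := card_mul_card_compl_le' C
      rw [Fintype.card_fin] at this ⊢
      linarith [mul_pow γ (n : ℝ) 2]
    · refine ⟨{X | X ⊆ C ×ˢ Cᶜ}, fun G _ => Finset.filter_subset _ _, ?_⟩
      rw [ncard_subsets, Finset.card_product]
      push_cast
      rw [← Real.rpow_natCast]
      refine Real.rpow_le_rpow_of_exponent_le (by norm_num) ?_
      have := card_mul_card_compl_le C hγ.le hs
      rw [Fintype.card_fin] at this
      push_cast
      have : 0 ≤ γ ^ 2 * (n : ℝ) ^ 2 := by positivity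
      linarith
  rw [ncard_pairs_eq_sum (fun (G : SimpleGraph (Fin n)) (C : Finset (Fin n)) =>
    IsUnipolarArrangement G (C : Set (Fin n)) ∧ ¬GenericCut G C γ d)]
  push_cast
  refine (Finset.sum_le_sum fun C _ => key C).trans ?_
  rw [Finset.sum_const, Finset.card_univ, Fintype.card_finset, Fintype.card_fin, nsmul_eq_mul]
  push_cast
  rw [← Real.rpow_natCast, ← Real.rpow_add (by norm_num)]
  refine Real.rpow_le_rpow_of_exponent_le (by norm_num) ?_
  have : 32 * (n : ℝ) ≤ n * γ ^ 2 * n := by gcongr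
  linarith

/-- The graph `G` with the neighbourhood of `v` replaced by `X \ {v}`. -/
def setNbr {V : Type*} (G : SimpleGraph V) (v : V) (X : Set V) : SimpleGraph V where
  Adj x y := x ≠ y ∧ if x = v then y ∈ X else if y = v then x ∈ X else G.Adj x y
  symm := ⟨by
    rintro x y ⟨hne, h⟩
    refine ⟨hne.symm, ?_⟩
    by_cases hx : x = v <;> by_cases hy : y = v
    · exact absurd (hx.trans hy.symm) hne
    · simpa [hx, hy] using h
    · simpa [hx, hy] using h
    · simpa [hx, hy, G.adj_comm] using h⟩
  loopless := ⟨fun x h => h.1 rfl⟩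

theorem setNbr_adj_left {V : Type*} {G : SimpleGraph V} {v y : V} {X : Set V} (h : y ≠ v) :
    (setNbr G v X).Adj v y ↔ y ∈ X := by
  simp [setNbr, h.symm]

theorem setNbr_adj_right {V : Type*} {G : SimpleGraph V} {v y : V} {X : Set V} (h : y ≠ v) :
    (setNbr G v X).Adj y v ↔ y ∈ X := by
  rw [SimpleGraph.adj_comm, setNbr_adj_left h]

theorem setNbr_adj {V : Type*} {G : SimpleGraph V} {v x y : V} {X : Set V} (hx : x ≠ v) (hy : y ≠ v) :
    (setNbr G v X).Adj x y ↔ G.Adj x y := by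
  simp only [setNbr, hx, hy, if_false, and_iff_right_iff_imp]
  exact fun h => h.ne

/-- `v` is adjacent to almost all of the central clique, but is not in it. -/
def NearlyCentral {V : Type*} (G : SimpleGraph V) (C : Finset V) (v : V) (η : ℝ) : Prop :=
  v ∉ C ∧ ((C.filter fun w => ¬G.Adj v w).card : ℝ) ≤ η * C.card

theorem ncard_nearlyCentral_mul_le {V : Type} [Fintype V] [DecidableEq V] (C : Finset V) (v : V) (η : ℝ) :
    {G : SimpleGraph V | IsUnipolarArrangement G (C : Set V) ∧ NearlyCentral G C v η}.ncard * 2 ^ C.card ≤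
      {G : SimpleGraph V | IsUnipolarArrangement G (C : Set V)}.ncard *
        (C.powerset.filter fun Y => (Y.card : ℝ) ≤ η * C.card).card := by
  set F := C.powerset.filter fun Y => (Y.card : ℝ) ≤ η * C.card
  have h1 : (C.powerset : Set (Finset V)).ncard = 2 ^ C.card := by
    rw [Set.ncard_coe_finset, Finset.card_powerset]
  rw [← h1, ← Set.ncard_coe_finset F, ← Set.ncard_prod, ← Set.ncard_prod]
  by_cases hv : v ∈ C
  · rw [show {G : SimpleGraph V | IsUnipolarArrangement G (C : Set V) ∧ NearlyCentral G C v η} = ∅ from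
      Set.eq_empty_of_forall_notMem fun G hG => hG.2.1 hv]
    simp
  refine Set.ncard_le_ncard_of_injOn (fun p => (setNbr p.1 v ((p.2 : Set V) ∪ {w | w ∉ C ∧ p.1.Adj v w}),
    C.filter fun w => ¬p.1.Adj v w)) ?_ ?_ (Set.toFinite _)
  · rintro ⟨G, X⟩ ⟨⟨hG, h2⟩, hX⟩
    have hX : X ⊆ C := by simpa using hX
    refine ⟨?_, ?_⟩
    · obtain ⟨hc, hfree⟩ := (isUnipolarArrangement_iff _ _).1 hG
      have key : ∀ x ∉ C, ∀ y ∉ C, ((setNbr G v ((X : Set V) ∪ {w | w ∉ C ∧ G.Adj v w})).Adj x y ↔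
          G.Adj x y) := by
        intro x hx y hy
        by_cases hne : x = y
        · simp [hne]
        by_cases hxv : x = v
        · subst hxv
          rw [setNbr_adj_left (Ne.symm hne)]
          have : y ∉ X := fun h => hy (hX h)
          simp [hy, this]
        by_cases hyv : y = v
        · subst hyv
          rw [setNbr_adj_right hne, G.adj_comm]
          have : x ∉ X := fun h => hx (hX h)
          simp [hx, this]
        exact setNbr_adj hxv hyv
      refine (isUnipolarArrangement_iff _ _).2 ⟨fun x hx y hy hne => ?_, fun x hx y hy z hz h1 h2 hne => ?_⟩
      · rw [setNbr_adj (fun h : x = v => hv (h ▸ Finset.mem_coe.1 hx))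
          (fun h : y = v => hv (h ▸ Finset.mem_coe.1 hy))]
        exact hc hx hy hne
      · have hx' : x ∉ C := by simpa using hx
        have hy' : y ∉ C := by simpa using hy
        have hz' : z ∉ C := by simpa using hz
        rw [key x hx' y hy'] at h1
        rw [key y hy' z hz'] at h2
        rw [key x hx' z hz']
        exact hfree x hx y hy z hz h1 h2 hne
    · simp only [F, Finset.coe_filter, Finset.mem_powerset, Set.mem_ofPred_eq]
      exact ⟨Finset.filter_subset _ _, h2.2⟩
  · rintro ⟨G, X⟩ ⟨hG, hX⟩ ⟨G', X'⟩ ⟨hG', hX'⟩ he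
    have hX : X ⊆ C := by simpa using hX
    have hX' : X' ⊆ C := by simpa using hX'
    simp only [Prod.mk.injEq] at he
    obtain ⟨he1, he2⟩ := he
    have hnb : ∀ y ≠ v, (y ∈ (X : Set V) ∪ {w | w ∉ C ∧ G.Adj v w} ↔
        y ∈ (X' : Set V) ∪ {w | w ∉ C ∧ G'.Adj v w}) := by
      intro y hy
      rw [← setNbr_adj_left (G := G) hy, he1, setNbr_adj_left hy]
    have hXX : X = X' := by
      ext y
      by_cases hy : y ∈ C
      · have := hnb y (fun h => hv (h ▸ hy))
        simpa [hy] using this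
      · exact iff_of_false (fun h => hy (hX h)) (fun h => hy (hX' h))
    have hGv : ∀ y, G.Adj v y ↔ G'.Adj v y := by
      intro y
      by_cases hyv : y = v
      · simp [hyv]
      by_cases hy : y ∈ C
      · have := Finset.ext_iff.1 he2 y
        simp only [Finset.mem_filter, hy, true_and] at this
        exact not_iff_not.1 this
      · have h3 : y ∉ X := fun h => hy (hX h)
        have h4 : y ∉ X' := fun h => hy (hX' h)
        have := hnb y hyv
        simpa [hy, h3, h4] using this
    refine Prod.ext ?_ hXX
    ext x y
    change G.Adj x y ↔ G'.Adj x y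
    by_cases hx : x = v
    · subst hx; exact hGv y
    by_cases hy : y = v
    · subst hy; rw [G.adj_comm, G'.adj_comm]; exact hGv x
    · rw [← setNbr_adj (G := G) hx hy, he1, setNbr_adj hx hy]

theorem card_sdiff_lt_of_genericCut {V : Type*} [Fintype V] [DecidableEq V] {G : SimpleGraph V}
    {C C' : Finset V} {γ d : ℝ} {t : ℕ} (hd : 0 < d) (hn : 0 < γ * Fintype.card V)
    (hC : IsUnipolarArrangement G (C : Set V)) (hC' : IsUnipolarArrangement G (C' : Set V))
    (hg : GenericCut G C γ d) (hg' : GenericCut G C' γ d) (ht : 3 * (γ * Fintype.card V) ≤ 2 * t)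
    (hdeg : ¬IsDegenerate G t) : ((C' \ C).card : ℝ) < γ * Fintype.card V := by
  obtain ⟨hc, hf⟩ := (isUnipolarArrangement_iff _ _).1 hC
  obtain ⟨hc', hf'⟩ := (isUnipolarArrangement_iff _ _).1 hC'
  by_contra! h1
  rcases lt_or_ge ((C ∩ C').card : ℝ) (γ * Fintype.card V) with h2 | h2
  · refine hdeg ⟨C, ⟨.inl (IsClique.p3Free hc), .inl (.of_isClique hc t)⟩, .inl hf, .inl ⟨Cᶜ \ C', ?_, ?_⟩⟩
    · have e1 := Finset.card_sdiff_add_card_inter C' C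
      have e2 := Finset.card_sdiff_add_card_inter Cᶜ C'
      have e3 : Cᶜ ∩ C' = C' \ C := by ext; simp [and_comm]
      have e4 := Finset.card_add_card_compl C
      have a1 := abs_le.1 hg.1
      have a2 := abs_le.1 hg'.1
      rw [e3] at e2
      rw [Finset.inter_comm] at e1
      have e1' : ((C' \ C).card : ℝ) + (C ∩ C').card = C'.card := by exact_mod_cast e1
      have e2' : ((Cᶜ \ C').card : ℝ) + (C' \ C).card = Cᶜ.card := by exact_mod_cast e2
      have e4' : (C.card : ℝ) + Cᶜ.card = Fintype.card V := by exact_mod_cast e4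
      have : ((Cᶜ \ C').card : ℝ) ≤ 2 * t := by linarith [a1.1, a2.1]
      exact_mod_cast this
    · refine hc'.subset fun x hx => ?_
      simp only [Finset.coe_sdiff, Finset.coe_compl, Set.mem_sdiff, Set.mem_compl_iff, not_and, not_not] at hx
      exact hx.2 hx.1
  · have h := hg.2 (C ∩ C') Finset.inter_subset_left (C' \ C)
      (fun x hx => by simp only [Finset.mem_sdiff] at hx; simpa using hx.2) h2 h1 false
    rw [Finset.filter_false_of_mem, Finset.card_empty, Nat.cast_zero] at h
    · have : 0 < d * (C ∩ C').card * (C' \ C).card := by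
        have := hn.trans_le h1
        have := hn.trans_le h2
        positivity
      linarith
    · rintro ⟨x, y⟩ hxy
      simp only [Finset.mem_product, Finset.mem_inter, Finset.mem_sdiff] at hxy
      have := hc' hxy.1.2 hxy.2.1 (fun h => hxy.2.2 (h ▸ hxy.1.1))
      simp [this]

theorem exists_nearlyCentral {V : Type*} [Fintype V] [DecidableEq V] {G : SimpleGraph V}
    {C C' : Finset V} {γ d η : ℝ} {t : ℕ} (hd : 0 < d) (hn : 0 < γ * Fintype.card V)
    (hC : IsUnipolarArrangement G (C : Set V)) (hC' : IsUnipolarArrangement G (C' : Set V))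
    (hg : GenericCut G C γ d) (hg' : GenericCut G C' γ d) (ht : 3 * (γ * Fintype.card V) ≤ 2 * t)
    (hdeg : ¬IsDegenerate G t) (hη : γ * Fintype.card V ≤ η * C.card) (hsub : ¬C' ⊆ C) :
    ∃ v, NearlyCentral G C v η := by
  obtain ⟨v, hv, hvC⟩ := Finset.not_subset.1 hsub
  refine ⟨v, hvC, le_trans (le_trans ?_ (card_sdiff_lt_of_genericCut hd hn hC' hC hg' hg ht hdeg).le) hη⟩
  rw [Nat.cast_le]
  refine Finset.card_le_card fun w hw => ?_
  simp only [Finset.mem_filter, Finset.mem_sdiff] at hw ⊢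
  refine ⟨hw.1, fun hwC' => hw.2 ?_⟩
  exact ((isUnipolarArrangement_iff _ _).1 hC').1 hv hwC' (fun h => hvC (h ▸ hw.1))

theorem not_isUnipolarArrangement_compl {V : Type*} [Fintype V] [DecidableEq V] {G : SimpleGraph V}
    {C I : Finset V} {γ d : ℝ} {t : ℕ} (hC : IsUnipolarArrangement G (C : Set V))
    (hg : GenericCut G C γ d) (hg' : GenericCut Gᶜ I γ d) (ht : 2 * (γ * Fintype.card V) + 1 ≤ 2 * t)
    (hdeg : ¬IsDegenerate G t) : ¬IsUnipolarArrangement Gᶜ (I : Set V) := by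
  intro hI
  obtain ⟨hc, hf⟩ := (isUnipolarArrangement_iff _ _).1 hC
  have hi := ((isUnipolarArrangement_iff _ _).1 hI).1
  refine hdeg ⟨C, ⟨.inl (IsClique.p3Free hc), .inl (.of_isClique hc t)⟩, .inl hf, .inr ⟨Cᶜ \ I, ?_, ?_⟩⟩
  · have h1 : (C ∩ I).card ≤ 1 := by
      refine Finset.card_le_one.2 fun x hx y hy => ?_
      by_contra hne
      simp only [Finset.mem_inter] at hx hy
      exact ((G.compl_adj x y).1 (hi hx.2 hy.2 hne)).2 (hc hx.1 hy.1 hne)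
    have e1 := Finset.card_sdiff_add_card_inter I C
    have e2 := Finset.card_sdiff_add_card_inter Cᶜ I
    have e3 : Cᶜ ∩ I = I \ C := by ext; simp [and_comm]
    have e4 := Finset.card_add_card_compl C
    have a1 := abs_le.1 hg.1
    have a2 := abs_le.1 hg'.1
    rw [e3] at e2
    rw [Finset.inter_comm] at e1
    have h1' : ((C ∩ I).card : ℝ) ≤ 1 := by exact_mod_cast h1
    have e1' : ((I \ C).card : ℝ) + (C ∩ I).card = I.card := by exact_mod_cast e1
    have e2' : ((Cᶜ \ I).card : ℝ) + (I \ C).card = Cᶜ.card := by exact_mod_cast e2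
    have e4' : (C.card : ℝ) + Cᶜ.card = Fintype.card V := by exact_mod_cast e4
    have : ((Cᶜ \ I).card : ℝ) ≤ 2 * t := by linarith [a1.1, a2.1]
    exact_mod_cast this
  · refine hi.subset fun x hx => ?_
    simp only [Finset.coe_sdiff, Finset.coe_compl, Set.mem_sdiff, Set.mem_compl_iff, not_and, not_not] at hx
    exact hx.2 hx.1

def centralCliques {V : Type*} (G : SimpleGraph V) : Set (Finset V) :=
  {C | IsUnipolarArrangement G (C : Set V)}

def nearlyCentralCliques {V : Type*} [Fintype V] (G : SimpleGraph V) (η : ℝ) : Set (Finset V) :=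
  {C | IsUnipolarArrangement G (C : Set V) ∧ (Fintype.card V : ℝ) / 3 ≤ C.card ∧
    ∃ v, NearlyCentral G C v η}

theorem natCard_eq_ncard_centralCliques {V : Type*} [Fintype V] (G : SimpleGraph V) :
    Nat.card {C : Set V // IsUnipolarArrangement G C} = (centralCliques G).ncard := by
  rw [← Nat.card_coe_set_eq]
  refine Nat.card_congr ⟨fun C => ⟨C.1.toFinset, by simpa [centralCliques] using C.2⟩,
    fun C => ⟨C.1, C.2⟩, fun C => Subtype.ext (by simp), fun C => Subtype.ext (by simp)⟩

theorem genR_eq {n : ℕ} (G : SimpleGraph (Fin n)) :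
    genR G = (centralCliques G).ncard + (centralCliques Gᶜ).ncard := by
  rw [genR, natCard_eq_ncard_centralCliques, natCard_eq_ncard_centralCliques]

theorem ncard_centralCliques_le_two_pow {V : Type*} [Fintype V] (G : SimpleGraph V) :
    (centralCliques G).ncard ≤ 2 ^ Fintype.card V := by
  rw [← Fintype.card_finset, ← Nat.card_eq_fintype_card]
  exact Set.ncard_le_card _

theorem sum_compl {V : Type*} [Fintype (SimpleGraph V)] (f : SimpleGraph V → ℕ) : ∑ G : SimpleGraph V, f Gᶜ = ∑ G, f G :=
  Equiv.sum_comp (compl_involutive.toPerm (compl : SimpleGraph V → _)) f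

theorem sum_genR (n : ℕ) : ∑ G : SimpleGraph (Fin n), genR G = 2 * scrL n := by
  simp only [genR_eq, Finset.sum_add_distrib]
  have h1 : ∑ G : SimpleGraph (Fin n), (centralCliques G).ncard = scrL n := by
    have := ncard_arrangements (Fin n)
    rw [Fintype.card_fin] at this
    rw [← this]
    exact (ncard_pairs_eq_sum' fun (G : SimpleGraph (Fin n)) (C : Finset (Fin n)) =>
      IsUnipolarArrangement G (C : Set (Fin n))).symm
  rw [sum_compl fun G => (centralCliques G).ncard, h1]
  ring

theorem ncard_centralCliques_le {V : Type*} [Fintype V] [DecidableEq V] {G : SimpleGraph V}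
    {γ d η : ℝ} {t : ℕ} (hd : 0 < d) (hn : 0 < γ * Fintype.card V)
    (hg : ∀ C : Finset V, IsUnipolarArrangement G (C : Set V) → GenericCut G C γ d)
    (ht : 3 * (γ * Fintype.card V) ≤ 2 * t) (hdeg : ¬IsDegenerate G t) (hη0 : 0 ≤ η)
    (hη : γ ≤ η / 3) (hγ : γ ≤ 1 / 6) :
    (centralCliques G).ncard ≤ (nearlyCentralCliques G η).ncard + 1 := by
  have hlarge : ∀ C : Finset V, IsUnipolarArrangement G (C : Set V) → (Fintype.card V : ℝ) / 3 ≤ C.card := by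
    intro C hC
    have h1 := (abs_le.1 (hg C hC).1).1
    have h2 : γ * Fintype.card V ≤ 1 / 6 * Fintype.card V := by gcongr
    linarith
  have key : ∀ C ∈ centralCliques G \ nearlyCentralCliques G η,
      ∀ C' ∈ centralCliques G \ nearlyCentralCliques G η, C' ⊆ C := by
    rintro C ⟨hC, hC1⟩ C' ⟨hC', -⟩
    by_contra hsub
    have h1 := hlarge C hC
    refine hC1 ⟨hC, h1, exists_nearlyCentral hd hn hC hC' (hg C hC) (hg C' hC') ht hdeg ?_ hsub⟩
    calc γ * Fintype.card V ≤ η / 3 * Fintype.card V := by gcongr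
      _ = η * ((Fintype.card V : ℝ) / 3) := by ring
      _ ≤ _ := by gcongr
  have h1 : (centralCliques G \ nearlyCentralCliques G η).ncard ≤ 1 :=
    (Set.ncard_le_one (Set.toFinite _)).2 fun C hC C' hC' =>
      (key C' hC' C hC).antisymm (key C hC C' hC')
  have h2 := (Set.ncard_le_ncard (Set.subset_sdiff_union (centralCliques G) (nearlyCentralCliques G η))
    (Set.toFinite _)).trans (Set.ncard_union_le _ _)
  omega

theorem sum_nearlyCentralCliques_le {η : ℝ}
    (H : ∀ {β : Type} (R : Finset β), ((R.powerset.filter fun Y => (Y.card : ℝ) ≤ η * R.card).card : ℝ) ≤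
      2 ^ ((1 / 10 : ℝ) * R.card)) (n : ℕ) :
    ((∑ G : SimpleGraph (Fin n), (nearlyCentralCliques G η).ncard : ℕ) : ℝ) ≤
      n * 2 ^ (-(3 / 10 * n : ℝ)) * scrL n := by
  have h1 := ncard_arrangements (Fin n)
  rw [Fintype.card_fin] at h1
  rw [← h1, arrangements, ncard_pairs_eq_sum fun (G : SimpleGraph (Fin n)) (C : Finset (Fin n)) =>
      IsUnipolarArrangement G (C : Set (Fin n))]
  have h2 : ∑ G : SimpleGraph (Fin n), (nearlyCentralCliques G η).ncard =
      ∑ C : Finset (Fin n), {G : SimpleGraph (Fin n) | C ∈ nearlyCentralCliques G η}.ncard :=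
    (ncard_pairs_eq_sum' fun (G : SimpleGraph (Fin n)) (C : Finset (Fin n)) =>
      C ∈ nearlyCentralCliques G η).symm.trans (ncard_pairs_eq_sum fun (G : SimpleGraph (Fin n))
        (C : Finset (Fin n)) => C ∈ nearlyCentralCliques G η)
  rw [h2]
  push_cast
  rw [Finset.mul_sum]
  refine Finset.sum_le_sum fun C _ => ?_
  by_cases hC : (n : ℝ) / 3 ≤ C.card
  · have h3 := ncard_exists_le (fun (v : Fin n) (G : SimpleGraph (Fin n)) =>
      IsUnipolarArrangement G (C : Set (Fin n)) ∧ NearlyCentral G C v η)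
      (2 ^ (-(3 / 10 * n : ℝ)) * {G : SimpleGraph (Fin n) |
        IsUnipolarArrangement G (C : Set (Fin n))}.ncard) fun v => by
      have h4 : (_ : ℝ) ≤ _ := Nat.cast_le.2 (ncard_nearlyCentral_mul_le C v η)
      push_cast at h4
      have h5 := h4.trans (mul_le_mul_of_nonneg_left (H C) (Nat.cast_nonneg _))
      rw [← Real.rpow_natCast, ← le_div_iff₀ (by positivity), mul_div_assoc,
        ← Real.rpow_sub (by norm_num)] at h5
      refine h5.trans ?_
      rw [mul_comm]
      gcongr
      · norm_num
      · linarith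
    rw [Fintype.card_fin] at h3
    rw [mul_assoc]
    refine le_trans ?_ h3
    rw [Nat.cast_le]
    refine Set.ncard_le_ncard ?_ (Set.toFinite _)
    rintro G ⟨a1, a2, v, a3⟩
    exact ⟨v, a1, a3⟩
  · rw [show {G : SimpleGraph (Fin n) | C ∈ nearlyCentralCliques G η} = ∅ from
      Set.eq_empty_of_forall_notMem fun G hG => hC (by simpa using hG.2.1), Set.ncard_empty, Nat.cast_zero]
    positivity

theorem exists_sum_genR_sub_one_le : ∃ κ : ℝ, 0 < κ ∧ ∀ᶠ n : ℕ in atTop,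
    ((∑ G : SimpleGraph (Fin n), (genR G - 1) : ℕ) : ℝ) ≤ 2 ^ (-(κ * n)) * scrL n := by
  obtain ⟨η, hη, hη1, Hη⟩ := exists_few_small_subsets (1 / 10) (by norm_num)
  obtain ⟨d, hd, hd1, Hd⟩ := exists_few_not_genericCut
  set γ := min (η / 3) (1 / 200) with hγ'
  have hγ : 0 < γ := by positivity
  have hγ1 : γ ≤ η / 3 := min_le_left _ _
  have hγ2 : γ ≤ 1 / 200 := min_le_right _ _
  refine ⟨1 / 10, by norm_num, ?_⟩
  filter_upwards [Hd γ hγ 2, eventually_ncard_isDegenerate_le 2, eventually_ge_atTop 200,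
    eventually_pow_le_two_rpow 2 (δ := 1 / 10) (by norm_num)] with n hN hD hn hp
  have hn' : (200 : ℝ) ≤ n := by exact_mod_cast hn
  set t := ⌈(n : ℝ) / 100⌉₊ with ht
  have htn : (n : ℝ) / 100 ≤ t := Nat.le_ceil _
  let N : SimpleGraph (Fin n) → Set (Finset (Fin n)) := fun G =>
    {C | IsUnipolarArrangement G (C : Set (Fin n)) ∧ ¬GenericCut G C γ d}
  have hpt : ∀ G : SimpleGraph (Fin n), genR G - 1 ≤ (nearlyCentralCliques G η).ncard +
      (nearlyCentralCliques Gᶜ η).ncard +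
      2 * 2 ^ n * ((if IsDegenerate G t then 1 else 0) + (N G).ncard + (N Gᶜ).ncard) := by
    intro G
    rw [genR_eq]
    have b1 := ncard_centralCliques_le_two_pow G
    have b2 := ncard_centralCliques_le_two_pow Gᶜ
    rw [Fintype.card_fin] at b1 b2
    by_cases hbad : (if IsDegenerate G t then 1 else 0) + (N G).ncard + (N Gᶜ).ncard = 0
    · have hdeg : ¬IsDegenerate G t := by
        intro h; simp [h] at hbad
      have hdeg' : ¬IsDegenerate Gᶜ t := fun h => hdeg h.of_compl
      have n1 : N G = ∅ := (Set.ncard_eq_zero (Set.toFinite _)).1 (by omega)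
      have n2 : N Gᶜ = ∅ := (Set.ncard_eq_zero (Set.toFinite _)).1 (by omega)
      have g1 : ∀ C : Finset (Fin n), IsUnipolarArrangement G (C : Set (Fin n)) → GenericCut G C γ d := by
        intro C hC
        by_contra h
        exact (n1 ▸ (show C ∈ N G from ⟨hC, h⟩) : C ∈ (∅ : Set (Finset (Fin n))))
      have g2 : ∀ C : Finset (Fin n), IsUnipolarArrangement Gᶜ (C : Set (Fin n)) → GenericCut Gᶜ C γ d := by
        intro C hC
        by_contra h
        exact (n2 ▸ (show C ∈ N Gᶜ from ⟨hC, h⟩) : C ∈ (∅ : Set (Finset (Fin n))))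
      have hγn : γ * n ≤ 1 / 200 * n := by gcongr
      have c1 := ncard_centralCliques_le (t := t) hd (by rw [Fintype.card_fin]; positivity) g1
        (by rw [Fintype.card_fin]; linarith) hdeg hη.le hγ1 (by linarith)
      have c2 := ncard_centralCliques_le (t := t) hd (by rw [Fintype.card_fin]; positivity) g2
        (by rw [Fintype.card_fin]; linarith) hdeg' hη.le hγ1 (by linarith)
      have c3 : (centralCliques G).ncard = 0 ∨ (centralCliques Gᶜ).ncard = 0 := by
        by_contra! h
        obtain ⟨C, hC⟩ := Set.nonempty_of_ncard_ne_zero h.1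
        obtain ⟨I, hI⟩ := Set.nonempty_of_ncard_ne_zero h.2
        exact not_isUnipolarArrangement_compl hC (g1 C hC) (g2 I hI)
          (by rw [Fintype.card_fin]; linarith) hdeg hI
      omega
    · have : 2 * 2 ^ n * 1 ≤ 2 * 2 ^ n *
          ((if IsDegenerate G t then 1 else 0) + (N G).ncard + (N Gᶜ).ncard) := by
        gcongr; omega
      omega
  have hsum := Finset.sum_le_sum fun G (_ : G ∈ (Finset.univ : Finset (SimpleGraph (Fin n)))) => hpt G
  simp only [Finset.sum_add_distrib, ← Finset.mul_sum] at hsum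
  rw [sum_compl fun G => (nearlyCentralCliques G η).ncard, sum_compl fun G => (N G).ncard,
    ← Finset.card_filter, ← Set.ncard_coe_finset, Finset.coe_filter_univ,
    show ∑ G, (N G).ncard = _ from (ncard_pairs_eq_sum' fun (G : SimpleGraph (Fin n)) C => C ∈ N G).symm]
    at hsum
  have hS := sum_nearlyCentralCliques_le Hη n
  have hsum' : ((∑ G : SimpleGraph (Fin n), (genR G - 1) : ℕ) : ℝ) ≤ _ := Nat.cast_le.2 hsum
  rw [Nat.cast_add, Nat.cast_add, Nat.cast_mul, Nat.cast_add, Nat.cast_add] at hsum'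
  set L : ℝ := ((scrL n : ℕ) : ℝ)
  have hL : 0 ≤ L := Nat.cast_nonneg _
  set q : ℝ := 2 ^ (-(2 * n : ℝ)) with hq
  have e1 : ((2 * 2 ^ n : ℕ) : ℝ) * q = 2 * 2 ^ (-(n : ℝ)) := by
    push_cast
    rw [← Real.rpow_natCast, mul_assoc, hq, ← Real.rpow_add (by norm_num)]
    congr 2; ring
  have e2 : (2 : ℝ) ^ (-(n : ℝ)) ≤ 2 ^ (-(3 / 10 * n : ℝ)) :=
    Real.rpow_le_rpow_of_exponent_le (by norm_num) (by linarith)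
  have e3 : (2 * (n : ℝ) + 6) * 2 ^ (-(3 / 10 * n : ℝ)) ≤ 2 ^ (-(1 / 10 * n : ℝ)) := by
    have : 2 * (n : ℝ) + 6 ≤ 2 ^ (1 / 10 * n : ℝ) := by nlinarith
    calc _ ≤ (2 : ℝ) ^ (1 / 10 * n : ℝ) * 2 ^ (-(3 / 10 * n : ℝ)) := by gcongr
      _ ≤ _ := by
        rw [← Real.rpow_add (by norm_num)]
        exact Real.rpow_le_rpow_of_exponent_le (by norm_num) (by linarith)
  refine hsum'.trans ?_
  calc _ ≤ n * 2 ^ (-(3 / 10 * n : ℝ)) * L + n * 2 ^ (-(3 / 10 * n : ℝ)) * L +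
        ((2 * 2 ^ n : ℕ) : ℝ) * (q * L + q * L + q * L) := by
        gcongr <;> exact hN
    _ = (2 * n * 2 ^ (-(3 / 10 * n : ℝ)) + 3 * (((2 * 2 ^ n : ℕ) : ℝ) * q)) * L := by ring
    _ ≤ (2 * n * 2 ^ (-(3 / 10 * n : ℝ)) + 3 * (2 * 2 ^ (-(3 / 10 * n : ℝ)))) * L := by
      rw [e1]; gcongr
    _ = (2 * (n : ℝ) + 6) * 2 ^ (-(3 / 10 * n : ℝ)) * L := by ring
    _ ≤ _ := by gcongr

theorem isUnipolar_iff_ncard_centralCliques_ne_zero {V : Type*} [Fintype V] (G : SimpleGraph V) :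
    IsUnipolar G ↔ (centralCliques G).ncard ≠ 0 := by
  rw [Ne, Set.ncard_eq_zero (Set.toFinite _), ← Ne, ← Set.nonempty_iff_ne_empty]
  constructor
  · rintro ⟨C, hC⟩
    exact ⟨C.toFinset, by simpa [centralCliques] using hC⟩
  · rintro ⟨C, hC⟩
    exact ⟨C, hC⟩

theorem isGenSplit_iff_genR_ne_zero {n : ℕ} (G : SimpleGraph (Fin n)) : IsGenSplit G ↔ genR G ≠ 0 := by
  rw [IsGenSplit, IsCoUnipolar, isUnipolar_iff_ncard_centralCliques_ne_zero,
    isUnipolar_iff_ncard_centralCliques_ne_zero, genR_eq]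
  omega

theorem sum_isPerfect (n : ℕ) :
    ∑ G : SimpleGraph (Fin n), (if IsPerfect G then (1 : ℝ) else 0) = perfectCount n := by
  rw [perfectCount, Finset.sum_boole, Nat.card_eq_fintype_card, Fintype.card_subtype]

theorem sum_abs_isPerfect_sub_genR_le (n : ℕ) :
    ∑ G : SimpleGraph (Fin n), |(if IsPerfect G then (1 : ℝ) else 0) - genR G| ≤
      {G : SimpleGraph (Fin n) | C5Free G ∧ ¬IsGenSplit G}.ncard +
        ((∑ G : SimpleGraph (Fin n), (genR G - 1) : ℕ) : ℝ) := by
  rw [Set.ncard_eq_toFinset_card', Set.toFinset_ofPred, Finset.card_filter]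
  push_cast
  rw [← Finset.sum_add_distrib]
  refine Finset.sum_le_sum fun G _ => ?_
  by_cases hG : IsGenSplit G
  · have h1 : 1 ≤ genR G := Nat.one_le_iff_ne_zero.2 ((isGenSplit_iff_genR_ne_zero G).1 hG)
    have h2 : (1 : ℝ) ≤ genR G := by exact_mod_cast h1
    rw [if_pos hG.isPerfect, Nat.cast_sub h1, abs_sub_comm, abs_of_nonneg (by linarith)]
    simp [hG]
  · have h1 : genR G = 0 := by
      by_contra h
      exact hG ((isGenSplit_iff_genR_ne_zero G).2 h)
    by_cases hP : IsPerfect G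
    · simp [hP, h1, hG, hP.c5Free]
    · simp only [hP, h1, if_false, Nat.cast_zero, sub_zero, abs_zero]
      positivity

theorem exists_sum_abs_isPerfect_sub_genR_le : ∃ κ : ℝ, 0 < κ ∧ ∀ᶠ n : ℕ in atTop,
    ∑ G : SimpleGraph (Fin n), |(if IsPerfect G then (1 : ℝ) else 0) - genR G| ≤
      2 * 2 ^ (-(κ * n)) * scrL n := by
  obtain ⟨κ₁, h1, H1⟩ := exists_few_not_isGenSplit
  obtain ⟨κ₂, h2, H2⟩ := exists_sum_genR_sub_one_le
  refine ⟨min κ₁ κ₂, lt_min h1 h2, ?_⟩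
  filter_upwards [H1, H2] with n e1 e2
  refine (sum_abs_isPerfect_sub_genR_le n).trans ((add_le_add e1 e2).trans ?_)
  have a1 : (2 : ℝ) ^ (-(κ₁ * n)) ≤ 2 ^ (-(min κ₁ κ₂ * n)) := by
    gcongr
    · norm_num
    · exact min_le_left _ _
  have a2 : (2 : ℝ) ^ (-(κ₂ * n)) ≤ 2 ^ (-(min κ₁ κ₂ * n)) := by
    gcongr
    · norm_num
    · exact min_le_right _ _
  rw [← add_mul, two_mul]
  gcongr

/-- Many graphs have two central cliques, differing in a vertex isolated outside of them. -/
theorem scrL_le_mul_ncard (n : ℕ) (hn : 1 ≤ n) :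
    scrL n ≤ {G : SimpleGraph (Fin n) | 2 ≤ genR G}.ncard * (2 ^ n * 2 ^ n) := by
  let v : Fin n := ⟨0, hn⟩
  have h1 := ncard_arrangements (Fin n)
  rw [Fintype.card_fin] at h1
  have h2 : (Set.univ : Set (Finset (Fin n))).ncard = 2 ^ n := by
    rw [Set.ncard_univ, Nat.card_eq_fintype_card, Fintype.card_finset, Fintype.card_fin]
  rw [← h1, ← h2, ← Set.ncard_prod, ← Set.ncard_prod]
  refine Set.ncard_le_ncard_of_injOn (fun p => (setNbr p.1 v (p.2 : Set (Fin n)), p.2,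
    Finset.univ.filter (p.1.Adj v))) ?_ ?_ (Set.toFinite _)
  · rintro ⟨G, C⟩ hG
    obtain ⟨hc, hf⟩ := (isUnipolarArrangement_iff G (C : Set (Fin n))).1 hG
    refine ⟨?_, Set.mem_univ _, Set.mem_univ _⟩
    set H := setNbr G v (C : Set (Fin n)) with hH
    have hadj : ∀ x, x ∉ C → ¬H.Adj v x := by
      intro x hx h
      exact hx (by simpa using (setNbr_adj_left h.ne').1 h)
    have hcl : H.IsClique (insert v (C : Set (Fin n))) := by
      intro x hx y hy hne
      by_cases hxv : x = v
      · subst hxv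
        have : y ∈ (C : Set (Fin n)) := by
          rcases hy with rfl | hy
          · exact absurd rfl hne
          · exact hy
        exact (setNbr_adj_left (Ne.symm hne)).2 this
      by_cases hyv : y = v
      · subst hyv
        have : x ∈ (C : Set (Fin n)) := by
          rcases hx with rfl | hx
          · exact absurd rfl hne
          · exact hx
        exact (setNbr_adj_right hne).2 this
      rw [hH, setNbr_adj hxv hyv]
      exact hc (hx.resolve_left hxv) (hy.resolve_left hyv) hne
    have harr : ∀ D : Finset (Fin n), (∀ x, x ≠ v → (x ∈ D ↔ x ∈ C)) → D ∈ centralCliques H := by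
      intro D hD
      refine (isUnipolarArrangement_iff _ _).2 ⟨hcl.subset fun x hx => ?_,
        fun x hx y hy z hz h1 h2 hne => ?_⟩
      · by_cases hxv : x = v
        · exact .inl hxv
        · exact .inr ((hD x hxv).1 hx)
      · have hout : ∀ w, w ∈ (D : Set (Fin n))ᶜ → w ≠ v → w ∉ C := by
          intro w hw hwv h
          exact hw ((hD w hwv).2 h)
        by_cases hxv : x = v
        · subst hxv
          exact absurd h1 (hadj y (hout y hy h1.ne'))
        by_cases hyv : y = v
        · subst hyv
          exact absurd h1.symm (hadj x (hout x hx hxv))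
        by_cases hzv : z = v
        · subst hzv
          exact absurd h2.symm (hadj y (hout y hy hyv))
        rw [hH, setNbr_adj hxv hyv] at h1
        rw [hH, setNbr_adj hyv hzv] at h2
        rw [hH, setNbr_adj hxv hzv]
        exact hf x (hout x hx hxv) y (hout y hy hyv) z (hout z hz hzv) h1 h2 hne
    have h3 : 2 ≤ (centralCliques H).ncard := by
      have h4 : ({insert v C, C.erase v} : Set (Finset (Fin n))).ncard = 2 :=
        Set.ncard_pair fun h => Finset.notMem_erase v C (h ▸ Finset.mem_insert_self v C)
      rw [← h4]
      refine Set.ncard_le_ncard ?_ (Set.toFinite _)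
      rintro D (rfl | rfl)
      · exact harr _ fun x hx => by simp [hx]
      · exact harr _ fun x hx => by simp [hx]
    change 2 ≤ genR H
    rw [genR_eq]
    omega
  · rintro ⟨G, C⟩ - ⟨G', C'⟩ - he
    simp only [Prod.mk.injEq] at he
    obtain ⟨e1, e2, e3⟩ := he
    refine Prod.ext ?_ e2
    have hv : ∀ x, G.Adj v x ↔ G'.Adj v x := by
      intro x
      simpa using Finset.ext_iff.1 e3 x
    ext x y
    change G.Adj x y ↔ G'.Adj x y
    by_cases hx : x = v
    · subst hx; exact hv y
    by_cases hy : y = v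
    · subst hy; rw [G.adj_comm, G'.adj_comm]; exact hv x
    · rw [← setNbr_adj (G := G) hx hy, e1, setNbr_adj hx hy]

theorem tv_le {n : ℕ} {L p E : ℝ} (hL : 0 < L) (hp : 0 < p)
    (hpn : ∑ G : SimpleGraph (Fin n), (if IsPerfect G then (1 : ℝ) else 0) = p)
    (hR : ∑ G : SimpleGraph (Fin n), (genR G : ℝ) = 2 * L)
    (hE : ∑ G : SimpleGraph (Fin n), |(if IsPerfect G then (1 : ℝ) else 0) - genR G| ≤ E) :
    (1 / 2) * ∑ G : SimpleGraph (Fin n), |(if IsPerfect G then (1 : ℝ) else 0) / p -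
      (genR G : ℝ) / (2 * L)| ≤ E / (2 * L) := by
  have h1 : |p - 2 * L| ≤ E := by
    rw [← hpn, ← hR, ← Finset.sum_sub_distrib]
    exact (Finset.abs_sum_le_sum_abs _ _).trans hE
  have h2 : ∀ G : SimpleGraph (Fin n), |(if IsPerfect G then (1 : ℝ) else 0) / p -
      (genR G : ℝ) / (2 * L)| ≤ (if IsPerfect G then (1 : ℝ) else 0) * (|p - 2 * L| / (p * (2 * L))) +
        |(if IsPerfect G then (1 : ℝ) else 0) - genR G| / (2 * L) := by
    intro G
    have h3 : (if IsPerfect G then (1 : ℝ) else 0) / p - (genR G : ℝ) / (2 * L) =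
        (if IsPerfect G then (1 : ℝ) else 0) * ((2 * L - p) / (p * (2 * L))) +
          ((if IsPerfect G then (1 : ℝ) else 0) - genR G) / (2 * L) := by
      field_simp; ring
    have h4 : (0 : ℝ) ≤ if IsPerfect G then 1 else 0 := by split_ifs <;> norm_num
    rw [h3]
    refine (abs_add_le _ _).trans_eq ?_
    rw [abs_mul, abs_div, abs_div, abs_of_nonneg h4, abs_sub_comm (2 * L),
      abs_of_pos (show 0 < p * (2 * L) by positivity), abs_of_pos (show 0 < 2 * L by positivity)]
  have h5 := Finset.sum_le_sum fun G (_ : G ∈ (Finset.univ : Finset (SimpleGraph (Fin n)))) => h2 G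
  rw [Finset.sum_add_distrib, ← Finset.sum_mul, ← Finset.sum_div, hpn] at h5
  have h6 : p * (|p - 2 * L| / (p * (2 * L))) = |p - 2 * L| / (2 * L) := by field_simp
  rw [h6] at h5
  have h7 : |p - 2 * L| / (2 * L) ≤ E / (2 * L) := by gcongr
  have h8 : (∑ G : SimpleGraph (Fin n), |(if IsPerfect G then (1 : ℝ) else 0) - genR G|) / (2 * L) ≤
      E / (2 * L) := by gcongr
  linarith

theorem le_tv {n : ℕ} (hn : 1 ≤ n) {p E : ℝ}
    (hpn : ∑ G : SimpleGraph (Fin n), (if IsPerfect G then (1 : ℝ) else 0) = p)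
    (hE : ∑ G : SimpleGraph (Fin n), |(if IsPerfect G then (1 : ℝ) else 0) - genR G| ≤ E)
    (hEL : E ≤ 2 / 3 * scrL n) :
    1 / (16 * (2 ^ n * 2 ^ n)) ≤ (1 / 2) * ∑ G : SimpleGraph (Fin n),
      |(if IsPerfect G then (1 : ℝ) else 0) / p - (genR G : ℝ) / (2 * (scrL n : ℝ))| := by
  have hS : (scrL n : ℝ) ≤ _ := Nat.cast_le.2 (scrL_le_mul_ncard n hn)
  have hL1 : (1 : ℝ) ≤ scrL n := by exact_mod_cast one_le_scrL n
  have hR : ∑ G : SimpleGraph (Fin n), (genR G : ℝ) = 2 * scrL n := by exact_mod_cast sum_genR n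
  set L : ℝ := ((scrL n : ℕ) : ℝ)
  have hp : 4 / 3 * L ≤ p := by
    have h1 : |p - 2 * L| ≤ E := by
      rw [← hpn, ← hR, ← Finset.sum_sub_distrib]
      exact (Finset.abs_sum_le_sum_abs _ _).trans hE
    linarith [(abs_le.1 h1).1]
  have hpt : ∀ G : SimpleGraph (Fin n), (if 2 ≤ genR G then (1 : ℝ) else 0) * (1 / (4 * L)) ≤
      |(if IsPerfect G then (1 : ℝ) else 0) / p - (genR G : ℝ) / (2 * L)| := by
    intro G
    by_cases hG : 2 ≤ genR G
    · have h1 : (2 : ℝ) ≤ genR G := by exact_mod_cast hG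
      have h2 : (if IsPerfect G then (1 : ℝ) else 0) / p ≤ 1 / (4 / 3 * L) := by
        have : (if IsPerfect G then (1 : ℝ) else 0) ≤ 1 := by split_ifs <;> norm_num
        gcongr
      have h3 : 2 / (2 * L) ≤ (genR G : ℝ) / (2 * L) := by gcongr
      have h4 : 1 / (4 / 3 * L) = 3 * (1 / (4 * L)) := by field_simp
      have h5 : 2 / (2 * L) = 4 * (1 / (4 * L)) := by field_simp
      rw [if_pos hG, one_mul, abs_sub_comm]
      refine le_trans ?_ (le_abs_self _)
      linarith
    · rw [if_neg hG, zero_mul]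
      positivity
  have hsum := Finset.sum_le_sum fun G (_ : G ∈ (Finset.univ : Finset (SimpleGraph (Fin n)))) => hpt G
  rw [← Finset.sum_mul, Finset.sum_boole, ← Set.ncard_coe_finset, Finset.coe_filter_univ] at hsum
  push_cast at hS
  set N : ℝ := (({G : SimpleGraph (Fin n) | 2 ≤ genR G}.ncard : ℕ) : ℝ)
  have h1 : 1 / (16 * (2 ^ n * 2 ^ n)) ≤ 1 / 2 * (N * (1 / (4 * L))) := by
    have : 1 / 2 * (N * (1 / (4 * L))) = N / (8 * L) := by field_simp; ring
    rw [this, div_le_div_iff₀ (by positivity) (by positivity)]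
    linarith
  linarith

/-- The total variation distance between the uniform distribution on perfect graphs on
`{1,…,n}` and the generated distribution `G ↦ R(G)/(2𝓛_n)` is `e^{-Θ(n)}`. -/
theorem tv_uniform_generated :
    ∃ c C : ℝ, 0 < c ∧ 0 < C ∧ ∃ n₀ : ℕ, ∀ n : ℕ, n₀ ≤ n → 1 ≤ n →
      Real.exp (-(C * n)) ≤
          (1 / 2) * ∑ G : SimpleGraph (Fin n),
            |(if IsPerfect G then (1 : ℝ) else 0) / (perfectCount n : ℝ) -
              (genR G : ℝ) / (2 * (scrL n : ℝ))| ∧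
        (1 / 2) * ∑ G : SimpleGraph (Fin n),
            |(if IsPerfect G then (1 : ℝ) else 0) / (perfectCount n : ℝ) -
              (genR G : ℝ) / (2 * (scrL n : ℝ))| ≤ Real.exp (-(c * n)) := by
  obtain ⟨κ, hκ, H⟩ := exists_sum_abs_isPerfect_sub_genR_le
  have hlog : 0 < Real.log 2 := Real.log_pos one_lt_two
  obtain ⟨n₀, h⟩ := eventually_atTop.1 (H.and (eventually_ge_atTop ⌈2 / κ⌉₊))
  refine ⟨κ * Real.log 2, Real.log 64, by positivity, Real.log_pos (by norm_num), n₀, fun n hn hn1 => ?_⟩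
  obtain ⟨hE, hn2⟩ := h n hn
  have hn2' : 2 / κ ≤ n := (Nat.le_ceil _).trans (by exact_mod_cast hn2)
  rw [div_le_iff₀ hκ] at hn2'
  have hL : (0 : ℝ) < scrL n := by exact_mod_cast one_le_scrL n
  have hR : ∑ G : SimpleGraph (Fin n), (genR G : ℝ) = 2 * scrL n := by exact_mod_cast sum_genR n
  have hsmall : 2 * (2 : ℝ) ^ (-(κ * n)) * scrL n ≤ 2 / 3 * scrL n := by
    have h4 : (2 : ℝ) ^ (-2 : ℝ) = 1 / 4 := by
      rw [Real.rpow_neg (by norm_num), show (2 : ℝ) = ((2 : ℕ) : ℝ) by norm_num, Real.rpow_natCast]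
      norm_num
    have : (2 : ℝ) ^ (-(κ * n)) ≤ 2 ^ (-2 : ℝ) :=
      Real.rpow_le_rpow_of_exponent_le (by norm_num) (by linarith)
    rw [h4] at this
    have : 2 * (2 : ℝ) ^ (-(κ * n)) ≤ 2 / 3 := by linarith
    exact mul_le_mul_of_nonneg_right this hL.le
  have hp : (0 : ℝ) < perfectCount n := by
    have : IsPerfect (⊥ : SimpleGraph (Fin n)) :=
      IsUnipolar.isPerfect ⟨∅, (isUnipolarArrangement_iff _ _).2 ⟨by simp, fun _ _ _ _ _ _ h => h.elim⟩⟩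
    have : Nonempty {G : SimpleGraph (Fin n) // IsPerfect G} := ⟨⟨_, this⟩⟩
    exact_mod_cast (Nat.card_pos : 0 < Nat.card {G : SimpleGraph (Fin n) // IsPerfect G})
  constructor
  · refine le_trans ?_ (le_tv hn1 (sum_isPerfect n) hE hsmall)
    have h16 : (16 : ℝ) ≤ 16 ^ n := le_self_pow₀ (by norm_num) (by omega)
    rw [Real.exp_neg, mul_comm, Real.exp_nat_mul, Real.exp_log (by norm_num), ← one_div]
    refine one_div_le_one_div_of_le (by positivity) ?_
    calc (16 : ℝ) * (2 ^ n * 2 ^ n) ≤ 16 ^ n * (2 ^ n * 2 ^ n) := by gcongr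
      _ = 64 ^ n := by rw [← mul_pow, ← mul_pow]; norm_num
  · refine (tv_le hL hp (sum_isPerfect n) hR hE).trans_eq ?_
    rw [show 2 * (2 : ℝ) ^ (-(κ * n)) * scrL n = 2 ^ (-(κ * n)) * (2 * scrL n) by ring,
      mul_div_assoc, div_self (by positivity), mul_one, Real.rpow_def_of_pos (by norm_num)]
    congr 1; ring
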